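/- Every triangulation of the nonorientable surface N_3 has a nonseparating cycle which is one-sided and orientable-leaving; a nonseparating cycle which is one-sided and nonorientable-leaving; and a nonseparating cycle which is two-sided and nonorientable-leaving. -/

import Mathlib

open scoped Classical

/-- A combinatorial triangulation of a closed surface: a finite set of triangular
faces (3-element subsets of `ℕ`) such that every edge lies in exactly two faces,
the faces around each vertex form a single cycle (the link condition), and the
whole complex is connected.  The underlying simple graph has as edges the
2-element subsets of faces. -/
structure Triangulation where
  faces : Finset (Finset ℕ)
  faces_nonempty : faces.Nonempty
  card_eq_three : ∀ f ∈ faces, f.card = 3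
  edge_in_two_faces : ∀ e : Finset ℕ, e.card = 2 → (∃ f ∈ faces, e ⊆ f) →
    (faces.filter (fun f => e ⊆ f)).card = 2
  link_connected : ∀ v : ℕ, ∀ f ∈ faces, ∀ g ∈ faces, v ∈ f → v ∈ g →
    Relation.ReflTransGen
      (fun f' g' => f' ∈ faces ∧ g' ∈ faces ∧ v ∈ f' ∧ v ∈ g' ∧ (f' ∩ g').card = 2) f g
  face_connected : ∀ f ∈ faces, ∀ g ∈ faces,
    Relation.ReflTransGen
      (fun f' g' => f' ∈ faces ∧ g' ∈ faces ∧ (f' ∩ g').card = 2) f g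

namespace Triangulation

/-- The vertices spanned by a set of faces. -/
def vertsOf (F : Finset (Finset ℕ)) : Finset ℕ := F.sup id

/-- The edges spanned by a set of triangular faces: all 2-element subsets of faces. -/
def edgesOf (F : Finset (Finset ℕ)) : Finset (Finset ℕ) :=
  (Finset.powersetCard 2 (vertsOf F)).filter (fun e => ∃ f ∈ F, e ⊆ f)

/-- The vertex set of a triangulation. -/
def verts (T : Triangulation) : Finset ℕ := vertsOf T.faces

/-- The edge set of a triangulation. -/
def edges (T : Triangulation) : Finset (Finset ℕ) := edgesOf T.faces

/-- The Euler characteristic `V - E + F` of a triangulation. -/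
def euler (T : Triangulation) : ℤ :=
  (T.verts.card : ℤ) - (T.edges.card : ℤ) + (T.faces.card : ℤ)

/-- The three directed edges of an ordered triple (an oriented triangle). -/
def dedges (t : ℕ × ℕ × ℕ) : Finset (ℕ × ℕ) :=
  {(t.1, t.2.1), (t.2.1, t.2.2), (t.2.2, t.1)}

/-- `σ` is a coherent orientation of the set `F` of triangular faces: it assigns to each
face an oriented triangle with that vertex set, so that no directed edge is used twice
(equivalently, the two faces sharing an edge traverse that edge in opposite directions). -/
def IsCoherent (F : Finset (Finset ℕ)) (σ : Finset ℕ → ℕ × ℕ × ℕ) : Prop :=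
  (∀ f ∈ F, ({(σ f).1, (σ f).2.1, (σ f).2.2} : Finset ℕ) = f) ∧
  (∀ f ∈ F, ∀ g ∈ F, f ≠ g → Disjoint (dedges (σ f)) (dedges (σ g)))

/-- A triangulation is orientable if its faces admit a coherent orientation. -/
def Orientable (T : Triangulation) : Prop := ∃ σ, IsCoherent T.faces σ

/-- `T` is a triangulation of the orientable surface `S_g` of genus `g`
(Euler characteristic `2 - 2g`). -/
def IsS (g : ℕ) (T : Triangulation) : Prop :=
  T.euler = 2 - 2 * (g : ℤ) ∧ T.Orientable

/-- `T` is a triangulation of the nonorientable surface `N_g` of genus `g`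
(Euler characteristic `2 - g`). -/
def IsN (g : ℕ) (T : Triangulation) : Prop :=
  T.euler = 2 - (g : ℤ) ∧ ¬ T.Orientable

/-- The edges of the cyclic vertex sequence `c`. -/
def cycEdges (c : List ℕ) : Finset (Finset ℕ) :=
  (Finset.range c.length).image
    (fun i => ({c.getD i 0, c.getD ((i + 1) % c.length) 0} : Finset ℕ))

/-- `c` is a cycle of the triangulation `T`: at least three distinct vertices,
consecutive ones (cyclically) joined by edges of `T`. -/
def IsCycle (T : Triangulation) (c : List ℕ) : Prop :=
  3 ≤ c.length ∧ c.Nodup ∧ ∀ e ∈ cycEdges c, e ∈ T.edges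

/-- Faces `f` and `g` lie in the same component of `S - C`, where `C` is the closed curve
corresponding to the cycle `c`: they are joined by a chain of faces consecutively sharing
edges that are not edges of the cycle. -/
def SameSide (T : Triangulation) (c : List ℕ) (f g : Finset ℕ) : Prop :=
  Relation.ReflTransGen
    (fun f' g' => f' ∈ T.faces ∧ g' ∈ T.faces ∧ (f' ∩ g').card = 2 ∧
      f' ∩ g' ∉ cycEdges c) f g

/-- The cycle `c` separates the surface: `S - C` is disconnected. -/
def Separating (T : Triangulation) (c : List ℕ) : Prop :=
  ∃ f ∈ T.faces, ∃ g ∈ T.faces, ¬ SameSide T c f g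

/-- The faces in the component of `S - C` containing the face `f`. -/
noncomputable def sideFaces (T : Triangulation) (c : List ℕ) (f : Finset ℕ) :
    Finset (Finset ℕ) :=
  T.faces.filter (fun g => SameSide T c f g)

/-- The Euler characteristic of the component of `f` in the surface cut along the cycle
`c`, capped with a single new face (`+1`). -/
noncomputable def sideEuler (T : Triangulation) (c : List ℕ) (f : Finset ℕ) : ℤ :=
  ((vertsOf (sideFaces T c f)).card : ℤ) - ((edgesOf (sideFaces T c f)).card : ℤ)
    + ((sideFaces T c f).card : ℤ) + 1

/-- The Euler genus `2 - χ` of the capped component of `f` in the surface cut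
along the cycle `c`. -/
noncomputable def sideEulerGenus (T : Triangulation) (c : List ℕ) (f : Finset ℕ) : ℤ :=
  2 - sideEuler T c f

/-- The capped component of `f` in the surface cut along the cycle `c` is orientable. -/
def SideOrientable (T : Triangulation) (c : List ℕ) (f : Finset ℕ) : Prop :=
  ∃ σ, IsCoherent (sideFaces T c f) σ

/-- `c` is a noncontractible separating cycle (NSC): it separates the surface and
neither capped component is a triangulation of the sphere (`χ = 2`). -/
def IsNSC (T : Triangulation) (c : List ℕ) : Prop :=
  IsCycle T c ∧ Separating T c ∧ ∀ f ∈ T.faces, sideEuler T c f ≠ 2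

/-- A coherent orientation of the faces of `T` in which the gluing across the edges of the
cycle `c` is ignored: this orients the surface obtained by cutting along `c`. -/
def IsCutCoherent (T : Triangulation) (c : List ℕ) (σ : Finset ℕ → ℕ × ℕ × ℕ) : Prop :=
  (∀ f ∈ T.faces, ({(σ f).1, (σ f).2.1, (σ f).2.2} : Finset ℕ) = f) ∧
  (∀ f ∈ T.faces, ∀ g ∈ T.faces, f ≠ g → f ∩ g ∉ cycEdges c →
    Disjoint (dedges (σ f)) (dedges (σ g)))

/-- The cycle `c` is orientable-leaving: the surface obtained by cutting along `c`
is orientable. -/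
def OrientableLeaving (T : Triangulation) (c : List ℕ) : Prop :=
  ∃ σ, IsCutCoherent T c σ

/-- A corner of the cycle `c`: a pair `(i, f)` where `f` is a face containing the `i`-th
vertex of `c`. -/
def IsCorner (T : Triangulation) (c : List ℕ) (x : ℕ × Finset ℕ) : Prop :=
  x.1 < c.length ∧ x.2 ∈ T.faces ∧ c.getD x.1 0 ∈ x.2

/-- Two corners lie on a common boundary segment of the surface cut along `c`:
either they are corners at the same cycle vertex whose faces share an edge through that
vertex not lying on the cycle, or they are corners of one face containing a cycle edge,
at the two endpoints of that edge. -/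
def CornerRel (T : Triangulation) (c : List ℕ) (x y : ℕ × Finset ℕ) : Prop :=
  IsCorner T c x ∧ IsCorner T c y ∧
  ((x.1 = y.1 ∧ (x.2 ∩ y.2).card = 2 ∧ c.getD x.1 0 ∈ x.2 ∩ y.2 ∧
      x.2 ∩ y.2 ∉ cycEdges c) ∨
    (y.1 = (x.1 + 1) % c.length ∧ x.2 = y.2 ∧
      ({c.getD x.1 0, c.getD y.1 0} : Finset ℕ) ⊆ x.2))

/-- The cycle `c` is one-sided: cutting the surface along `c` produces a single boundary
cycle, i.e. all corners along `c` lie on one boundary component (the neighborhood of the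
curve is a Möbius band).  A nonseparating cycle is two-sided iff it is not one-sided. -/
def OneSided (T : Triangulation) (c : List ℕ) : Prop :=
  ∀ x y, IsCorner T c x → IsCorner T c y → Relation.EqvGen (CornerRel T c) x y

/-- The 3-cycles (triangles) of the graph of `T`. -/
def triangles (T : Triangulation) : Finset (Finset ℕ) :=
  (Finset.powersetCard 3 T.verts).filter
    (fun t => ∀ e ∈ Finset.powersetCard 2 t, e ∈ T.edges)

/-- An edge of `T` is contractible iff it lies in exactly two 3-cycles of the graph of
`T` (for any triangulation other than `K₄` on the sphere, this is equivalent to the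
contraction of the edge yielding again a triangulation of the same surface). -/
def ContractibleEdge (T : Triangulation) (e : Finset ℕ) : Prop :=
  e ∈ T.edges ∧ (T.triangles.filter (fun t => e ⊆ t)).card = 2

/-- A triangulation is irreducible if it has no contractible edge. -/
def Irreducible (T : Triangulation) : Prop :=
  ∀ e, ¬ ContractibleEdge T e

/-- Two face sets are equivalent if some relabelling of the vertices carries one onto the
other (such a bijection carries faces to faces and hence edges to edges). -/
def FacesEquiv (F F' : Finset (Finset ℕ)) : Prop :=
  ∃ φ : ℕ ≃ ℕ, F' = F.image (fun f => f.image φ)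

/-- Two triangulations are equivalent if some vertex bijection carries faces to faces
(and hence edges to edges). -/
def EquivTri (T T' : Triangulation) : Prop := FacesEquiv T.faces T'.faces

/-- `T'` is obtained from `T` by a diagonal flip: the edge `{a,c}`, lying in the faces
`{a,b,c}` and `{a,c,d}` with `{b,d}` not an edge, is replaced by `{b,d}` and the two
faces by `{a,b,d}` and `{b,c,d}`. -/
def Flip (T T' : Triangulation) : Prop :=
  ∃ a b c d : ℕ, ({a, b, c} : Finset ℕ) ∈ T.faces ∧ ({a, c, d} : Finset ℕ) ∈ T.faces ∧
    b ≠ d ∧ ({b, d} : Finset ℕ) ∉ T.edges ∧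
    T'.faces = (T.faces \ {({a, b, c} : Finset ℕ), ({a, c, d} : Finset ℕ)}) ∪
      {({a, b, d} : Finset ℕ), ({b, c, d} : Finset ℕ)}

/-- Two triangulations are equivalent under diagonal flips if a finite sequence of
diagonal flips transforms one into a triangulation equivalent to the other. -/
def FlipEquiv (T T' : Triangulation) : Prop :=
  ∃ T'' : Triangulation, Relation.ReflTransGen Flip T T'' ∧ EquivTri T'' T'

end Triangulation

namespace SimpleGraph

variable {V : Type*} {G : SimpleGraph V}

namespace Walk

/-- Splitting a walk at its first vertex in `S`. -/
theorem exists_first_hit {u v : V} (p : G.Walk u v) (S : Set V) (h : ∃ w ∈ p.support, w ∈ S) :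
    ∃ (w : V) (q : G.Walk u w) (r : G.Walk w v), p = q.append r ∧ w ∈ S ∧
      ∀ x ∈ q.support, x ∈ S → x = w := by
  induction p with
  | nil =>
    obtain ⟨w, hw, hS⟩ := h
    simp only [support_nil, List.mem_singleton] at hw
    subst hw
    exact ⟨_, nil, nil, rfl, hS, by simp⟩
  | @cons a b c hab p ih =>
    by_cases ha : a ∈ S
    · exact ⟨a, nil, cons hab p, rfl, ha, by simp⟩
    · obtain ⟨w, hw, hS⟩ := h
      have hw' : w ∈ p.support := by
        rcases List.mem_cons.1 hw with rfl | h
        · exact absurd hS ha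
        · exact h
      obtain ⟨w, q, r, rfl, hwS, hq⟩ := ih ⟨w, hw', hS⟩
      refine ⟨w, cons hab q, r, rfl, hwS, fun x hx hxS => ?_⟩
      rcases List.mem_cons.1 hx with rfl | h
      · exact absurd hxS ha
      · exact hq x h hxS

/-- A walk from `A` to `B` contains a path from `A` to `B` meeting both sets only at its ends. -/
theorem exists_trimmed {u v : V} (p : G.Walk u v) (A B : Finset V) (hu : u ∈ A) (hv : v ∈ B) :
    ∃ (s t : V) (q : G.Walk s t), q.IsPath ∧ s ∈ A ∧ t ∈ B ∧ (∀ x ∈ q.support, x ∈ p.support) ∧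
      (∀ x ∈ q.support, x ∈ A → x = s) ∧ (∀ x ∈ q.support, x ∈ B → x = t) := by
  obtain ⟨t, q, r, hqr, ht, hq⟩ := p.bypass.exists_first_hit (↑B) ⟨v, end_mem_support _, hv⟩
  have hp := p.bypass_isPath
  rw [hqr] at hp
  have hqp := hp.of_append_left
  obtain ⟨s, q', r', hqr', hs, hq'⟩ :=
    q.reverse.exists_first_hit (↑A) ⟨u, end_mem_support _, hu⟩
  have hsub : ∀ x ∈ q'.support, x ∈ q.support := fun x hx => by
    have : x ∈ q.reverse.support := by
      rw [hqr', mem_support_append_iff]; exact Or.inl hx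
    simpa using this
  have hqrp : q.reverse.IsPath := (isPath_reverse_iff q).2 hqp
  rw [hqr'] at hqrp
  refine ⟨s, t, q'.reverse, (isPath_reverse_iff _).2 hqrp.of_append_left, hs, ht, ?_, ?_, ?_⟩
  · intro x hx
    apply p.support_bypass_subset_support
    rw [hqr, mem_support_append_iff]
    exact Or.inl (hsub x (by simpa using hx))
  · intro x hx hA
    exact hq' x (by simpa using hx) hA
  · intro x hx hB
    exact hq x (hsub x (by simpa using hx)) hB

theorem IsPath.eq_of_start_mem_dropUntil {u v w : V} {p : G.Walk u v} (hp : p.IsPath)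
    (hw : w ∈ p.support) (h : u ∈ (p.dropUntil w hw).support) : u = w := by
  by_contra hne
  rw [← p.take_spec hw] at hp
  have hn := hp.support_nodup
  rw [support_append, List.nodup_append'] at hn
  refine hn.2.2 (start_mem_support _) ?_
  rw [mem_support_iff] at h
  exact h.resolve_left hne

theorem IsPath.eq_of_end_mem_takeUntil {u v w : V} {p : G.Walk u v} (hp : p.IsPath)
    (hw : w ∈ p.support) (h : v ∈ (p.takeUntil w hw).support) : v = w := by
  by_contra hne
  exact endpoint_notMem_support_takeUntil hp hw (by rintro rfl; exact hne rfl) h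

theorem deleteEdge_cases {x y : V} (T : Set V) {a b : V} (p : G.Walk a b)
    (hp : ∀ z ∈ p.support, z ∉ T) :
    (∃ q : (G.deleteEdges {s(x, y)}).Walk a b, ∀ z ∈ q.support, z ∉ T) ∨
    ((∃ q : (G.deleteEdges {s(x, y)}).Walk a x, ∀ z ∈ q.support, z ∉ T) ∧
      ∃ q : (G.deleteEdges {s(x, y)}).Walk y b, ∀ z ∈ q.support, z ∉ T) ∨
    ((∃ q : (G.deleteEdges {s(x, y)}).Walk a y, ∀ z ∈ q.support, z ∉ T) ∧
      ∃ q : (G.deleteEdges {s(x, y)}).Walk x b, ∀ z ∈ q.support, z ∉ T) := by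
  induction p with
  | nil => exact Or.inl ⟨nil, by simpa using hp⟩
  | @cons a c b hac p ih =>
    have haT : a ∉ T := hp a (by simp)
    have ih := ih fun z hz => hp z (by simp [hz])
    have nil' : ∃ q : (G.deleteEdges {s(x, y)}).Walk a a, ∀ z ∈ q.support, z ∉ T :=
      ⟨nil, by simpa using haT⟩
    by_cases he : s(a, c) = s(x, y)
    · rcases Sym2.eq_iff.1 he with ⟨rfl, rfl⟩ | ⟨rfl, rfl⟩
      · rcases ih with h | ⟨-, h⟩ | ⟨-, h⟩
        · exact Or.inr (Or.inl ⟨nil', h⟩)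
        · exact Or.inr (Or.inl ⟨nil', h⟩)
        · exact Or.inl h
      · rcases ih with h | ⟨-, h⟩ | ⟨-, h⟩
        · exact Or.inr (Or.inr ⟨nil', h⟩)
        · exact Or.inl h
        · exact Or.inr (Or.inr ⟨nil', h⟩)
    · have hadj : (G.deleteEdges {s(x, y)}).Adj a c := by
        rw [deleteEdges_adj]; exact ⟨hac, by simpa using he⟩
      have ext : ∀ {d : V}, (∃ q : (G.deleteEdges {s(x, y)}).Walk c d, ∀ z ∈ q.support, z ∉ T) →
          ∃ q : (G.deleteEdges {s(x, y)}).Walk a d, ∀ z ∈ q.support, z ∉ T := by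
        rintro d ⟨q, hq⟩
        refine ⟨cons hadj q, fun z hz => ?_⟩
        rcases List.mem_cons.1 hz with rfl | h
        · exact haT
        · exact hq z h
      rcases ih with h | ⟨h, h'⟩ | ⟨h, h'⟩
      · exact Or.inl (ext h)
      · exact Or.inr (Or.inl ⟨ext h, h'⟩)
      · exact Or.inr (Or.inr ⟨ext h, h'⟩)

end Walk

/-- `k` pairwise disjoint paths from `A` to `B` meeting `A` and `B` only at their ends. -/
def Linkage (G : SimpleGraph V) (A B : Finset V) (k : ℕ) : Prop :=
  ∃ (s t : Fin k → V) (P : ∀ i, G.Walk (s i) (t i)),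
    (∀ i, (P i).IsPath ∧ s i ∈ A ∧ t i ∈ B ∧ (∀ x ∈ (P i).support, x ∈ A → x = s i) ∧
      (∀ x ∈ (P i).support, x ∈ B → x = t i)) ∧
    ∀ i j, i ≠ j → ∀ x ∈ (P i).support, x ∉ (P j).support

/-- `S` meets every walk from `A` to `B`. -/
def Cuts (G : SimpleGraph V) (A B S : Finset V) : Prop :=
  ∀ a ∈ A, ∀ b ∈ B, ∀ p : G.Walk a b, ∃ x ∈ p.support, x ∈ S

theorem linkage_of_walks {A B : Finset V} {k : ℕ} (s t : Fin k → V) (P : ∀ i, G.Walk (s i) (t i))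
    (hs : ∀ i, s i ∈ A) (ht : ∀ i, t i ∈ B)
    (hd : ∀ i j, i ≠ j → ∀ x ∈ (P i).support, x ∉ (P j).support) : G.Linkage A B k := by
  choose s' t' P' h1 h2 h3 h4 h5 h6 using
    fun i => (P i).exists_trimmed A B (hs i) (ht i)
  exact ⟨s', t', P', fun i => ⟨h1 i, h2 i, h3 i, h5 i, h6 i⟩,
    fun i j hij x hx hx' => hd i j hij x (h4 i x hx) (h4 j x hx')⟩

theorem linkage_combine {x y : V} (hxy : G.Adj x y) {A B S : Finset V} {k : ℕ}
    (hcard : S.card + 1 = k) (hx : x ∉ S) (hy : y ∉ S)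
    (hS : (G.deleteEdges {s(x, y)}).Cuts A B S)
    (hP : (G.deleteEdges {s(x, y)}).Linkage A (insert x S) k)
    (hQ : (G.deleteEdges {s(x, y)}).Linkage (insert y S) B k) : G.Linkage A B k := by
  obtain ⟨sP, tP, P, hP, hPd⟩ := hP
  obtain ⟨sQ, tQ, Q, hQ, hQd⟩ := hQ
  have hle : G.deleteEdges {s(x, y)} ≤ G := deleteEdges_le _
  have htinj : Function.Injective tP := fun i j hij => by
    by_contra hne
    exact hPd i j hne (tP i) (Walk.end_mem_support _) (by rw [hij]; exact Walk.end_mem_support _)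
  have hsinj : Function.Injective sQ := fun i j hij => by
    by_contra hne
    exact hQd i j hne (sQ i) (Walk.start_mem_support _)
      (by rw [hij]; exact Walk.start_mem_support _)
  have hsurj : ∀ z ∈ insert y S, ∃ j, sQ j = z := by
    have h1 : (Finset.univ.image sQ) ⊆ insert y S := by
      intro z hz
      obtain ⟨j, -, rfl⟩ := Finset.mem_image.1 hz
      exact (hQ j).2.1
    have h2 : Finset.univ.image sQ = insert y S := by
      apply Finset.eq_of_subset_of_card_le h1
      rw [Finset.card_image_of_injective _ hsinj, Finset.card_insert_of_notMem hy]
      simp [hcard]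
    intro z hz
    rw [← h2] at hz
    obtain ⟨j, -, rfl⟩ := Finset.mem_image.1 hz
    exact ⟨j, rfl⟩
  have key : ∀ i, ∃ j, (sQ j = if tP i = x then y else tP i) := by
    intro i
    apply hsurj
    have := (hP i).2.2.1
    split_ifs with h
    · simp
    · rw [Finset.mem_insert] at this ⊢; tauto
  choose j hj using key
  have hφ : ∀ i i', (sQ (j i) = sQ (j i')) → i = i' := by
    intro i i' h
    rw [hj, hj] at h
    apply htinj
    have h1 := (hP i).2.2.1
    have h2 := (hP i').2.2.1
    rw [Finset.mem_insert] at h1 h2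
    split_ifs at h with a b b
    · rw [a, b]
    · exfalso; rw [h] at hy; tauto
    · exfalso; rw [← h] at hy; tauto
    · exact h
  have hW : ∀ i, ∃ W : G.Walk (sP i) (tQ (j i)),
      ∀ z ∈ W.support, z ∈ (P i).support ∨ z ∈ (Q (j i)).support := by
    intro i
    have hconn : ∃ W : G.Walk (tP i) (sQ (j i)), ∀ z ∈ W.support, z = tP i ∨ z = sQ (j i) := by
      have h := hj i
      generalize sQ (j i) = b at h ⊢
      generalize tP i = a at h ⊢
      by_cases hax : a = x
      · rw [if_pos hax] at h
        subst hax h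
        exact ⟨hxy.toWalk, by simp⟩
      · rw [if_neg hax] at h
        subst h
        exact ⟨Walk.nil, by simp⟩
    obtain ⟨W, hW⟩ := hconn
    refine ⟨((P i).mapLe hle).append (W.append ((Q (j i)).mapLe hle)), fun z hz => ?_⟩
    rw [Walk.mem_support_append_iff, Walk.mem_support_append_iff, Walk.support_mapLe_eq_support,
      Walk.support_mapLe_eq_support] at hz
    rcases hz with h | h | h
    · exact Or.inl h
    · rcases hW z h with rfl | rfl
      · exact Or.inl (Walk.end_mem_support _)
      · exact Or.inr (Walk.start_mem_support _)
    · exact Or.inr h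
  choose W hW using hW
  have cross : ∀ i i' w, w ∈ (P i).support → w ∈ (Q (j i')).support → i = i' := by
    intro i i' w hw hw'
    obtain ⟨z, hz, hzS⟩ := hS _ (hP i).2.1 _ (hQ (j i')).2.2.1
      (((P i).takeUntil w hw).append ((Q (j i')).dropUntil w hw'))
    have hwS : w ∈ S := by
      rw [Walk.mem_support_append_iff] at hz
      rcases hz with hz | hz
      · have hzt := (hP i).2.2.2.2 z (Walk.support_takeUntil_subset_support _ _ hz) (by simp [hzS])
        rw [← (hP i).1.eq_of_end_mem_takeUntil hw (hzt ▸ hz), ← hzt]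
        exact hzS
      · have hzt := (hQ (j i')).2.2.2.1 z (Walk.support_dropUntil_subset_support _ _ hz)
          (by simp [hzS])
        rw [← (hQ (j i')).1.eq_of_start_mem_dropUntil hw' (hzt ▸ hz), ← hzt]
        exact hzS
    have h1 := (hP i).2.2.2.2 w hw (by simp [hwS])
    have h2 := (hQ (j i')).2.2.2.1 w hw' (by simp [hwS])
    apply hφ
    rw [← h2, hj, if_neg (by rw [← h1]; rintro rfl; exact hx hwS), h1]
  refine linkage_of_walks _ _ W (fun i => (hP i).2.1) (fun i => (hQ (j i)).2.2.1) ?_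
  intro i i' hne w hw hw'
  rcases hW i w hw with h | h <;> rcases hW i' w hw' with h' | h'
  · exact hPd i i' hne w h h'
  · exact hne (cross i i' w h h')
  · exact hne (cross i' i w h' h).symm
  · refine hQd (j i) (j i') (fun h => hne (hφ i i' (by rw [h]))) w h h'

/-- Menger's theorem for vertex-disjoint paths between two sets. -/
theorem menger (A B : Finset V) (k : ℕ) (hfin : G.edgeSet.Finite)
    (h : ∀ S, G.Cuts A B S → k ≤ S.card) : G.Linkage A B k := by
  induction hn : G.edgeSet.ncard using Nat.strong_induction_on generalizing G A B with
  | _ n ih =>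
  by_cases hE : ∃ x y, G.Adj x y
  · obtain ⟨x, y, hxy⟩ := hE
    set H := G.deleteEdges {s(x, y)} with hH
    have hle : H ≤ G := deleteEdges_le _
    have hHE : H.edgeSet = G.edgeSet \ {s(x, y)} := by rw [hH, edgeSet_deleteEdges]
    have hHfin : H.edgeSet.Finite := by rw [hHE]; exact hfin.sdiff
    have hHlt : H.edgeSet.ncard < n := by
      rw [hHE, ← hn]
      exact Set.ncard_sdiff_singleton_lt_of_mem (by simpa using hxy) hfin
    have IH := fun (A B : Finset V) (h : ∀ S, H.Cuts A B S → k ≤ S.card) =>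
      ih _ hHlt A B hHfin h rfl
    by_cases hall : ∀ S, H.Cuts A B S → k ≤ S.card
    · obtain ⟨s, t, P, hP, hd⟩ := IH A B hall
      refine ⟨s, t, fun i => (P i).mapLe hle, fun i => ?_, fun i j hij => ?_⟩
      · simp only [Walk.support_mapLe_eq_support]
        exact ⟨(Walk.isPath_mapLe hle).2 (hP i).1, (hP i).2⟩
      · simp only [Walk.support_mapLe_eq_support]
        exact hd i j hij
    · push Not at hall
      obtain ⟨S, hS, hSk⟩ := hall
      have hnc : ¬ G.Cuts A B S := fun hc => absurd (h S hc) (by omega)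
      have main : ∀ x y, G.Adj x y → H = G.deleteEdges {s(x, y)} →
          (∃ a ∈ A, ∃ p1 : H.Walk a x, ∀ z ∈ p1.support, z ∉ S) →
          (∃ b ∈ B, ∃ p2 : H.Walk y b, ∀ z ∈ p2.support, z ∉ S) → G.Linkage A B k := by
        intro x y hxy hHxy ⟨a₀, ha₀, p1, hp1⟩ ⟨b₀, hb₀, p2, hp2⟩
        have hx : x ∉ S := hp1 x (Walk.end_mem_support _)
        have hy : y ∉ S := hp2 y (Walk.start_mem_support _)
        have c1 : ∀ T, H.Cuts A (insert x S) T → k ≤ T.card := by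
          intro T hT
          apply h
          intro a ha b hb p
          by_contra hno
          push Not at hno
          have c := Walk.deleteEdge_cases (x := x) (y := y) (↑T) p hno
          rw [← hHxy] at c
          have viaS : ∀ {d : V} (q : H.Walk a d), (∀ z ∈ q.support, z ∉ (T : Set V)) →
              ∀ z ∈ q.support, z ∉ S := by
            intro d q hq z hz hzS
            obtain ⟨w, hw, hwT⟩ := hT a ha z (by simp [hzS]) (q.takeUntil z hz)
            exact hq w (Walk.support_takeUntil_subset_support _ _ hw) hwT
          rcases c with ⟨q, hq⟩ | ⟨⟨q, hq⟩, -⟩ | ⟨⟨q, hq⟩, -⟩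
          · obtain ⟨z, hz, hzS⟩ := hS a ha b hb q
            exact viaS q hq z hz hzS
          · obtain ⟨w, hw, hwT⟩ := hT a ha x (by simp) q
            exact hq w hw hwT
          · obtain ⟨z, hz, hzS⟩ := hS a ha b₀ hb₀ (q.append p2)
            rw [Walk.mem_support_append_iff] at hz
            rcases hz with hz | hz
            · exact viaS q hq z hz hzS
            · exact hp2 z hz hzS
        have c2 : ∀ T, H.Cuts (insert y S) B T → k ≤ T.card := by
          intro T hT
          apply h
          intro a ha b hb p
          by_contra hno
          push Not at hno
          have c := Walk.deleteEdge_cases (x := x) (y := y) (↑T) p hno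
          rw [← hHxy] at c
          have viaS : ∀ {d : V} (q : H.Walk d b), (∀ z ∈ q.support, z ∉ (T : Set V)) →
              ∀ z ∈ q.support, z ∉ S := by
            intro d q hq z hz hzS
            obtain ⟨w, hw, hwT⟩ := hT z (by simp [hzS]) b hb (q.dropUntil z hz)
            exact hq w (Walk.support_dropUntil_subset_support _ _ hw) hwT
          rcases c with ⟨q, hq⟩ | ⟨-, ⟨q, hq⟩⟩ | ⟨-, ⟨q, hq⟩⟩
          · obtain ⟨z, hz, hzS⟩ := hS a ha b hb q
            exact viaS q hq z hz hzS
          · obtain ⟨w, hw, hwT⟩ := hT y (by simp) b hb q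
            exact hq w hw hwT
          · obtain ⟨z, hz, hzS⟩ := hS a₀ ha₀ b hb (p1.append q)
            rw [Walk.mem_support_append_iff] at hz
            rcases hz with hz | hz
            · exact hp1 z hz hzS
            · exact viaS q hq z hz hzS
        have hcard : S.card + 1 = k := by
          have := c1 (insert x S) fun a ha b hb p => ⟨b, Walk.end_mem_support _, hb⟩
          rw [Finset.card_insert_of_notMem hx] at this
          omega
        rw [hHxy] at hS IH c1 c2
        exact linkage_combine hxy hcard hx hy hS (IH _ _ c1) (IH _ _ c2)
      unfold Cuts at hnc
      push Not at hnc
      obtain ⟨a, ha, b, hb, p, hp⟩ := hnc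
      have c := Walk.deleteEdge_cases (x := x) (y := y) (↑S) p hp
      rw [← hH] at c
      rcases c with ⟨q, hq⟩ | ⟨⟨q, hq⟩, ⟨q', hq'⟩⟩ | ⟨⟨q, hq⟩, ⟨q', hq'⟩⟩
      · obtain ⟨z, hz, hzS⟩ := hS a ha b hb q
        exact absurd hzS (hq z hz)
      · exact main x y hxy hH ⟨a, ha, q, hq⟩ ⟨b, hb, q', hq'⟩
      · exact main y x hxy.symm (by rw [hH, Sym2.eq_swap]) ⟨a, ha, q, hq⟩ ⟨b, hb, q', hq'⟩
  · push Not at hE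
    have hc : G.Cuts A B (A ∩ B) := by
      intro a ha b hb p
      cases p with
      | nil => exact ⟨a, by simp, by simp [ha, hb]⟩
      | cons h _ => exact absurd h (hE _ _)
    obtain ⟨f⟩ : Nonempty (Fin k ↪ ↥(A ∩ B)) := by
      apply Function.Embedding.nonempty_of_card_le
      simpa using h _ hc
    refine linkage_of_walks (fun i => (f i : V)) (fun i => (f i : V)) (fun i => Walk.nil)
      (fun i => (Finset.mem_inter.1 (f i).2).1) (fun i => (Finset.mem_inter.1 (f i).2).2) ?_
    intro i j hij x hx hx'
    simp only [Walk.support_nil, List.mem_singleton] at hx hx'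
    exact hij (f.injective (Subtype.ext (hx ▸ hx')))

end SimpleGraph

namespace SimpleGraph

variable {V : Type*} {G : SimpleGraph V} {M : Type*} [AddCommGroup M]

namespace Walk

/-- The sum of the labels of the edges of a walk. -/
def wlab (L : V → V → M) {u v : V} (p : G.Walk u v) : M :=
  (p.darts.map fun d => L d.fst d.snd).sum

variable (L : V → V → M)

@[simp] theorem wlab_nil {u : V} : (nil : G.Walk u u).wlab L = 0 := by simp [wlab]

@[simp] theorem wlab_cons {u v w : V} (h : G.Adj u v) (p : G.Walk v w) :
    (cons h p).wlab L = L u v + p.wlab L := by simp [wlab]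

@[simp] theorem wlab_append {u v w : V} (p : G.Walk u v) (q : G.Walk v w) :
    (p.append q).wlab L = p.wlab L + q.wlab L := by simp [wlab]

theorem wlab_reverse {L : V → V → M} (hL : ∀ a b, L a b = L b a) {u v : V} (p : G.Walk u v) :
    p.reverse.wlab L = p.wlab L := by
  induction p with
  | nil => simp
  | cons h p ih => simp [ih, hL, add_comm]

theorem wlab_map {N : Type*} [AddCommGroup N] (φ : M →+ N) {u v : V} (p : G.Walk u v) :
    φ (p.wlab L) = p.wlab (fun a b => φ (L a b)) := by
  induction p with
  | nil => simp
  | cons h p ih => simp [ih]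

theorem wlab_eq_of_length_eq_one {u v : V} {p : G.Walk u v} (h : p.length = 1) :
    p.wlab L = L u v := by
  cases p with
  | nil => simp at h
  | cons h' q =>
    cases q with
    | nil => simp
    | cons _ _ => simp at h

theorem wlab_mapLe {H : SimpleGraph V} (h : G ≤ H) {u v : V} (p : G.Walk u v) :
    (p.mapLe h).wlab L = p.wlab L := by
  induction p with
  | nil => simp
  | cons h' p ih => simp [ih]

/-- Two internally disjoint paths with the same ends form a cycle. -/
theorem IsPath.isCycle_append_reverse {u v : V} {p q : G.Walk u v} (hp : p.IsPath) (hq : q.IsPath)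
    (hd : ∀ x ∈ p.support, x ∈ q.support → x = u ∨ x = v)
    (hn : 1 < p.length ∨ 1 < q.length) : (p.append q.reverse).IsCycle := by
  refine hp.isCycle_append ((isPath_reverse_iff q).2 hq) (fun x hx hx' => ?_) (by simpa using hn)
  have h1 := hp.support_nodup
  have h2 := ((isPath_reverse_iff q).2 hq).support_nodup
  rw [← cons_tail_support] at h1 h2
  have hu := (List.nodup_cons.1 h1).1
  have hv := (List.nodup_cons.1 h2).1
  have a1 : x ∈ p.support := List.mem_of_mem_tail hx
  have a2 : x ∈ q.support := by
    have := List.mem_of_mem_tail hx'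
    simpa using this
  rcases hd x a1 a2 with rfl | rfl
  · exact hu hx
  · exact hv hx'

theorem one_lt_length_of_wlab_ne {L : V → V → M} {u v : V} (huv : u ≠ v) {p q : G.Walk u v}
    (h : p.wlab L ≠ q.wlab L) : 1 < p.length ∨ 1 < q.length := by
  by_contra hc
  push Not at hc
  have pos : ∀ r : G.Walk u v, r.length ≤ 1 → r.length = 1 := fun r hr => by
    have : r.length ≠ 0 := fun h => huv (eq_of_length_eq_zero h)
    omega
  exact h (by rw [wlab_eq_of_length_eq_one L (pos p hc.1), wlab_eq_of_length_eq_one L (pos q hc.2)])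

/-- A potential computing the labels of the two arcs of a cycle between any two of its
vertices. -/
def IsArcPotential (L : V → V → M) {u : V} (c : G.Walk u u) (α : V → M) : Prop :=
  ∀ a ∈ c.support, ∀ b ∈ c.support, a ≠ b →
    ∃ r₁ r₂ : G.Walk a b, r₁.IsPath ∧ r₂.IsPath ∧
      (∀ x ∈ r₁.support, x ∈ c.support) ∧ (∀ x ∈ r₂.support, x ∈ c.support) ∧
      (∀ x ∈ r₁.support, x ∈ r₂.support → x = a ∨ x = b) ∧
      r₁.wlab L = α a + α b ∧ r₂.wlab L = c.wlab L + (α a + α b) ∧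
      r₁.length + r₂.length = c.length ∧
      (∀ e ∈ r₁.edges, e ∈ c.edges) ∧ (∀ e ∈ r₂.edges, e ∈ c.edges) ∧
      (∀ e ∈ c.edges, e ∈ r₁.edges ∨ e ∈ r₂.edges)

theorem IsCycle.exists_isArcPotential [Module (ZMod 2) M] {L : V → V → M}
    (hL : ∀ a b, L a b = L b a) {u : V} {c : G.Walk u u} (hc : c.IsCycle) :
    ∃ α : V → M, IsArcPotential L c α := by
  refine ⟨fun v => if h : v ∈ c.support then (c.takeUntil v h).wlab L else 0, ?_⟩
  have main : ∀ a b (ha : a ∈ c.support) (hb : b ∈ c.support), a ≠ b →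
      b ∈ (c.takeUntil a ha).support → ∃ (r₁ : G.Walk b a) (r₂ : G.Walk a b),
        r₁.IsPath ∧ r₂.IsPath ∧
        (∀ x ∈ r₁.support, x ∈ c.support) ∧ (∀ x ∈ r₂.support, x ∈ c.support) ∧
        (∀ x ∈ r₁.support, x ∈ r₂.support → x = a ∨ x = b) ∧
        (c.takeUntil a ha).wlab L = (c.takeUntil b hb).wlab L + r₁.wlab L ∧
        r₁.wlab L + r₂.wlab L = c.wlab L ∧
        r₁.length + r₂.length = c.length ∧
        (∀ e ∈ r₁.edges, e ∈ c.edges) ∧ (∀ e ∈ r₂.edges, e ∈ c.edges) ∧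
        (∀ e ∈ c.edges, e ∈ r₁.edges ∨ e ∈ r₂.edges) := by
    intro a b ha hb hab hba
    have e1 := c.take_spec ha
    have e2 := (c.takeUntil a ha).take_spec hba
    have e3 := c.takeUntil_takeUntil ha hba
    set r₁ := (c.takeUntil a ha).dropUntil b hba
    set q := c.dropUntil a ha
    rw [e3] at e2
    set p := c.takeUntil b hb
    have hcyc : ((q.append p).append r₁).IsCycle := by
      have := hc.rotate ha
      rw [rotate, ← e2, append_assoc] at this
      exact this
    have hr1 : ¬ r₁.Nil := fun h => hab h.eq.symm
    have hqp : ¬ (q.append p).Nil := fun h => hab h.eq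
    have hd := hcyc.support_nodup
    rw [tail_support_append, List.nodup_append'] at hd
    have hcl : c = (p.append r₁).append q := by rw [e2, e1]
    refine ⟨r₁, q.append p, hcyc.isPath_of_append_right hqp, hcyc.isPath_of_append_left hr1,
      ?_, ?_, ?_, ?_, ?_, ?_, ?_, ?_, ?_⟩
    · intro x hx; rw [hcl]; simp only [mem_support_append_iff]; tauto
    · intro x hx; rw [hcl]; simp only [mem_support_append_iff] at hx ⊢; tauto
    · intro x hx hx'
      rw [mem_support_iff] at hx hx'
      rcases hx with h | h
      · exact Or.inr h
      · rcases hx' with h' | h'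
        · exact Or.inl h'
        · exact absurd h (hd.2.2 h')
    · rw [← e2, wlab_append]
    · rw [hcl]; simp only [wlab_append]; abel
    · rw [hcl]; simp only [length_append]; omega
    · intro x hx; rw [hcl]; simp only [edges_append, List.mem_append]; tauto
    · intro x hx; rw [hcl]; simp only [edges_append, List.mem_append] at hx ⊢; tauto
    · intro x hx; rw [hcl] at hx; simp only [edges_append, List.mem_append] at hx ⊢; tauto
  have arith : ∀ A B R S C : M, A = B + R → R + S = C → R = A + B ∧ S = C + (A + B) := by
    intro A B R S C h1 h2
    have hR := ZModModule.add_self R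
    have hB := ZModModule.add_self B
    subst h1 h2
    constructor
    · calc R = (B + B) + R := by rw [hB, zero_add]
        _ = _ := by abel
    · calc S = (R + R) + (B + B) + S := by rw [hB, hR]; simp
        _ = _ := by abel
  intro a ha b hb hab
  simp only [dif_pos ha, dif_pos hb]
  have hpa := c.support_takeUntil_prefix_support ha
  have hpb := c.support_takeUntil_prefix_support hb
  rcases (le_total _ _).imp (List.prefix_of_prefix_length_le hpa hpb)
    (List.prefix_of_prefix_length_le hpb hpa) with h | h
  · obtain ⟨r₁, r₂, h1, h2, h3, h4, h5, h6, h7, h8, h9, h10, h11⟩ :=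
      main b a hb ha hab.symm (h.subset (end_mem_support _))
    obtain ⟨i1, i2⟩ := arith _ _ _ _ _ h6 h7
    refine ⟨r₁, r₂.reverse, h1, (isPath_reverse_iff _).2 h2, h3, by simpa using h4, ?_, ?_, ?_, ?_,
      h9, by simpa using h10, by simpa using h11⟩
    · intro x hx hx'
      exact (h5 x hx (by simpa using hx')).symm
    · rw [i1, add_comm]
    · rw [wlab_reverse hL, i2, add_comm (wlab L _) (wlab L (c.takeUntil a ha))]
    · simpa using h8
  · obtain ⟨r₁, r₂, h1, h2, h3, h4, h5, h6, h7, h8, h9, h10, h11⟩ :=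
      main a b ha hb hab (h.subset (end_mem_support _))
    obtain ⟨i1, i2⟩ := arith _ _ _ _ _ h6 h7
    refine ⟨r₁.reverse, r₂, (isPath_reverse_iff _).2 h1, h2, by simpa using h3, h4, ?_, ?_, ?_, ?_,
      by simpa using h9, h10, by simpa using h11⟩
    · intro x hx hx'
      exact h5 x (by simpa using hx) hx'
    · rw [wlab_reverse hL, i1]
    · rw [i2]
    · simpa using h8

/-- A path between two vertices of `S` whose label is not the difference of a potential `β`
contains a segment with the same property that is internally disjoint from `S`. -/
theorem IsPath.exists_ear [Module (ZMod 2) M] (l : V → V → M) (β : V → M) (S : Set V) {a b : V}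
    {R : G.Walk a b} (hR : R.IsPath) (ha : a ∈ S) (hb : b ∈ S) (hne : R.wlab l ≠ β a + β b) :
    ∃ (u v : V) (r : G.Walk u v), u ∈ S ∧ v ∈ S ∧ u ≠ v ∧ r.IsPath ∧
      (∀ x ∈ r.support, x ∈ S → x = u ∨ x = v) ∧ (∀ x ∈ r.support, x ∈ R.support) ∧
      r.wlab l ≠ β u + β v := by
  induction hn : R.length using Nat.strong_induction_on generalizing a with
  | _ n ih =>
  cases R with
  | nil => simp [ZModModule.add_self] at hne
  | @cons _ a' _ h R =>
    obtain ⟨w, q, r, rfl, hw, hq⟩ := R.exists_first_hit S ⟨b, end_mem_support _, hb⟩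
    have hcp := hR
    rw [cons_isPath_iff] at hR
    have haw : a ≠ w := fun h => hR.2 (by
      rw [mem_support_append_iff, h]; exact Or.inl (end_mem_support _))
    by_cases hlab : (cons h q).wlab l = β a + β w
    · have hne' : r.wlab l ≠ β w + β b := by
        intro he
        apply hne
        rw [← cons_append, wlab_append, hlab, he]
        have := ZModModule.add_self (β w)
        calc β a + β w + (β w + β b) = β a + (β w + β w) + β b := by abel
          _ = _ := by rw [this, add_zero]
      obtain ⟨u, v, r', h1, h2, h3, h4, h5, h6, h7⟩ := ih r.length (by
        rw [← hn]; simp) hR.1.of_append_right hw hne' rfl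
      refine ⟨u, v, r', h1, h2, h3, h4, h5, fun x hx => ?_, h7⟩
      rw [support_cons, List.mem_cons, mem_support_append_iff]
      exact Or.inr (Or.inr (h6 x hx))
    · rw [← cons_append] at hcp
      refine ⟨a, w, cons h q, ha, hw, haw, hcp.of_append_left, ?_, ?_, hlab⟩
      · intro x hx hxS
        rcases List.mem_cons.1 hx with rfl | hx
        · exact Or.inl rfl
        · exact Or.inr (hq x hx hxS)
      · intro x hx
        rw [← cons_append, mem_support_append_iff]
        exact Or.inl hx

end Walk

end SimpleGraph

namespace SimpleGraph

variable {V : Type*} {G : SimpleGraph V} {M : Type*} [AddCommGroup M] [Module (ZMod 2) M]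

namespace Walk

theorem IsPath.append_of_inter {u v w : V} {p : G.Walk u v} {q : G.Walk v w} (hp : p.IsPath)
    (hq : q.IsPath) (h : ∀ x ∈ p.support, x ∈ q.support → x = v) : (p.append q).IsPath := by
  rw [isPath_def, support_append, List.nodup_append']
  have h2 := hq.support_nodup
  refine ⟨hp.support_nodup, h2.tail, fun x hx hx' => ?_⟩
  have := h x hx (List.mem_of_mem_tail hx')
  subst this
  rw [← cons_tail_support] at h2
  exact (List.nodup_cons.1 h2).1 hx'

theorem wlab_bypass {l : V → V → M} (hl : ∀ a b, l a b = l b a)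
    (h0 : ∀ (u : V) (c : G.Walk u u), c.IsCycle → c.wlab l = 0) {u v : V} (p : G.Walk u v) :
    p.bypass.wlab l = p.wlab l := by
  induction p with
  | nil => rfl
  | @cons a b c h p ih =>
    simp only [bypass]
    split_ifs with hs
    · rw [wlab_cons, ← ih]
      conv_rhs => rw [← p.bypass.take_spec hs]
      rw [wlab_append, ← add_assoc]
      suffices hz : l a b + (p.bypass.takeUntil a hs).wlab l = 0 by rw [hz, zero_add]
      have hpath := p.bypass_isPath.takeUntil hs
      generalize p.bypass.takeUntil a hs = q at hpath
      by_cases hq : 1 < q.length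
      · have := h0 a (h.toWalk.append q) (IsPath.isCycle_append ?_ hpath ?_ (Or.inr hq))
        · simpa using this
        · simp [h.ne]
        · have := hpath.support_nodup
          rw [← cons_tail_support] at this
          simpa using (List.nodup_cons.1 this).1
      · have : q.length ≠ 0 := fun hh => h.ne (eq_of_length_eq_zero hh).symm
        rw [wlab_eq_of_length_eq_one l (by omega : q.length = 1), hl b a, ZModModule.add_self]
    · rw [wlab_cons, wlab_cons, ih]

end Walk

open Walk

theorem exists_potential {l : V → V → M} (hl : ∀ a b, l a b = l b a)
    (h0 : ∀ (u : V) (c : G.Walk u u), c.IsCycle → c.wlab l = 0) :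
    ∃ β : V → M, ∀ a b, G.Adj a b → l a b = β a + β b := by
  have closed : ∀ (u : V) (c : G.Walk u u), c.wlab l = 0 := fun u c => by
    have h := c.bypass_isPath
    rw [isPath_iff_nil] at h
    rw [← wlab_bypass hl h0 c]
    rw [eq_nil_iff_nil.2 h, wlab_nil]
  have hr : ∀ v, G.Reachable (G.connectedComponentMk v).out v := fun v =>
    ConnectedComponent.exact (Quot.out_eq _)
  have hr' : ∀ v, ∃ x, ∀ u, u = (G.connectedComponentMk v).out → ∃ p : G.Walk u v, p.wlab l = x :=
    fun v => (hr v).elim fun p => ⟨p.wlab l, by rintro u rfl; exact ⟨p, rfl⟩⟩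
  choose β hβ using hr'
  refine ⟨β, fun a b hab => ?_⟩
  obtain ⟨p, hp⟩ := hβ a _ rfl
  obtain ⟨q, hq⟩ := hβ b (G.connectedComponentMk a).out
    (by rw [ConnectedComponent.sound hab.reachable])
  have := closed _ (p.append (hab.toWalk.append q.reverse))
  simp only [wlab_append, wlab_reverse hl, hp, hq, Adj.toWalk, wlab_cons, wlab_nil,
    add_zero] at this
  have h1 := ZModModule.add_self (β a)
  have h2 := ZModModule.add_self (β b)
  calc l a b = (β a + (l a b + β b)) + (β a + β b) := by
        rw [show β a + (l a b + β b) + (β a + β b) = l a b + (β a + β a) + (β b + β b) by abel, h1,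
          h2]
        simp
    _ = _ := by rw [this, zero_add]

/-- If `φ` is odd on some cycle and even on the cycle `K`, then `K` is the sum of two cycles on
which `φ` is odd. -/
theorem exists_odd_split (U : Set V)
    (hG : ∀ A B : Finset V, ↑A ⊆ U → ↑B ⊆ U → 2 ≤ A.card → 2 ≤ B.card → G.Linkage A B 2)
    {L : V → V → M} (hL : ∀ a b, L a b = L b a) (φ : M →+ ZMod 2)
    {f k : V} {F : G.Walk f f} (hF : F.IsCycle) (hF1 : φ (F.wlab L) = 1)
    {K : G.Walk k k} (hK : K.IsCycle) (hK0 : φ (K.wlab L) = 0)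
    (hFU : ∀ x ∈ F.support, x ∈ U) (hKU : ∀ x ∈ K.support, x ∈ U) :
    ∃ (u v : V) (D₁ : G.Walk u u) (D₂ : G.Walk v v), D₁.IsCycle ∧ D₂.IsCycle ∧
      φ (D₁.wlab L) = 1 ∧ φ (D₂.wlab L) = 1 ∧ D₁.wlab L + D₂.wlab L = K.wlab L := by
  obtain ⟨αF, hαF⟩ := hF.exists_isArcPotential hL
  obtain ⟨α, hα⟩ := hK.exists_isArcPotential hL
  have hcard : ∀ {w : V} {C : G.Walk w w}, C.IsCycle → 2 ≤ C.support.toFinset.card := by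
    intro w C hC
    have h3 := hC.three_le_length
    have h1 : C.support.tail.toFinset ⊆ C.support.toFinset := fun x hx => by
      simp only [List.mem_toFinset] at hx ⊢; exact List.mem_of_mem_tail hx
    have h2 := Finset.card_le_card h1
    rw [List.toFinset_card_of_nodup hC.support_nodup] at h2
    simp at h2
    omega
  obtain ⟨s, t, P, hP, hd⟩ := hG F.support.toFinset K.support.toFinset
    (fun x hx => hFU x (by simpa using hx)) (fun x hx => hKU x (by simpa using hx))
    (hcard hF) (hcard hK)
  simp only [List.mem_toFinset] at hP
  have hs : s 0 ≠ s 1 := fun h => hd 0 1 (by simp) (s 0) (start_mem_support _)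
    (by rw [h]; exact start_mem_support _)
  have ht : t 0 ≠ t 1 := fun h => hd 0 1 (by simp) (t 0) (end_mem_support _)
    (by rw [h]; exact end_mem_support _)
  obtain ⟨r₁, r₂, hr₁, hr₂, hs₁, hs₂, -, hl₁, hl₂, -⟩ := hαF _ (hP 0).2.1 _ (hP 1).2.1 hs
  have hR : ∀ r : G.Walk (s 0) (s 1), r.IsPath → (∀ x ∈ r.support, x ∈ F.support) →
      (((P 0).reverse.append r).append (P 1)).IsPath := by
    intro r hr hrs
    refine IsPath.append_of_inter (IsPath.append_of_inter ((isPath_reverse_iff _).2 (hP 0).1) hr ?_)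
      (hP 1).1 ?_
    · intro x hx hx'
      exact (hP 0).2.2.2.1 x (by simpa using hx) (hrs x hx')
    · intro x hx hx'
      rw [mem_support_append_iff] at hx
      rcases hx with hx | hx
      · exact absurd hx' (hd 0 1 (by simp) x (by simpa using hx))
      · exact (hP 1).2.2.2.1 x hx' (hrs x hx)
  have hexR : ∃ R : G.Walk (t 0) (t 1), R.IsPath ∧
      R.wlab (fun a b => φ (L a b)) ≠ φ (α (t 0)) + φ (α (t 1)) := by
    by_cases h1 : (((P 0).reverse.append r₁).append (P 1)).wlab (fun a b => φ (L a b)) =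
      φ (α (t 0)) + φ (α (t 1))
    · refine ⟨_, hR r₂ hr₂ hs₂, ?_⟩
      rw [← h1, ← wlab_map, ← wlab_map]
      simp only [wlab_append, hl₁, hl₂, map_add, hF1]
      generalize φ _ = a, φ _ = b, φ _ = c, φ _ = d
      revert a b c d; decide
    · exact ⟨_, hR r₁ hr₁ hs₁, h1⟩
  obtain ⟨R, hRp, hRl⟩ := hexR
  obtain ⟨u, v, r, hu, hv, huv, hrp, hrS, -, hrl⟩ := hRp.exists_ear (fun a b => φ (L a b))
    (fun a => φ (α a)) {x | x ∈ K.support} (hP 0).2.2.1 (hP 1).2.2.1 hRl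
  rw [← wlab_map] at hrl
  obtain ⟨q₁, q₂, hq₁, hq₂, hk₁, hk₂, -, hm₁, hm₂, -⟩ := hα u hu v hv huv
  have e1 : φ (r.wlab L) ≠ φ (q₁.wlab L) := by rw [hm₁, map_add]; exact hrl
  have e2 : φ (r.wlab L) ≠ φ (q₂.wlab L) := by rw [hm₂, map_add, hK0, zero_add, map_add]; exact hrl
  have odd : ∀ a b : ZMod 2, a ≠ b → a + b = 1 := by decide
  refine ⟨u, u, r.append q₁.reverse, r.append q₂.reverse, ?_, ?_, ?_, ?_, ?_⟩
  · exact hrp.isCycle_append_reverse hq₁ (fun x hx hx' => hrS x hx (hk₁ x hx'))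
      (one_lt_length_of_wlab_ne huv (fun h => e1 (by rw [h])))
  · exact hrp.isCycle_append_reverse hq₂ (fun x hx hx' => hrS x hx (hk₂ x hx'))
      (one_lt_length_of_wlab_ne huv (fun h => e2 (by rw [h])))
  · rw [wlab_append, wlab_reverse hL, map_add, odd _ _ e1]
  · rw [wlab_append, wlab_reverse hL, map_add, odd _ _ e2]
  · rw [wlab_append, wlab_append, wlab_reverse hL, wlab_reverse hL, hm₁, hm₂]
    have h1 := ZModModule.add_self (r.wlab L)
    have h2 := ZModModule.add_self (α u + α v)
    generalize r.wlab L = a at *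
    generalize α u + α v = b at *
    calc a + b + (a + (K.wlab L + b)) = (a + a) + (b + b) + K.wlab L := by abel
      _ = _ := by rw [h1, h2]; simp

omit [Module (ZMod 2) M] in
/-- An edge joining two vertices of a cycle either belongs to the cycle or splits it into two
shorter cycles. -/
theorem Walk.IsArcPotential.chord {L : V → V → M} (hL : ∀ a b, L a b = L b a)
    {k : V} {K : G.Walk k k} {α : V → M} (hα : IsArcPotential L K α)
    {u v : V} (hu : u ∈ K.support) (hv : v ∈ K.support) (huv : G.Adj u v) :
    (L u v = α u + α v ∨ L u v = K.wlab L + (α u + α v)) ∨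
    ∃ D₁ D₂ : G.Walk u u, D₁.IsCycle ∧ D₂.IsCycle ∧ D₁.length < K.length ∧ D₂.length < K.length ∧
      D₁.wlab L = L u v + (α u + α v) ∧ D₂.wlab L = K.wlab L + (L u v + (α u + α v)) := by
  obtain ⟨q₁, q₂, hq₁, hq₂, -, -, -, hm₁, hm₂, hlen, -, -, -⟩ := hα u hu v hv huv.ne
  have pos : ∀ r : G.Walk u v, r.length ≠ 0 := fun r hr => huv.ne (eq_of_length_eq_zero hr)
  by_cases h1 : q₁.length = 1
  · exact Or.inl (Or.inl (by rw [← hm₁, wlab_eq_of_length_eq_one L h1]))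
  by_cases h2 : q₂.length = 1
  · exact Or.inl (Or.inr (by rw [← hm₂, wlab_eq_of_length_eq_one L h2]))
  have p1 := pos q₁
  have p2 := pos q₂
  have hp : huv.toWalk.IsPath := by simp [huv.ne]
  have hd : ∀ q : G.Walk u v, ∀ x ∈ huv.toWalk.support, x ∈ q.support → x = u ∨ x = v := by
    intro q x hx _; simpa using hx
  refine Or.inr ⟨huv.toWalk.append q₁.reverse, huv.toWalk.append q₂.reverse,
    hp.isCycle_append_reverse hq₁ (hd _) (Or.inr (by omega)),
    hp.isCycle_append_reverse hq₂ (hd _) (Or.inr (by omega)), by simp; omega, by simp; omega,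
    ?_, ?_⟩
  · rw [wlab_append, wlab_reverse hL, hm₁]; simp
  · rw [wlab_append, wlab_reverse hL, hm₂]; simp; abel

/-- Two disjoint cycles joined by two disjoint paths give rise to cycles through both paths, using
either of the arcs of each cycle. -/
theorem exists_isCycle_of_two_paths {L : V → V → M} (hL : ∀ a b, L a b = L b a)
    {c k : V} {C : G.Walk c c} {K : G.Walk k k} {αC αK : V → M}
    (hC : IsArcPotential L C αC) (hK : IsArcPotential L K αK)
    (hdis : ∀ x ∈ C.support, x ∉ K.support)
    {s t s' t' : V} {P : G.Walk s t} {P' : G.Walk s' t'} (hP : P.IsPath) (hP' : P'.IsPath)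
    (hPP : ∀ x ∈ P.support, x ∉ P'.support)
    (hs : s ∈ C.support) (hs' : s' ∈ C.support) (ht : t ∈ K.support) (ht' : t' ∈ K.support)
    (hPC : ∀ x ∈ P.support, x ∈ C.support → x = s) (hPK : ∀ x ∈ P.support, x ∈ K.support → x = t)
    (hPC' : ∀ x ∈ P'.support, x ∈ C.support → x = s')
    (hPK' : ∀ x ∈ P'.support, x ∈ K.support → x = t') (ε ε' : ZMod 2) :
    ∃ (u : V) (D : G.Walk u u), D.IsCycle ∧
      D.wlab L = (αC s + P.wlab L + αK t) + (αC s' + P'.wlab L + αK t') +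
        (ε • C.wlab L + ε' • K.wlab L) := by
  have hss : s' ≠ s := by
    rintro rfl; exact hPP _ (start_mem_support _) (start_mem_support _)
  have htt : t ≠ t' := by
    rintro rfl; exact hPP _ (end_mem_support _) (end_mem_support _)
  have arc : ∀ {w : V} {W : G.Walk w w} {α : V → M}, IsArcPotential L W α → ∀ a ∈ W.support,
      ∀ b ∈ W.support, a ≠ b → ∀ η : ZMod 2, ∃ r : G.Walk a b, r.IsPath ∧
      (∀ x ∈ r.support, x ∈ W.support) ∧ r.wlab L = η • W.wlab L + (α a + α b) := by
    intro w W α hα a ha b hb hab η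
    obtain ⟨q₁, q₂, hq₁, hq₂, h1, h2, -, hm₁, hm₂, -⟩ := hα a ha b hb hab
    have : η = 0 ∨ η = 1 := by revert η; decide
    rcases this with rfl | rfl
    · exact ⟨q₁, hq₁, h1, by simpa using hm₁⟩
    · exact ⟨q₂, hq₂, h2, by simpa using hm₂⟩
  obtain ⟨r, hr, hrC, hrl⟩ := arc hC s' hs' s hs hss ε
  obtain ⟨q, hq, hqK, hql⟩ := arc hK t ht t' ht' htt ε'
  have h1 : (r.append P).IsPath := hr.append_of_inter hP fun x hx hx' => hPC x hx' (hrC x hx)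
  have h2 : ((r.append P).append q).IsPath := by
    refine h1.append_of_inter hq fun x hx hx' => ?_
    rcases (mem_support_append_iff _ _).1 hx with h | h
    · exact absurd (hqK x hx') (hdis x (hrC x h))
    · exact hPK x h (hqK x hx')
  have hr0 : r.length ≠ 0 := fun h => hss (eq_of_length_eq_zero h)
  have hq0 : q.length ≠ 0 := fun h => htt (eq_of_length_eq_zero h)
  refine ⟨_, _, h2.isCycle_append_reverse hP' (fun x hx hx' => ?_)
    (Or.inl (by simp only [length_append]; omega)), ?_⟩
  · rw [mem_support_append_iff, mem_support_append_iff] at hx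
    rcases hx with (hx | hx) | hx
    · exact Or.inl (hPC' x hx' (hrC x hx))
    · exact absurd hx' (hPP x hx)
    · exact Or.inr (hPK' x hx' (hqK x hx))
  · rw [wlab_append, wlab_reverse hL, wlab_append, wlab_append, hrl, hql]
    abel

end SimpleGraph

/-- Solvability of a linear system over `ZMod 2` given by an incidence relation. -/
theorem exists_incidence_solution {ι κ : Type*} (S : Finset ι) (K : Finset κ) (R : ι → κ → Prop)
    [∀ e f, Decidable (R e f)] (y : ι → ZMod 2)
    (h : ∀ φ : ι → ZMod 2, (∀ f ∈ K, ∑ e ∈ S with R e f, φ e = 0) → ∑ e ∈ S, φ e * y e = 0) :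
    ∃ t : κ → ZMod 2, ∀ e ∈ S, ∑ f ∈ K with R e f, t f = y e := by
  let A : (κ → ZMod 2) →ₗ[ZMod 2] (S → ZMod 2) :=
    { toFun := fun t e => ∑ f ∈ K with R e f, t f
      map_add' := fun s t => by ext e; simp [Finset.sum_add_distrib]
      map_smul' := fun c t => by ext e; simp [Finset.mul_sum] }
  by_contra hno
  have hy : (fun e : S => y e) ∉ LinearMap.range A := by
    rintro ⟨t, ht⟩
    exact hno ⟨t, fun e he => congrFun ht ⟨e, he⟩⟩
  obtain ⟨f, hf, hfA⟩ := Submodule.exists_le_ker_of_notMem hy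
  apply hf
  have hfs : ∀ z : S → ZMod 2, f z = ∑ e : S, f (Pi.single e 1) * z e := fun z => by
    rw [LinearMap.pi_apply_eq_sum_univ]
    refine Finset.sum_congr rfl fun e _ => ?_
    rw [smul_eq_mul, mul_comm]
    congr 2
    ext i
    simp [Pi.single_apply, eq_comm]
  set φ : ι → ZMod 2 := fun e => if h : e ∈ S then f (Pi.single ⟨e, h⟩ 1) else 0 with hφ
  have hφs : ∀ z : ι → ZMod 2, f (fun e => z e) = ∑ e ∈ S, φ e * z e := fun z => by
    rw [hfs, ← Finset.sum_attach S]
    refine Finset.sum_congr rfl fun e _ => ?_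
    simp [hφ]
  rw [hφs]
  apply h
  intro k hk
  have h0 : f (A (Pi.single k 1)) = 0 := hfA ⟨_, rfl⟩
  have : A (Pi.single k 1) = fun e : S => (if R e k then 1 else 0 : ZMod 2) := by
    ext e
    simp only [A, LinearMap.coe_mk, AddHom.coe_mk, Finset.sum_filter]
    rw [Finset.sum_eq_single k]
    · simp
    · intro b _ hb; simp [hb]
    · exact fun h => absurd hk h
  rw [this, hφs (fun e => if R e k then 1 else 0)] at h0
  rw [Finset.sum_filter]
  refine (Finset.sum_congr rfl fun e _ => ?_).trans h0
  simp

namespace Triangulation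

variable (T : Triangulation)

theorem mem_vertsOf {F : Finset (Finset ℕ)} {v : ℕ} : v ∈ vertsOf F ↔ ∃ f ∈ F, v ∈ f := by
  simp [vertsOf, Finset.mem_sup]

variable {T}

theorem mem_verts {v : ℕ} : v ∈ T.verts ↔ ∃ f ∈ T.faces, v ∈ f := mem_vertsOf

theorem mem_edges {e : Finset ℕ} : e ∈ T.edges ↔ e.card = 2 ∧ ∃ f ∈ T.faces, e ⊆ f := by
  simp only [edges, edgesOf, Finset.mem_filter, Finset.mem_powersetCard]
  constructor
  · rintro ⟨⟨-, h⟩, h'⟩; exact ⟨h, h'⟩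
  · rintro ⟨h, f, hf, hef⟩
    exact ⟨⟨fun x hx => mem_vertsOf.2 ⟨f, hf, hef hx⟩, h⟩, f, hf, hef⟩

theorem card_of_mem_edges {e : Finset ℕ} (he : e ∈ T.edges) : e.card = 2 := (mem_edges.1 he).1

theorem pair_mem_edges {f : Finset ℕ} (hf : f ∈ T.faces) {u v : ℕ} (hu : u ∈ f) (hv : v ∈ f)
    (huv : u ≠ v) : {u, v} ∈ T.edges :=
  mem_edges.2 ⟨Finset.card_pair huv, f, hf, by intro x; simp; rintro (rfl | rfl) <;> assumption⟩

theorem exists_two_faces {e : Finset ℕ} (he : e ∈ T.edges) :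
    ∃ f g, f ≠ g ∧ f ∈ T.faces ∧ g ∈ T.faces ∧ e ⊆ f ∧ e ⊆ g ∧
      {h ∈ T.faces | e ⊆ h} = {f, g} := by
  obtain ⟨h1, h2⟩ := mem_edges.1 he
  obtain ⟨f, g, hfg, h⟩ := Finset.card_eq_two.1 (T.edge_in_two_faces e h1 h2)
  have hf : f ∈ {h ∈ T.faces | e ⊆ h} := by rw [h]; simp
  have hg : g ∈ {h ∈ T.faces | e ⊆ h} := by rw [h]; simp
  rw [Finset.mem_filter] at hf hg
  exact ⟨f, g, hfg, hf.1, hg.1, hf.2, hg.2, h⟩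

theorem exists_other_face {e f : Finset ℕ} (he : e ∈ T.edges) (hf : f ∈ T.faces) (hef : e ⊆ f) :
    ∃ g, f ≠ g ∧ g ∈ T.faces ∧ e ⊆ g ∧ {h ∈ T.faces | e ⊆ h} = {f, g} := by
  obtain ⟨a, b, hab, ha, hb, hea, heb, h⟩ := exists_two_faces he
  have : f ∈ {h ∈ T.faces | e ⊆ h} := by simp [hf, hef]
  rw [h] at this
  simp only [Finset.mem_insert, Finset.mem_singleton] at this
  rcases this with rfl | rfl
  · exact ⟨b, hab, hb, heb, h⟩
  · exact ⟨a, hab.symm, ha, hea, by rw [h, Finset.pair_comm]⟩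

theorem faces_filter_eq {e f g : Finset ℕ} (he : e ∈ T.edges) (hf : f ∈ T.faces) (hg : g ∈ T.faces)
    (hfg : f ≠ g) (hef : e ⊆ f) (heg : e ⊆ g) : {h ∈ T.faces | e ⊆ h} = {f, g} := by
  obtain ⟨g', -, -, -, h⟩ := exists_other_face he hf hef
  have : g ∈ {h ∈ T.faces | e ⊆ h} := by simp [hg, heg]
  rw [h] at this
  simp only [Finset.mem_insert, Finset.mem_singleton] at this
  rw [h, this.resolve_left hfg.symm]

theorem inter_eq {e f g : Finset ℕ} (he : e ∈ T.edges) (hf : f ∈ T.faces) (hg : g ∈ T.faces)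
    (hfg : f ≠ g) (hef : e ⊆ f) (heg : e ⊆ g) : f ∩ g = e := by
  symm
  apply Finset.eq_of_subset_of_card_le (Finset.subset_inter hef heg)
  rw [card_of_mem_edges he]
  have h3 := T.card_eq_three f hf
  have h3' := T.card_eq_three g hg
  have : (f ∩ g).card ≠ 3 := fun h => hfg <| by
    have a := Finset.eq_of_subset_of_card_le (Finset.inter_subset_left (s₁ := f) (s₂ := g))
      (by omega)
    have b := Finset.eq_of_subset_of_card_le (Finset.inter_subset_right (s₁ := f) (s₂ := g))
      (by omega)
    rw [← a]; exact b
  have := Finset.card_le_card (Finset.inter_subset_left (s₁ := f) (s₂ := g))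
  omega

theorem inter_mem_edges {f g : Finset ℕ} (hf : f ∈ T.faces) (h : (f ∩ g).card = 2) :
    f ∩ g ∈ T.edges := mem_edges.2 ⟨h, f, hf, Finset.inter_subset_left⟩

theorem ne_of_inter_card {f g : Finset ℕ} (hf : f ∈ T.faces) (h : (f ∩ g).card = 2) : f ≠ g := by
  rintro rfl
  have := T.card_eq_three f hf
  rw [Finset.inter_self] at h
  omega

theorem sum_faces_edge {M : Type*} [AddCommMonoid M] {e f g : Finset ℕ} (he : e ∈ T.edges)
    (hf : f ∈ T.faces) (hg : g ∈ T.faces) (hfg : f ≠ g) (hef : e ⊆ f) (heg : e ⊆ g)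
    (s : Finset ℕ → M) : ∑ h ∈ T.faces with e ⊆ h, s h = s f + s g := by
  rw [faces_filter_eq he hf hg hfg hef heg, Finset.sum_pair hfg]

theorem exists_eq_of_mem {f : Finset ℕ} (hf : f ∈ T.faces) {v : ℕ} (hv : v ∈ f) :
    ∃ a b, v ≠ a ∧ v ≠ b ∧ a ≠ b ∧ f = {v, a, b} := by
  have h3 := T.card_eq_three f hf
  have h2 : (f.erase v).card = 2 := by rw [Finset.card_erase_of_mem hv]; omega
  obtain ⟨a, b, hab, h⟩ := Finset.card_eq_two.1 h2
  have ha : a ∈ f.erase v := by rw [h]; simp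
  have hb : b ∈ f.erase v := by rw [h]; simp
  refine ⟨a, b, (Finset.ne_of_mem_erase ha).symm, (Finset.ne_of_mem_erase hb).symm, hab, ?_⟩
  rw [← Finset.insert_erase hv, h]

theorem exists_eq_of_pair {f : Finset ℕ} (hf : f ∈ T.faces) {u v : ℕ} (hu : u ∈ f) (hv : v ∈ f)
    (huv : u ≠ v) : ∃ a, u ≠ a ∧ v ≠ a ∧ f = {u, v, a} := by
  obtain ⟨a, b, h1, h2, h3, rfl⟩ := exists_eq_of_mem hf hu
  simp only [Finset.mem_insert, Finset.mem_singleton] at hv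
  rcases hv with rfl | rfl | rfl
  · exact absurd rfl huv
  · exact ⟨b, h2, h3, rfl⟩
  · exact ⟨a, h1, h3.symm, by rw [Finset.pair_comm]⟩

theorem exists_eq {f : Finset ℕ} (hf : f ∈ T.faces) :
    ∃ a b c, a ≠ b ∧ a ≠ c ∧ b ≠ c ∧ f = {a, b, c} :=
  Finset.card_eq_three.1 (T.card_eq_three f hf)

theorem edges_filter_face {a b c : ℕ} (hab : a ≠ b) (hac : a ≠ c) (hbc : b ≠ c)
    (hf : {a, b, c} ∈ T.faces) :
    {e ∈ T.edges | e ⊆ {a, b, c}} = {{a, b}, {a, c}, {b, c}} := by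
  ext e
  simp only [Finset.mem_filter, Finset.mem_insert, Finset.mem_singleton]
  constructor
  · rintro ⟨he, hef⟩
    obtain ⟨x, y, hxy, rfl⟩ := Finset.card_eq_two.1 (card_of_mem_edges he)
    have hx := hef (show x ∈ ({x, y} : Finset ℕ) by simp)
    have hy := hef (show y ∈ ({x, y} : Finset ℕ) by simp)
    simp only [Finset.mem_insert, Finset.mem_singleton] at hx hy
    rcases hx with rfl | rfl | rfl <;> rcases hy with rfl | rfl | rfl <;>
      simp_all [Finset.pair_comm]
  · rintro (rfl | rfl | rfl)
    · exact ⟨pair_mem_edges hf (by simp) (by simp) hab, by intro x; simp; tauto⟩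
    · exact ⟨pair_mem_edges hf (by simp) (by simp) hac, by intro x; simp; tauto⟩
    · exact ⟨pair_mem_edges hf (by simp) (by simp) hbc, by intro x; simp; tauto⟩

theorem pair_ne {a b c : ℕ} (hab : a ≠ b) (hbc : b ≠ c) : ({a, b} : Finset ℕ) ≠ {a, c} := by
  intro h
  have : b ∈ ({a, c} : Finset ℕ) := by rw [← h]; simp
  simp at this
  tauto

theorem sum_edges_face {M : Type*} [AddCommMonoid M] {a b c : ℕ} (hab : a ≠ b) (hac : a ≠ c)
    (hbc : b ≠ c) (hf : {a, b, c} ∈ T.faces) (w : Finset ℕ → M) :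
    ∑ e ∈ T.edges with e ⊆ {a, b, c}, w e = w {a, b} + (w {a, c} + w {b, c}) := by
  rw [edges_filter_face hab hac hbc hf, Finset.sum_insert, Finset.sum_pair]
  · rw [Finset.pair_comm a c, Finset.pair_comm b c]; exact pair_ne hac.symm hab
  · simp only [Finset.mem_insert, Finset.mem_singleton, not_or]
    exact ⟨pair_ne hab hbc, by rw [Finset.pair_comm a b]; exact pair_ne hab.symm hac⟩

theorem sum_edges_face_at {M : Type*} [AddCommMonoid M] {v a b : ℕ} (hva : v ≠ a) (hvb : v ≠ b)
    (hab : a ≠ b) (hf : {v, a, b} ∈ T.faces) (w : Finset ℕ → M) :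
    ∑ e ∈ T.edges with (v ∈ e ∧ e ⊆ {v, a, b}), w e = w {v, a} + w {v, b} := by
  have : ∑ e ∈ T.edges with (v ∈ e ∧ e ⊆ {v, a, b}), w e =
      ∑ e ∈ T.edges with e ⊆ {v, a, b}, if v ∈ e then w e else 0 := by
    rw [← Finset.sum_filter, Finset.filter_filter]
    refine Finset.sum_congr ?_ fun _ _ => rfl
    ext e; simp only [Finset.mem_filter]; tauto
  rw [this, sum_edges_face hva hvb hab hf]
  simp [hva, hvb]

/-- Faces around a vertex: a property passing across the edges at `v` holds at all faces at `v`. -/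
theorem link_induction {v : ℕ} {P : Finset ℕ → Prop}
    (h : ∀ f ∈ T.faces, ∀ g ∈ T.faces, f ≠ g → ∀ e ∈ T.edges, v ∈ e → e ⊆ f → e ⊆ g → P f → P g)
    {f g : Finset ℕ} (hf : f ∈ T.faces) (hg : g ∈ T.faces) (hvf : v ∈ f) (hvg : v ∈ g) (hP : P f) :
    P g := by
  have := T.link_connected v f hf g hg hvf hvg
  induction this with
  | refl => exact hP
  | tail _ hbc ih =>
    obtain ⟨hb, hc, hvb, hvc, h2⟩ := hbc
    exact h _ hb _ hc (ne_of_inter_card hb h2) _ (inter_mem_edges hb h2) (by simp [hvb, hvc])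
      Finset.inter_subset_left Finset.inter_subset_right (ih hb hvb)

theorem face_induction {P : Finset ℕ → Prop}
    (h : ∀ f ∈ T.faces, ∀ g ∈ T.faces, f ≠ g → ∀ e ∈ T.edges, e ⊆ f → e ⊆ g → P f → P g)
    {f g : Finset ℕ} (hf : f ∈ T.faces) (hg : g ∈ T.faces) (hP : P f) : P g := by
  have := T.face_connected f hf g hg
  induction this with
  | refl => exact hP
  | tail _ hbc ih =>
    obtain ⟨hb, hc, h2⟩ := hbc
    exact h _ hb _ hc (ne_of_inter_card hb h2) _ (inter_mem_edges hb h2)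
      Finset.inter_subset_left Finset.inter_subset_right (ih hb)

theorem sum_edge_face_comm {M : Type*} [AddCommMonoid M] (w : Finset ℕ → Finset ℕ → M) :
    ∑ e ∈ T.edges, ∑ f ∈ T.faces with e ⊆ f, w e f =
      ∑ f ∈ T.faces, ∑ e ∈ T.edges with e ⊆ f, w e f := by
  simp only [Finset.sum_filter]
  exact Finset.sum_comm

theorem sum_faces_edges_eq_zero (w : Finset ℕ → ZMod 2) :
    ∑ f ∈ T.faces, ∑ e ∈ T.edges with e ⊆ f, w e = 0 := by
  rw [← sum_edge_face_comm]
  refine Finset.sum_eq_zero fun e he => ?_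
  obtain ⟨f, g, hfg, hf, hg, hef, heg, h⟩ := exists_two_faces he
  rw [h, Finset.sum_pair hfg, CharTwo.add_self_eq_zero]

/-- The 1-skeleton. -/
def graph (T : Triangulation) : SimpleGraph ℕ where
  Adj u v := {u, v} ∈ T.edges
  symm := ⟨fun u v h => by rwa [Finset.pair_comm]⟩
  loopless := ⟨fun u h => by have := card_of_mem_edges h; simp at this⟩

theorem graph_adj {u v : ℕ} : T.graph.Adj u v ↔ {u, v} ∈ T.edges := Iff.rfl

theorem mem_verts_of_mem_edges {e : Finset ℕ} (he : e ∈ T.edges) {v : ℕ} (hv : v ∈ e) :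
    v ∈ T.verts := by
  obtain ⟨-, f, hf, hef⟩ := mem_edges.1 he
  exact mem_verts.2 ⟨f, hf, hef hv⟩

theorem graph_edgeSet_finite : T.graph.edgeSet.Finite := by
  apply (Finset.finite_toSet (T.verts ×ˢ T.verts)).image (fun p => s(p.1, p.2)) |>.subset
  intro e he
  induction e using Sym2.ind with
  | _ u v =>
  have h : {u, v} ∈ T.edges := by simpa [graph_adj] using he
  exact ⟨(u, v), by simp [mem_verts_of_mem_edges h], rfl⟩

/-- A vertex property constant on the opposite edges of the faces at `a` that miss `b` takes the
same value at the two vertices opposite to the edge `ab`. -/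
theorem fourth_vertex {a b x y : ℕ} (hab : a ≠ b) (hax : a ≠ x) (hbx : b ≠ x) (hay : a ≠ y)
    (hby : b ≠ y) (hf : {a, b, x} ∈ T.faces) (hg : {a, b, y} ∈ T.faces)
    (hfg : ({a, b, x} : Finset ℕ) ≠ {a, b, y}) {A : ℕ → Prop} (hAa : ¬ A a) (hAb : ¬ A b)
    (step : ∀ h ∈ T.faces, ∀ c ∈ h, ∀ d ∈ h, b ∉ h → d ≠ a → A c → A d) (hAx : A x) : A y := by
  obtain ⟨w, hw⟩ : ∃ w : Finset ℕ → ZMod 2, ∀ e, w e = if a ∈ e ∧ ∃ z ∈ e, A z then 1 else 0 :=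
    ⟨_, fun _ => rfl⟩
  have hwa : ∀ z, w {a, z} = if A z then 1 else 0 := fun z => by simp [hw, hAa]
  have hw0 : ∀ c d, a ≠ c → a ≠ d → w {c, d} = 0 := fun c d hc hd => by simp [hw, hc, hd]
  have hsum := sum_faces_edges_eq_zero (T := T) w
  have he : {a, b} ∈ T.edges := pair_mem_edges hf (by simp) (by simp) hab
  have hother : ∀ h ∈ T.faces, h ∉ ({{a, b, x}, {a, b, y}} : Finset (Finset ℕ)) →
      ∑ e ∈ T.edges with e ⊆ h, w e = 0 := by
    intro h hh hne
    by_cases hah : a ∈ h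
    · have hbn : b ∉ h := by
        intro hb
        have hfe := faces_filter_eq he hf hg hfg (Finset.insert_subset_insert _ (by simp))
          (Finset.insert_subset_insert _ (by simp))
        refine hne (Finset.ext_iff.1 hfe h |>.1 (Finset.mem_filter.2 ?_))
        refine ⟨hh, fun z hz => ?_⟩
        simp only [Finset.mem_insert, Finset.mem_singleton] at hz
        rcases hz with rfl | rfl
        exacts [hah, hb]
      obtain ⟨c, d, h1, h2, h3, rfl⟩ := exists_eq_of_mem hh hah
      rw [sum_edges_face h1 h2 h3 hh, hwa c, hwa d, hw0 c d h1 h2, add_zero]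
      have : A c ↔ A d := ⟨step _ hh c (by simp) d (by simp) hbn h2.symm,
        step _ hh d (by simp) c (by simp) hbn h1.symm⟩
      simp only [this, CharTwo.add_self_eq_zero]
    · refine Finset.sum_eq_zero fun e he => ?_
      rw [hw, if_neg]
      exact fun h => hah ((Finset.mem_filter.1 he).2 h.1)
  have hsub : ({{a, b, x}, {a, b, y}} : Finset (Finset ℕ)) ⊆ T.faces := by
    intro z; simp only [Finset.mem_insert, Finset.mem_singleton]
    rintro (rfl | rfl)
    exacts [hf, hg]
  have hsum := (Finset.sum_pair hfg).symm.trans ((Finset.sum_subset hsub hother).trans hsum)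
  have hsum := (congrArg₂ (· + ·) (sum_edges_face hab hax hbx hf w)
    (sum_edges_face hab hay hby hg w)).symm.trans hsum
  simp only [hwa, hw0 b x hab hax, hw0 b y hab hay, if_neg hAb, if_pos hAx] at hsum
  by_contra hAy
  rw [if_neg hAy] at hsum
  simp at hsum

/-- The 1-skeleton is 3-connected. -/
theorem exists_walk_avoiding {S : Finset ℕ} (hS : S.card ≤ 2) {u v : ℕ} (hu : u ∈ T.verts)
    (hv : v ∈ T.verts) (huS : u ∉ S) (hvS : v ∉ S) :
    ∃ p : T.graph.Walk u v, ∀ z ∈ p.support, z ∉ S := by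
  set A : ℕ → Prop := fun z => ∃ p : T.graph.Walk u z, ∀ w ∈ p.support, w ∉ S with hA
  have hAS : ∀ z, A z → z ∉ S := fun z ⟨p, hp⟩ => hp z (SimpleGraph.Walk.end_mem_support _)
  have step : ∀ f ∈ T.faces, ∀ z ∈ f, ∀ w ∈ f, w ∉ S → A z → A w := by
    rintro f hf z hz w hw hwS ⟨p, hp⟩
    by_cases h : z = w
    · subst h; exact ⟨p, hp⟩
    · refine ⟨p.concat (show T.graph.Adj z w from pair_mem_edges hf hz hw h), fun x hx => ?_⟩
      rw [SimpleGraph.Walk.support_concat, List.mem_append] at hx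
      rcases hx with hx | hx
      · exact hp x hx
      · simp at hx; rwa [hx]
  obtain ⟨f, hf, huf⟩ := mem_verts.1 hu
  obtain ⟨g, hg, hvg⟩ := mem_verts.1 hv
  have : ∃ x ∈ g, A x := by
    refine face_induction (P := fun g => ∃ x ∈ g, A x) ?_ hf hg
      ⟨u, huf, SimpleGraph.Walk.nil, by simpa using huS⟩
    rintro f hf g hg hfg e he hef heg ⟨x, hx, hAx⟩
    by_cases hes : ∃ z ∈ e, z ∉ S
    · obtain ⟨z, hz, hzS⟩ := hes
      exact ⟨z, heg hz, step f hf x hx z (hef hz) hzS hAx⟩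
    · push Not at hes
      have heS : e = S := Finset.eq_of_subset_of_card_le hes
        (by rw [card_of_mem_edges he]; exact hS)
      obtain ⟨a, b, hab, rfl⟩ := Finset.card_eq_two.1 (card_of_mem_edges he)
      have haf : a ∈ f := hef (by simp)
      have hbf : b ∈ f := hef (by simp)
      have hag : a ∈ g := heg (by simp)
      have hbg : b ∈ g := heg (by simp)
      obtain ⟨x', hax, hbx, rfl⟩ := exists_eq_of_pair hf haf hbf hab
      obtain ⟨y, hay, hby, rfl⟩ := exists_eq_of_pair hg hag hbg hab
      have haS : a ∈ S := by rw [← heS]; simp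
      have hbS : b ∈ S := by rw [← heS]; simp
      have hxx : x = x' := by
        simp only [Finset.mem_insert, Finset.mem_singleton] at hx
        rcases hx with rfl | rfl | rfl
        · exact absurd haS (hAS _ hAx)
        · exact absurd hbS (hAS _ hAx)
        · rfl
      subst hxx
      refine ⟨y, by simp, ?_⟩
      refine fourth_vertex hab hax hbx hay hby hf hg hfg (fun h => hAS _ h haS)
        (fun h => hAS _ h hbS) ?_ hAx
      intro h hh c hc d hd hbh hda hAc
      refine step _ hh c hc d hd ?_ hAc
      rw [← heS]
      simp only [Finset.mem_insert, Finset.mem_singleton, not_or]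
      exact ⟨hda, fun h => hbh (h ▸ hd)⟩
  obtain ⟨x, hx, hAx⟩ := this
  exact step g hg x hx v hvg hvS hAx

theorem linkage {k : ℕ} (hk : k ≤ 3) (A B : Finset ℕ) (hA : A ⊆ T.verts) (hB : B ⊆ T.verts)
    (hAk : k ≤ A.card) (hBk : k ≤ B.card) : T.graph.Linkage A B k := by
  refine SimpleGraph.menger A B k graph_edgeSet_finite fun S hS => ?_
  by_contra hlt
  have ex : ∀ C : Finset ℕ, k ≤ C.card → ∃ a ∈ C, a ∉ S := fun C hC => by
    by_contra hno
    push Not at hno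
    have := Finset.card_le_card (show C ⊆ S from hno)
    omega
  obtain ⟨a, ha, haS⟩ := ex A hAk
  obtain ⟨b, hb, hbS⟩ := ex B hBk
  obtain ⟨p, hp⟩ := exists_walk_avoiding (T := T) (S := S) (by omega) (hA ha) (hB hb) haS hbS
  obtain ⟨x, hx, hxS⟩ := hS a ha b hb p
  exact hp x hx hxS

end Triangulation

namespace Triangulation

variable {T : Triangulation}

/-- A mod 2 chain with even degree at each vertex. -/
def IsEven (T : Triangulation) (x : Finset ℕ → ZMod 2) : Prop :=
  ∀ v, ∑ e ∈ T.edges with v ∈ e, x e = 0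

/-- A mod 2 boundary. -/
def IsBd (T : Triangulation) (x : Finset ℕ → ZMod 2) : Prop :=
  ∃ s : Finset ℕ → ZMod 2, ∀ e ∈ T.edges, x e = ∑ f ∈ T.faces with e ⊆ f, s f

/-- `t v` colours the faces around `v`, the colour changing exactly across the edges of `x`. -/
def IsCol (T : Triangulation) (x : Finset ℕ → ZMod 2) (t : ℕ → Finset ℕ → ZMod 2) : Prop :=
  ∀ e ∈ T.edges, ∀ v ∈ e, ∑ f ∈ T.faces with e ⊆ f, t v f = x e

/-- The sum of the colours at the two ends of an edge, seen in a face containing the edge. -/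
noncomputable def edgeCol (T : Triangulation) (t : ℕ → Finset ℕ → ZMod 2) (e : Finset ℕ) : ZMod 2 :=
  if h : ∃ f ∈ T.faces, e ⊆ f then ∑ v ∈ e, t v h.choose else 0

/-- The intersection number of a coloured chain with a chain. -/
noncomputable def pairing (T : Triangulation) (t : ℕ → Finset ℕ → ZMod 2) :
    (Finset ℕ → ZMod 2) →+ ZMod 2 where
  toFun y := ∑ e ∈ T.edges, edgeCol T t e * y e
  map_zero' := by simp
  map_add' x y := by simp [mul_add, Finset.sum_add_distrib]

theorem pairing_apply (t : ℕ → Finset ℕ → ZMod 2) (y : Finset ℕ → ZMod 2) :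
    T.pairing t y = ∑ e ∈ T.edges, edgeCol T t e * y e := rfl

theorem IsEven.add {x y : Finset ℕ → ZMod 2} (hx : T.IsEven x) (hy : T.IsEven y) :
    T.IsEven (x + y) := fun v => by simp [Finset.sum_add_distrib, hx v, hy v]

theorem IsEven.zero : T.IsEven 0 := fun v => by simp

theorem IsBd.add {x y : Finset ℕ → ZMod 2} (hx : T.IsBd x) (hy : T.IsBd y) : T.IsBd (x + y) := by
  obtain ⟨s, hs⟩ := hx
  obtain ⟨r, hr⟩ := hy
  exact ⟨s + r, fun e he => by simp [Finset.sum_add_distrib, hs e he, hr e he]⟩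

theorem IsBd.zero : T.IsBd 0 := ⟨0, fun e _ => by simp⟩

theorem IsCol.eq {x : Finset ℕ → ZMod 2} {t : ℕ → Finset ℕ → ZMod 2} (h : T.IsCol x t)
    {e f g : Finset ℕ} (he : e ∈ T.edges) (hf : f ∈ T.faces) (hg : g ∈ T.faces) (hfg : f ≠ g)
    (hef : e ⊆ f) (heg : e ⊆ g) {v : ℕ} (hv : v ∈ e) : t v f + t v g = x e := by
  rw [← h e he v hv, sum_faces_edge he hf hg hfg hef heg]

theorem IsCol.add {x y : Finset ℕ → ZMod 2} {t r : ℕ → Finset ℕ → ZMod 2} (hx : T.IsCol x t)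
    (hy : T.IsCol y r) : T.IsCol (x + y) (t + r) := fun e he v hv => by
  simp [Finset.sum_add_distrib, hx e he v hv, hy e he v hv]

theorem IsCol.congr {x y : Finset ℕ → ZMod 2} {t : ℕ → Finset ℕ → ZMod 2} (hx : T.IsCol x t)
    (h : ∀ e ∈ T.edges, x e = y e) : T.IsCol y t := fun e he v hv => by
  rw [hx e he v hv, h e he]

theorem sum_edges_at_face_comm (v : ℕ) (w : Finset ℕ → ZMod 2) :
    ∑ e ∈ T.edges with v ∈ e, ∑ f ∈ T.faces with e ⊆ f, w f = 0 := by
  have : ∀ e, (if v ∈ e then ∑ f ∈ T.faces, if e ⊆ f then w f else 0 else 0) =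
      ∑ f ∈ T.faces, if v ∈ e ∧ e ⊆ f then w f else 0 := fun e => by
    by_cases h : v ∈ e <;> simp [h]
  simp only [Finset.sum_filter, this]
  rw [Finset.sum_comm]
  refine Finset.sum_eq_zero fun f hf => ?_
  rw [← Finset.sum_filter]
  by_cases hv : v ∈ f
  · obtain ⟨a, b, h1, h2, h3, rfl⟩ := exists_eq_of_mem hf hv
    rw [sum_edges_face_at h1 h2 h3 hf, CharTwo.add_self_eq_zero]
  · refine Finset.sum_eq_zero fun e he => absurd ?_ hv
    exact (Finset.mem_filter.1 he).2.2 (Finset.mem_filter.1 he).2.1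

theorem IsCol.isEven {x : Finset ℕ → ZMod 2} {t : ℕ → Finset ℕ → ZMod 2} (h : T.IsCol x t) :
    T.IsEven x := fun v => by
  rw [← sum_edges_at_face_comm v (t v)]
  refine Finset.sum_congr rfl fun e he => ?_
  rw [Finset.mem_filter] at he
  rw [h e he.1 v he.2]

theorem IsBd.isEven {x : Finset ℕ → ZMod 2} (h : T.IsBd x) : T.IsEven x := by
  obtain ⟨s, hs⟩ := h
  exact IsCol.isEven (t := fun _ => s) fun e he v _ => (hs e he).symm

theorem IsEven.exists_isCol {x : Finset ℕ → ZMod 2} (hx : T.IsEven x) : ∃ t, T.IsCol x t := by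
  have key : ∀ v, ∃ t : Finset ℕ → ZMod 2, ∀ e ∈ {e ∈ T.edges | v ∈ e},
      ∑ f ∈ {f ∈ T.faces | v ∈ f} with e ⊆ f, t f = x e := by
    intro v
    refine exists_incidence_solution _ _ (fun e f : Finset ℕ => e ⊆ f) _ fun φ hφ => ?_
    by_cases hne : ∃ e₀ ∈ T.edges, v ∈ e₀
    · obtain ⟨e₀, he₀, hv₀⟩ := hne
      have hpair : ∀ f ∈ T.faces, ∀ e ∈ T.edges, ∀ e' ∈ T.edges, v ∈ e → v ∈ e' → e ⊆ f → e' ⊆ f →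
          φ e = φ e' := by
        intro f hf e he e' he' hv hv' hef hef'
        by_cases hee : e = e'
        · rw [hee]
        obtain ⟨a, b, h1, h2, h3, rfl⟩ := exists_eq_of_mem hf (hef hv)
        have h := hφ _ (Finset.mem_filter.2 ⟨hf, hef hv⟩)
        rw [Finset.filter_filter, sum_edges_face_at h1 h2 h3 hf] at h
        have hab : φ {v, a} = φ {v, b} := by
          rwa [← CharTwo.sub_eq_add, sub_eq_zero] at h
        have cases : ∀ e ∈ T.edges, v ∈ e → e ⊆ {v, a, b} → e = {v, a} ∨ e = {v, b} := by
          intro e he hv hef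
          have : e ∈ {e ∈ T.edges | e ⊆ {v, a, b}} := Finset.mem_filter.2 ⟨he, hef⟩
          rw [edges_filter_face h1 h2 h3 hf] at this
          simp only [Finset.mem_insert, Finset.mem_singleton] at this
          rcases this with h | h | h
          · exact Or.inl h
          · exact Or.inr h
          · rw [h] at hv; simp [h1, h2] at hv
        rcases cases e he hv hef with rfl | rfl <;> rcases cases e' he' hv' hef' with rfl | rfl <;>
          simp [hab]
      have hconst : ∀ e ∈ T.edges, v ∈ e → φ e = φ e₀ := by
        intro e he hv
        obtain ⟨-, f₀, hf₀, hef₀⟩ := mem_edges.1 he₀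
        obtain ⟨-, f, hf, hef⟩ := mem_edges.1 he
        refine link_induction (v := v)
          (P := fun f => ∀ e ∈ T.edges, v ∈ e → e ⊆ f → φ e = φ e₀) ?_ hf₀ hf (hef₀ hv₀) (hef hv)
          ?_ e he hv hef
        · intro f hf g hg _ d hd hvd hdf hdg ih e he hv heg
          rw [← ih d hd hvd hdf]
          exact hpair g hg e he d hd hv hvd heg hdg
        · intro e he hv hef
          exact hpair f₀ hf₀ e he e₀ he₀ hv hv₀ hef hef₀
      rw [Finset.sum_congr rfl (g := fun e => φ e₀ * x e), ← Finset.mul_sum, hx v, mul_zero]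
      intro e he
      rw [Finset.mem_filter] at he
      rw [hconst e he.1 he.2]
    · refine Finset.sum_eq_zero fun e he => absurd ⟨e, ?_⟩ hne
      simpa using he
  choose t ht using key
  refine ⟨t, fun e he v hv => ?_⟩
  rw [← ht v e (Finset.mem_filter.2 ⟨he, hv⟩), Finset.filter_filter]
  refine Finset.sum_congr ?_ fun _ _ => rfl
  ext f
  simp only [Finset.mem_filter]
  exact ⟨fun h => ⟨h.1, h.2 hv, h.2⟩, fun h => ⟨h.1, h.2.2⟩⟩

theorem sum_vertices_add_self (e : Finset ℕ) (he : e ∈ T.edges) (c : ZMod 2) :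
    ∑ _v ∈ e, c = 0 := by
  rw [Finset.sum_const, card_of_mem_edges he, two_nsmul, CharTwo.add_self_eq_zero]

theorem IsCol.edgeCol_eq {x : Finset ℕ → ZMod 2} {t : ℕ → Finset ℕ → ZMod 2} (h : T.IsCol x t)
    {e f : Finset ℕ} (he : e ∈ T.edges) (hf : f ∈ T.faces) (hef : e ⊆ f) :
    edgeCol T t e = ∑ v ∈ e, t v f := by
  have hex : ∃ f ∈ T.faces, e ⊆ f := ⟨f, hf, hef⟩
  rw [edgeCol, dif_pos hex]
  by_cases hfg : f = hex.choose
  · rw [← hfg]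
  · rw [← sub_eq_zero, CharTwo.sub_eq_add, ← Finset.sum_add_distrib,
      ← sum_vertices_add_self e he (x e)]
    refine Finset.sum_congr rfl fun v hv => ?_
    rw [add_comm]
    exact h.eq he hf hex.choose_spec.1 hfg hef hex.choose_spec.2 hv

theorem edgeCol_add (t r : ℕ → Finset ℕ → ZMod 2) (e : Finset ℕ) :
    edgeCol T (t + r) e = edgeCol T t e + edgeCol T r e := by
  unfold edgeCol
  split_ifs <;> simp [Finset.sum_add_distrib]

theorem pairing_add_left (t r : ℕ → Finset ℕ → ZMod 2) (y : Finset ℕ → ZMod 2) :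
    T.pairing (t + r) y = T.pairing t y + T.pairing r y := by
  simp [pairing_apply, edgeCol_add, add_mul, Finset.sum_add_distrib]

theorem pairing_eq_zero_of_potential {t : ℕ → Finset ℕ → ZMod 2} {y : Finset ℕ → ZMod 2}
    (hy : T.IsEven y) (p : ℕ → ZMod 2)
    (h : ∀ e ∈ T.edges, y e ≠ 0 → edgeCol T t e = ∑ v ∈ e, p v) : T.pairing t y = 0 := by
  have h1 : T.pairing t y = ∑ e ∈ T.edges, ∑ v ∈ T.verts, if v ∈ e then p v * y e else 0 := by
    rw [pairing_apply]
    refine Finset.sum_congr rfl fun e he => ?_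
    by_cases h0 : y e = 0
    · simp [h0]
    · rw [h e he h0, Finset.sum_mul, ← Finset.sum_filter]
      refine Finset.sum_congr ?_ fun _ _ => rfl
      ext v
      simp only [Finset.mem_filter]
      exact ⟨fun hv => ⟨mem_verts_of_mem_edges he hv, hv⟩, fun hv => hv.2⟩
  rw [h1, Finset.sum_comm]
  refine Finset.sum_eq_zero fun v _ => ?_
  rw [← Finset.sum_filter, ← Finset.mul_sum, hy v, mul_zero]

theorem IsCol.const {x : Finset ℕ → ZMod 2} {t : ℕ → Finset ℕ → ZMod 2} (h : T.IsCol x t) {v : ℕ}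
    (hx : ∀ e ∈ T.edges, v ∈ e → x e = 0) {f g : Finset ℕ} (hf : f ∈ T.faces) (hg : g ∈ T.faces)
    (hvf : v ∈ f) (hvg : v ∈ g) : t v f = t v g := by
  refine link_induction (v := v) (P := fun g => t v f = t v g) ?_ hf hg hvf hvg rfl
  intro a ha b hb hab e he hve hea heb ih
  have := h.eq he ha hb hab hea heb hve
  rw [hx e he hve, ← CharTwo.sub_eq_add, sub_eq_zero] at this
  rw [ih, this]

theorem IsCol.exists_potential {x : Finset ℕ → ZMod 2} {t : ℕ → Finset ℕ → ZMod 2} (h : T.IsCol x t)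
    (X : Set ℕ) (hx : ∀ e ∈ T.edges, x e ≠ 0 → ∀ v ∈ e, v ∈ X) :
    ∃ p : ℕ → ZMod 2, ∀ f ∈ T.faces, ∀ v ∈ f, v ∉ X → t v f = p v := by
  refine ⟨fun v => if h : ∃ f ∈ T.faces, v ∈ f then t v h.choose else 0, fun f hf v hv hvX => ?_⟩
  have hex : ∃ f ∈ T.faces, v ∈ f := ⟨f, hf, hv⟩
  simp only [dif_pos hex]
  refine h.const (fun e he hve => ?_) hf hex.choose_spec.1 hv hex.choose_spec.2
  by_contra h0
  exact hvX (hx e he h0 v hve)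

theorem IsCol.pairing_eq_zero_of_disjoint {x y : Finset ℕ → ZMod 2} {t : ℕ → Finset ℕ → ZMod 2}
    (h : T.IsCol x t) (hy : T.IsEven y) (X : Set ℕ)
    (hx : ∀ e ∈ T.edges, x e ≠ 0 → ∀ v ∈ e, v ∈ X)
    (hyX : ∀ e ∈ T.edges, y e ≠ 0 → ∀ v ∈ e, v ∉ X) : T.pairing t y = 0 := by
  obtain ⟨p, hp⟩ := h.exists_potential X hx
  refine pairing_eq_zero_of_potential hy p fun e he h0 => ?_
  obtain ⟨-, f, hf, hef⟩ := mem_edges.1 he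
  rw [h.edgeCol_eq he hf hef]
  exact Finset.sum_congr rfl fun v hv => hp f hf v (hef hv) (hyX e he h0 v hv)

theorem IsCol.pairing_unique {x y : Finset ℕ → ZMod 2} {t r : ℕ → Finset ℕ → ZMod 2}
    (ht : T.IsCol x t) (hr : T.IsCol x r) (hy : T.IsEven y) : T.pairing t y = T.pairing r y := by
  rw [← sub_eq_zero, CharTwo.sub_eq_add, ← pairing_add_left]
  refine ((ht.add hr).congr (y := 0) fun e _ => ?_).pairing_eq_zero_of_disjoint hy ∅ ?_ ?_
  · simp [CharTwo.add_self_eq_zero]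
  · simp
  · simp

theorem IsCol.pairing_comm {x y : Finset ℕ → ZMod 2} {t r : ℕ → Finset ℕ → ZMod 2}
    (ht : T.IsCol x t) (hr : T.IsCol y r) : T.pairing t y = T.pairing r x := by
  rw [← sub_eq_zero, CharTwo.sub_eq_add, pairing_apply, pairing_apply, ← Finset.sum_add_distrib]
  have h1 : ∀ e ∈ T.edges, edgeCol T t e * y e + edgeCol T r e * x e =
      ∑ f ∈ T.faces with e ⊆ f, ∑ v ∈ e, t v f * r v f := by
    intro e he
    obtain ⟨f, g, hfg, hf, hg, hef, heg, hh⟩ := exists_two_faces he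
    rw [hh, Finset.sum_pair hfg, ht.edgeCol_eq he hf hef, hr.edgeCol_eq he hf hef]
    obtain ⟨u, v, huv, rfl⟩ := Finset.card_eq_two.1 (card_of_mem_edges he)
    simp only [Finset.sum_pair huv]
    have hu : u ∈ ({u, v} : Finset ℕ) := by simp
    have hv : v ∈ ({u, v} : Finset ℕ) := by simp
    have e1 := ht.eq he hf hg hfg hef heg hu
    have e2 := ht.eq he hf hg hfg hef heg hv
    have e3 := hr.eq he hf hg hfg hef heg hu
    have e4 := hr.eq he hf hg hfg hef heg hv
    generalize x {u, v} = a at *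
    generalize y {u, v} = b at *
    generalize t u f = t1 at *
    generalize t u g = t2 at *
    generalize t v f = t3 at *
    generalize t v g = t4 at *
    generalize r u f = r1 at *
    generalize r u g = r2 at *
    generalize r v f = r3 at *
    generalize r v g = r4 at *
    have ht2 : t2 = t1 + a := by rw [← e1, ← add_assoc, CharTwo.add_self_eq_zero, zero_add]
    have ht4 : t4 = t3 + a := by rw [← e2, ← add_assoc, CharTwo.add_self_eq_zero, zero_add]
    have hr2 : r2 = r1 + b := by rw [← e3, ← add_assoc, CharTwo.add_self_eq_zero, zero_add]
    have hr4 : r4 = r3 + b := by rw [← e4, ← add_assoc, CharTwo.add_self_eq_zero, zero_add]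
    rw [ht2, ht4, hr2, hr4]
    linear_combination (-(t1 * r1) - t3 * r3 - a * b) * CharTwo.two_eq_zero (R := ZMod 2)
  rw [Finset.sum_congr rfl h1, sum_edge_face_comm]
  refine Finset.sum_eq_zero fun f hf => ?_
  obtain ⟨a, b, c, hab, hac, hbc, rfl⟩ := exists_eq hf
  rw [sum_edges_face hab hac hbc hf, Finset.sum_pair hab, Finset.sum_pair hac, Finset.sum_pair hbc]
  linear_combination (t a {a, b, c} * r a {a, b, c} + t b {a, b, c} * r b {a, b, c} +
    t c {a, b, c} * r c {a, b, c}) * CharTwo.two_eq_zero (R := ZMod 2)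

theorem IsCol.pairing_bd {x y : Finset ℕ → ZMod 2} {t : ℕ → Finset ℕ → ZMod 2}
    (ht : T.IsCol x t) (hy : T.IsBd y) : T.pairing t y = 0 := by
  obtain ⟨s, hs⟩ := hy
  have h1 : ∀ e ∈ T.edges, edgeCol T t e * y e =
      ∑ f ∈ T.faces with e ⊆ f, s f * ∑ v ∈ e, t v f := by
    intro e he
    rw [hs e he, Finset.mul_sum]
    refine Finset.sum_congr rfl fun f hf => ?_
    rw [Finset.mem_filter] at hf
    rw [ht.edgeCol_eq he hf.1 hf.2, mul_comm]
  rw [pairing_apply, Finset.sum_congr rfl h1, sum_edge_face_comm]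
  refine Finset.sum_eq_zero fun f hf => ?_
  obtain ⟨a, b, c, hab, hac, hbc, rfl⟩ := exists_eq hf
  rw [sum_edges_face hab hac hbc hf, Finset.sum_pair hab, Finset.sum_pair hac, Finset.sum_pair hbc]
  linear_combination (s {a, b, c}) * (t a {a, b, c} + t b {a, b, c} +
    t c {a, b, c}) * CharTwo.two_eq_zero (R := ZMod 2)

/-- A colouring of an even chain. -/
noncomputable def col (T : Triangulation) (x : Finset ℕ → ZMod 2) : ℕ → Finset ℕ → ZMod 2 :=
  if h : ∃ t, T.IsCol x t then h.choose else 0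

theorem IsEven.isCol {x : Finset ℕ → ZMod 2} (hx : T.IsEven x) : T.IsCol x (T.col x) := by
  have h := hx.exists_isCol
  rw [col, dif_pos h]
  exact h.choose_spec

/-- The mod 2 intersection form. -/
noncomputable def inter (T : Triangulation) (x : Finset ℕ → ZMod 2) :
    (Finset ℕ → ZMod 2) →+ ZMod 2 := T.pairing (T.col x)

theorem IsCol.inter_eq {x y : Finset ℕ → ZMod 2} {t : ℕ → Finset ℕ → ZMod 2} (ht : T.IsCol x t)
    (hy : T.IsEven y) : T.inter x y = T.pairing t y :=
  ht.isEven.isCol.pairing_unique ht hy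

theorem inter_comm {x y : Finset ℕ → ZMod 2} (hx : T.IsEven x) (hy : T.IsEven y) :
    T.inter x y = T.inter y x := hx.isCol.pairing_comm hy.isCol

theorem inter_add_left {x y z : Finset ℕ → ZMod 2} (hx : T.IsEven x) (hy : T.IsEven y)
    (hz : T.IsEven z) : T.inter (x + y) z = T.inter x z + T.inter y z := by
  rw [inter_comm (hx.add hy) hz, map_add, inter_comm hz hx, inter_comm hz hy]

theorem inter_bd_right {x y : Finset ℕ → ZMod 2} (hx : T.IsEven x) (hy : T.IsBd y) :
    T.inter x y = 0 := hx.isCol.pairing_bd hy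

/-- The chain of a single edge. -/
noncomputable def edgeChain (u v : ℕ) : Finset ℕ → ZMod 2 := Pi.single {u, v} 1

theorem edgeChain_comm (u v : ℕ) : edgeChain u v = edgeChain v u := by
  rw [edgeChain, edgeChain, Finset.pair_comm]

theorem pairing_edgeChain (t : ℕ → Finset ℕ → ZMod 2) {u v : ℕ} (h : {u, v} ∈ T.edges) :
    T.pairing t (edgeChain u v) = edgeCol T t {u, v} := by
  rw [pairing_apply, Finset.sum_eq_single {u, v}]
  · simp [edgeChain]
  · intro e _ he; simp [edgeChain, he]
  · exact fun hn => absurd h hn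

theorem degree_wlab {u w : ℕ} (p : T.graph.Walk u w) (v : ℕ) :
    ∑ e ∈ T.edges with v ∈ e, p.wlab edgeChain e =
      (if v = u then 1 else 0) + (if v = w then 1 else 0) := by
  induction p with
  | nil => simp [CharTwo.add_self_eq_zero]
  | @cons a b c h p ih =>
    have hab : {a, b} ∈ T.edges := h
    simp only [SimpleGraph.Walk.wlab_cons, Pi.add_apply, Finset.sum_add_distrib, ih]
    have : ∑ e ∈ T.edges with v ∈ e, edgeChain a b e =
        if v ∈ ({a, b} : Finset ℕ) then 1 else 0 := by
      rw [Finset.sum_filter, Finset.sum_eq_single {a, b}]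
      · simp [edgeChain]
      · intro e _ he; simp [edgeChain, he]
      · exact fun hn => absurd hab hn
    rw [this]
    have hne : a ≠ b := h.ne
    by_cases h1 : v = a
    · subst h1; simp [hne]
    · by_cases h2 : v = b
      · subst h2; simp [h1, ← add_assoc, CharTwo.add_self_eq_zero]
      · simp [h1, h2]

theorem isEven_wlab {u : ℕ} (c : T.graph.Walk u u) : T.IsEven (c.wlab edgeChain) := fun v => by
  rw [degree_wlab, CharTwo.add_self_eq_zero]

theorem support_of_wlab {u w : ℕ} (p : T.graph.Walk u w) {e : Finset ℕ}
    (h : p.wlab edgeChain e ≠ 0) : ∀ v ∈ e, v ∈ p.support := by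
  induction p with
  | nil => simp at h
  | @cons a b c hab p ih =>
    intro v hv
    rw [SimpleGraph.Walk.wlab_cons, Pi.add_apply] at h
    by_cases he : e = {a, b}
    · subst he
      simp only [Finset.mem_insert, Finset.mem_singleton] at hv
      rcases hv with rfl | rfl <;> simp
    · have : edgeChain a b e = 0 := by simp [edgeChain, he]
      rw [this, zero_add] at h
      exact List.mem_cons_of_mem _ (ih h v hv)

theorem IsCol.isBd_of_potential {x : Finset ℕ → ZMod 2} {t : ℕ → Finset ℕ → ZMod 2}
    (ht : T.IsCol x t) (β : ℕ → ZMod 2)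
    (h : ∀ u v, T.graph.Adj u v → edgeCol T t {u, v} = β u + β v) : T.IsBd x := by
  have hs : ∀ f ∈ T.faces, ∀ u ∈ f, ∀ v ∈ f, t u f + β u = t v f + β v := by
    intro f hf u hu v hv
    by_cases huv : u = v
    · rw [huv]
    have he := pair_mem_edges hf hu hv huv
    have h1 := h u v he
    rw [ht.edgeCol_eq he hf (by intro z; simp; rintro (rfl | rfl) <;> assumption),
      Finset.sum_pair huv] at h1
    rw [← sub_eq_zero, CharTwo.sub_eq_add]
    linear_combination h1 + (β u + β v) * CharTwo.two_eq_zero (R := ZMod 2)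
  refine ⟨fun f => if h : f.Nonempty then t h.choose f + β h.choose else 0, fun e he => ?_⟩
  obtain ⟨f, g, hfg, hf, hg, hef, heg, hh⟩ := exists_two_faces he
  obtain ⟨v, hv⟩ : e.Nonempty := Finset.card_pos.1 (by rw [card_of_mem_edges he]; norm_num)
  have key : ∀ f ∈ T.faces, e ⊆ f →
      (if h : f.Nonempty then t h.choose f + β h.choose else 0) = t v f + β v := by
    intro f hf hef
    have hne : f.Nonempty := ⟨v, hef hv⟩
    rw [dif_pos hne]
    exact hs f hf _ hne.choose_spec v (hef hv)
  rw [hh, Finset.sum_pair hfg, key f hf hef, key g hg heg, ← ht.eq he hf hg hfg hef heg hv]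
  linear_combination (-β v) * CharTwo.two_eq_zero (R := ZMod 2)

/-- The intersection form is nondegenerate, and cycles suffice to see this. -/
theorem IsEven.isBd_of_inter {x : Finset ℕ → ZMod 2} (hx : T.IsEven x)
    (h : ∀ (u : ℕ) (c : T.graph.Walk u u), c.IsCycle → T.inter x (c.wlab edgeChain) = 0) :
    T.IsBd x := by
  obtain ⟨β, hβ⟩ := SimpleGraph.exists_potential (G := T.graph)
    (l := fun a b => T.inter x (edgeChain a b)) (fun a b => by rw [edgeChain_comm])
    (fun u c hc => by rw [← SimpleGraph.Walk.wlab_map]; exact h u c hc)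
  refine hx.isCol.isBd_of_potential β fun u v huv => ?_
  rw [← pairing_edgeChain _ huv]
  exact hβ u v huv

end Triangulation

theorem finrank_ker_of_constants {ι M : Type*} [Fintype ι] [Nonempty ι] [AddCommGroup M]
    [Module (ZMod 2) M] (A : (ι → ZMod 2) →ₗ[ZMod 2] M)
    (h : ∀ p, A p = 0 ↔ ∀ i j, p i = p j) : Module.finrank (ZMod 2) (LinearMap.ker A) = 1 := by
  have : LinearMap.ker A = Submodule.span (ZMod 2) {fun _ => 1} := by
    ext p
    rw [LinearMap.mem_ker, h, Submodule.mem_span_singleton]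
    constructor
    · intro hp
      refine ⟨p (Classical.arbitrary ι), ?_⟩
      ext i
      simp [hp i (Classical.arbitrary ι)]
    · rintro ⟨a, rfl⟩
      simp
  rw [this]
  refine finrank_span_singleton fun h0 => ?_
  have := congrFun h0 (Classical.arbitrary ι)
  simp at this

namespace Triangulation

variable {T : Triangulation}

theorem sum_subtype_eq {s : Finset (Finset ℕ)} (p : Finset ℕ → Prop) [DecidablePred p]
    (x : s → ZMod 2) :
    ∑ e : s, (if p e then 1 else 0) * x e =
      ∑ e ∈ s with p e, (fun e => if h : e ∈ s then x ⟨e, h⟩ else 0) e := by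
  rw [Finset.sum_filter, ← Finset.sum_attach s]
  refine Finset.sum_congr rfl fun e _ => ?_
  simp

/-- A basis of the first homology mod 2. -/
theorem exists_homology_basis {n : ℕ} (hn : T.euler = 2 - (n : ℤ)) :
    ∃ b : Fin n → Finset ℕ → ZMod 2, (∀ i, T.IsEven (b i)) ∧
      (∀ x, T.IsEven x → ∃ ε : Fin n → ZMod 2, T.IsBd (x + ∑ i, ε i • b i)) ∧
      ∀ ε : Fin n → ZMod 2, T.IsBd (∑ i, ε i • b i) → ε = 0 := by
  obtain ⟨f₀, hf₀⟩ := T.faces_nonempty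
  obtain ⟨a₀, _, _, -, -, -, hf₀'⟩ := exists_eq hf₀
  have : Nonempty T.faces := ⟨⟨f₀, hf₀⟩⟩
  have : Nonempty T.verts := ⟨⟨a₀, mem_verts.2 ⟨f₀, hf₀, by rw [hf₀']; simp⟩⟩⟩
  let ext : (T.edges → ZMod 2) →ₗ[ZMod 2] (Finset ℕ → ZMod 2) :=
    { toFun := fun x e => if h : e ∈ T.edges then x ⟨e, h⟩ else 0
      map_add' := fun x y => by ext e; by_cases h : e ∈ T.edges <;> simp [h]
      map_smul' := fun c x => by ext e; by_cases h : e ∈ T.edges <;> simp [h] }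
  let res : (Finset ℕ → ZMod 2) → (T.edges → ZMod 2) := fun x e => x e
  have hext : ∀ x (e : T.edges), ext x e = x e := fun x e => by simp [ext]
  obtain ⟨M₁, hM₁e⟩ : ∃ M : Matrix T.verts T.edges (ZMod 2),
      ∀ v e, M v e = if (v : ℕ) ∈ (e : Finset ℕ) then 1 else 0 := ⟨fun _ _ => _, fun _ _ => rfl⟩
  obtain ⟨M₂, hM₂e⟩ : ∃ M : Matrix T.edges T.faces (ZMod 2),
      ∀ e f, M e f = if (e : Finset ℕ) ⊆ (f : Finset ℕ) then 1 else 0 :=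
    ⟨fun _ _ => _, fun _ _ => rfl⟩
  have hM₁ : ∀ x, M₁.mulVecLin x = 0 ↔ T.IsEven (ext x) := by
    intro x
    constructor
    · intro h v
      by_cases hv : v ∈ T.verts
      · have := congrFun h ⟨v, hv⟩
        simp only [Matrix.mulVecLin_apply, Matrix.mulVec, dotProduct, hM₁e, Pi.zero_apply] at this
        rw [sum_subtype_eq (fun e => v ∈ e)] at this
        exact this
      · refine Finset.sum_eq_zero fun e he => absurd ?_ hv
        rw [Finset.mem_filter] at he
        exact mem_verts_of_mem_edges he.1 he.2
    · intro h
      ext v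
      simp only [Matrix.mulVecLin_apply, Matrix.mulVec, dotProduct, hM₁e, Pi.zero_apply]
      rw [sum_subtype_eq (fun e => (v : ℕ) ∈ e)]
      exact h v
  have hM₂ : ∀ s (e : T.edges), M₂.mulVecLin s e =
      ∑ f ∈ T.faces with (e : Finset ℕ) ⊆ f,
          (fun f => if h : f ∈ T.faces then s ⟨f, h⟩ else 0) f := by
    intro s e
    simp only [Matrix.mulVecLin_apply, Matrix.mulVec, dotProduct, hM₂e]
    rw [sum_subtype_eq (fun f => (e : Finset ℕ) ⊆ f)]
  have hB : ∀ x, x ∈ LinearMap.range M₂.mulVecLin ↔ T.IsBd (ext x) := by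
    intro x
    constructor
    · rintro ⟨s, rfl⟩
      refine ⟨fun f => if h : f ∈ T.faces then s ⟨f, h⟩ else 0, fun e he => ?_⟩
      rw [← hM₂ s ⟨e, he⟩]
      exact hext _ ⟨e, he⟩
    · rintro ⟨s, hs⟩
      refine ⟨fun f => s f, ?_⟩
      ext e
      rw [hM₂, ← hext x e, hs e e.2]
      refine Finset.sum_congr rfl fun f hf => ?_
      simp [(Finset.mem_filter.1 hf).1]
  have hk₁ : Module.finrank (ZMod 2) (LinearMap.ker M₁.transpose.mulVecLin) = 1 := by
    refine finrank_ker_of_constants _ fun p => ?_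
    have hap : ∀ e : T.edges, ∀ u v (hu : u ∈ T.verts) (hv : v ∈ T.verts), u ≠ v →
        (e : Finset ℕ) = {u, v} → M₁.transpose.mulVecLin p e = p ⟨u, hu⟩ + p ⟨v, hv⟩ := by
      intro e u v hu hv huv he
      simp only [Matrix.mulVecLin_apply, Matrix.mulVec, dotProduct, hM₁e,
        Matrix.transpose_apply, he]
      rw [← Finset.sum_subset (Finset.subset_univ {⟨u, hu⟩, ⟨v, hv⟩}), Finset.sum_pair]
      · simp
      · simpa using huv
      · intro z _ hz
        have : (z : ℕ) ∉ ({u, v} : Finset ℕ) := by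
          intro hz'
          apply hz
          simp only [Finset.mem_insert, Finset.mem_singleton] at hz' ⊢
          exact hz'.imp (fun h => Subtype.ext h) (fun h => Subtype.ext h)
        simp [this]
    constructor
    · intro h i j
      obtain ⟨w, -⟩ := exists_walk_avoiding (T := T) (S := ∅) (by simp) i.2 j.2 (by simp) (by simp)
      have : ∀ (u v : ℕ) (w : T.graph.Walk u v) (hu : u ∈ T.verts) (hv : v ∈ T.verts),
          p ⟨u, hu⟩ = p ⟨v, hv⟩ := by
        intro u v w
        induction w with
        | nil => intros; rfl
        | @cons a b c hab w ih =>
          intro ha hc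
          have hb : b ∈ T.verts := mem_verts_of_mem_edges hab (by simp)
          rw [← ih hb hc, ← sub_eq_zero, CharTwo.sub_eq_add, ← hap ⟨_, hab⟩ a b ha hb hab.ne rfl, h]
          rfl
      exact this i j w i.2 j.2
    · intro h
      ext e
      obtain ⟨u, v, huv, he⟩ := Finset.card_eq_two.1 (card_of_mem_edges e.2)
      have hu : u ∈ T.verts := mem_verts_of_mem_edges e.2 (by rw [he]; simp)
      have hv : v ∈ T.verts := mem_verts_of_mem_edges e.2 (by rw [he]; simp)
      rw [hap e u v hu hv huv he, h ⟨u, hu⟩ ⟨v, hv⟩, CharTwo.add_self_eq_zero]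
      rfl
  have hk₂ : Module.finrank (ZMod 2) (LinearMap.ker M₂.mulVecLin) = 1 := by
    refine finrank_ker_of_constants _ fun s => ?_
    have hs : ∀ e (he : e ∈ T.edges) f g (hf : f ∈ T.faces) (hg : g ∈ T.faces), f ≠ g → e ⊆ f →
        e ⊆ g → M₂.mulVecLin s ⟨e, he⟩ = s ⟨f, hf⟩ + s ⟨g, hg⟩ := by
      intro e he f g hf hg hfg hef heg
      rw [hM₂, sum_faces_edge he hf hg hfg hef heg]
      simp [hf, hg]
    constructor
    · intro h i j
      have := face_induction (T := T) (P := fun g => ∃ hg : g ∈ T.faces, s i = s ⟨g, hg⟩)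
        (by
          rintro f hf g hg hfg e he hef heg ⟨_, ih⟩
          refine ⟨hg, ?_⟩
          rw [ih, ← sub_eq_zero, CharTwo.sub_eq_add, ← hs e he f g hf hg hfg hef heg, h]
          rfl) i.2 j.2 ⟨i.2, rfl⟩
      exact this.2
    · intro h
      ext e
      obtain ⟨f, g, hfg, hf, hg, hef, heg, -⟩ := exists_two_faces e.2
      rw [hs e e.2 f g hf hg hfg hef heg, h ⟨f, hf⟩ ⟨g, hg⟩, CharTwo.add_self_eq_zero]
      rfl
  set W := LinearMap.ker M₁.mulVecLin with hW
  set B := LinearMap.range M₂.mulVecLin with hBdef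
  have hBW : B ≤ W := fun x hx => (hM₁ x).2 ((hB x).1 hx).isEven
  have hfin : Module.finrank (ZMod 2) (W ⧸ B.submoduleOf W) = n := by
    have h1 := Submodule.finrank_quotient_add_finrank (B.submoduleOf W)
    have h2 : Module.finrank (ZMod 2) (B.submoduleOf W) = Module.finrank (ZMod 2) B :=
      (Submodule.submoduleOfEquivOfLe hBW).finrank_eq
    have h3 : _ + Module.finrank (ZMod 2) W = _ := M₁.mulVecLin.finrank_range_add_finrank_ker
    have h4 := M₁.transpose.mulVecLin.finrank_range_add_finrank_ker
    have h5 : Module.finrank (ZMod 2) B + _ = _ := M₂.mulVecLin.finrank_range_add_finrank_ker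
    have h6 : Module.finrank (ZMod 2) (LinearMap.range M₁.transpose.mulVecLin) =
      Module.finrank (ZMod 2) (LinearMap.range M₁.mulVecLin) := M₁.rank_transpose
    rw [hk₁] at h4
    rw [hk₂] at h5
    rw [Module.finrank_fintype_fun_eq_card, Fintype.card_coe] at h3 h4 h5
    unfold euler at hn
    omega
  obtain ⟨bas⟩ : Nonempty (Module.Basis (Fin n) (ZMod 2) (W ⧸ B.submoduleOf W)) :=
    ⟨Module.finBasisOfFinrankEq _ _ hfin⟩
  choose c hc using fun i => Submodule.mkQ_surjective _ (bas i)
  have hsum : ∀ ε : Fin n → ZMod 2, (B.submoduleOf W).mkQ (∑ i, ε i • c i) = ∑ i, ε i • bas i := by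
    intro ε; simp only [map_sum, map_smul, hc]
  have hext' : ∀ ε : Fin n → ZMod 2,
      ∑ i, ε i • ext (c i) = ext ((∑ i, ε i • c i : W) : T.edges → ZMod 2) := by
    intro ε; simp [map_sum, map_smul]
  refine ⟨fun i => ext (c i), fun i => (hM₁ _).1 (c i).2, fun x hx => ?_, fun ε hε => ?_⟩
  · have hxe : ∀ e ∈ T.edges, ext (res x) e = x e := fun e he => hext (res x) ⟨e, he⟩
    have hxW : res x ∈ W := by
      refine (hM₁ _).2 fun v => ?_
      rw [← hx v]
      exact Finset.sum_congr rfl fun e he => hxe e (Finset.mem_filter.1 he).1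
    refine ⟨bas.repr ((B.submoduleOf W).mkQ ⟨res x, hxW⟩), ?_⟩
    set ε := bas.repr ((B.submoduleOf W).mkQ ⟨res x, hxW⟩) with hε
    have h1 : (B.submoduleOf W).mkQ (⟨res x, hxW⟩ + ∑ i, ε i • c i) = 0 := by
      rw [map_add, hsum, bas.sum_repr, ZModModule.add_self]
    rw [Submodule.mkQ_apply, Submodule.Quotient.mk_eq_zero] at h1
    replace h1 := (hB _).1 h1
    obtain ⟨s, hs⟩ := h1
    refine ⟨s, fun e he => ?_⟩
    rw [← hs e he, hext', Submodule.subtype_apply, Submodule.coe_add, map_add,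
      Pi.add_apply, Pi.add_apply, hxe e he]
  · rw [hext', ← hB] at hε
    have h1 : (B.submoduleOf W).mkQ (∑ i, ε i • c i) = 0 := by
      rw [Submodule.mkQ_apply, Submodule.Quotient.mk_eq_zero]
      exact hε
    rw [hsum] at h1
    exact funext fun i => Fintype.linearIndependent_iff.1 bas.linearIndependent ε h1 i

end Triangulation

namespace Triangulation

variable {T : Triangulation} {k m x y w : Finset ℕ → ZMod 2}

theorem IsEven.smul (c : ZMod 2) (hx : T.IsEven x) : T.IsEven (c • x) := fun v => by
  simp [← Finset.mul_sum, hx v]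

theorem IsBd.smul (c : ZMod 2) (hx : T.IsBd x) : T.IsBd (c • x) := by
  obtain ⟨s, hs⟩ := hx
  exact ⟨c • s, fun e he => by simp [← Finset.mul_sum, hs e he]⟩

theorem IsEven.sum {ι : Type*} {s : Finset ι} {b : ι → Finset ℕ → ZMod 2}
    (h : ∀ i ∈ s, T.IsEven (b i)) : T.IsEven (∑ i ∈ s, b i) :=
  Finset.sum_induction b _ (fun _ _ => IsEven.add) IsEven.zero h

theorem IsBd.sum {ι : Type*} {s : Finset ι} {b : ι → Finset ℕ → ZMod 2}
    (h : ∀ i ∈ s, T.IsBd (b i)) : T.IsBd (∑ i ∈ s, b i) :=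
  Finset.sum_induction b _ (fun _ _ => IsBd.add) IsBd.zero h

theorem chain_add_self (x : Finset ℕ → ZMod 2) : x + x = 0 := ZModModule.add_self x

theorem inter_congr_right (hx : T.IsEven x) (h : T.IsBd (y + w)) : T.inter x y = T.inter x w := by
  have := inter_bd_right hx h
  rwa [map_add, ← CharTwo.sub_eq_add, sub_eq_zero] at this

theorem exists_relation (hn : T.euler = 2 - ((3 : ℕ) : ℤ)) {c : Fin 4 → Finset ℕ → ZMod 2}
    (hc : ∀ i, T.IsEven (c i)) : ∃ g : Fin 4 → ZMod 2, g ≠ 0 ∧ T.IsBd (∑ i, g i • c i) := by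
  obtain ⟨b, hb, hspan, -⟩ := exists_homology_basis hn
  choose q hq using fun i => hspan (c i) (hc i)
  have hdep : ¬ LinearIndependent (ZMod 2) q := fun h => by
    have := h.fintype_card_le_finrank
    simp at this
  obtain ⟨g, hg, i, hi⟩ := Fintype.not_linearIndependent_iff.1 hdep
  refine ⟨g, fun h => hi (by rw [h]; rfl), ?_⟩
  have h1 : T.IsBd (∑ i, g i • (c i + ∑ j, q i j • b j)) :=
    IsBd.sum fun i _ => (hq i).smul (g i)
  have h2 : ∑ i, g i • ∑ j, q i j • b j = ∑ j, (∑ i, g i • q i) j • b j := by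
    simp only [Finset.smul_sum, Finset.sum_apply, Finset.sum_smul, Pi.smul_apply, smul_smul,
      smul_eq_mul]
    exact Finset.sum_comm
  simp only [smul_add, Finset.sum_add_distrib] at h1
  rw [h2, hg] at h1
  simpa using h1

theorem exists_span (hn : T.euler = 2 - ((3 : ℕ) : ℤ)) (hk : T.IsEven k) (hy : T.IsEven y)
    (hw : T.IsEven w)
    (hi : ∀ α β γ : ZMod 2, T.IsBd (α • k + β • y + γ • w) → α = 0 ∧ β = 0 ∧ γ = 0)
    (hx : T.IsEven x) : ∃ α β γ : ZMod 2, T.IsBd (x + (α • k + β • y + γ • w)) := by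
  obtain ⟨g, hg, hB⟩ := exists_relation hn (c := ![k, y, w, x])
    (by intro i; fin_cases i <;> assumption)
  simp only [Fin.sum_univ_four, Matrix.cons_val] at hB
  have hz : ∀ a : ZMod 2, a = 0 ∨ a = 1 := by decide
  rcases hz (g 3) with h3 | h3
  · rw [h3, zero_smul, add_zero] at hB
    obtain ⟨h0, h1, h2⟩ := hi _ _ _ hB
    exact absurd (funext fun i => by fin_cases i <;> assumption) hg
  · rw [h3, one_smul, add_comm] at hB
    exact ⟨_, _, _, hB⟩

theorem isBd_of_perp (hn : T.euler = 2 - ((3 : ℕ) : ℤ)) (hk : T.IsEven k) (hy : T.IsEven y)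
    (hw : T.IsEven w)
    (hi : ∀ α β γ : ZMod 2, T.IsBd (α • k + β • y + γ • w) → α = 0 ∧ β = 0 ∧ γ = 0)
    (hx : T.IsEven x) (hxk : T.inter x k = 0) (hxy : T.inter x y = 0) (hxw : T.inter x w = 0) :
    T.IsBd x := by
  have hsm : ∀ (c : ZMod 2) z, T.inter x z = 0 → T.inter x (c • z) = 0 := by
    intro c z hz
    have : ∀ a : ZMod 2, a = 0 ∨ a = 1 := by decide
    rcases this c with rfl | rfl <;> simp [hz]
  refine hx.isBd_of_inter fun u c _ => ?_
  obtain ⟨α, β, γ, h⟩ := exists_span hn hk hy hw hi (isEven_wlab c)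
  rw [inter_congr_right hx h, map_add, map_add, hsm _ _ hxk, hsm _ _ hxy, hsm _ _ hxw]
  simp

theorem isBd_cases (hn : T.euler = 2 - ((3 : ℕ) : ℤ)) (hk : T.IsEven k) (hkB : ¬ T.IsBd k)
    (hkk : T.inter k k = 0) (hy : T.IsEven y) (hyB : ¬ T.IsBd y) (hykB : ¬ T.IsBd (y + k))
    (hky : T.inter k y = 0) (hw : T.IsEven w) (hkw : T.inter k w = 0) :
    T.IsBd w ∨ T.IsBd (w + k) ∨ T.IsBd (w + y) ∨ T.IsBd (w + (y + k)) := by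
  by_contra hno
  push Not at hno
  obtain ⟨h1, h2, h3, h4⟩ := hno
  refine hkB (isBd_of_perp hn hk hy hw (fun α β γ h => ?_) hk hkk hky hkw)
  have hz : ∀ a : ZMod 2, a = 0 ∨ a = 1 := by decide
  rcases hz α with rfl | rfl <;> rcases hz β with rfl | rfl <;> rcases hz γ with rfl | rfl <;>
    simp only [zero_smul, one_smul, zero_add, add_zero] at h
  · simp
  · exact absurd h h1
  · exact absurd h hyB
  · exact absurd (by rwa [add_comm]) h3
  · exact absurd h hkB
  · exact absurd (by rwa [add_comm]) h2
  · exact absurd (by rwa [add_comm]) hykB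
  · exact absurd (by rwa [add_comm y k, add_comm]) h4

theorem exists_perp (hn : T.euler = 2 - ((3 : ℕ) : ℤ)) (x : Finset ℕ → ZMod 2) (hm : T.IsEven m) :
    ∃ y, T.IsEven y ∧ T.inter x y = 0 ∧ ¬ T.IsBd y ∧ ¬ T.IsBd (y + m) := by
  obtain ⟨b, hb, hspan, hind⟩ := exists_homology_basis hn
  obtain ⟨μ, hμ⟩ := hspan m hm
  have hdec : ∀ g0 g1 g2 u0 u1 u2 : ZMod 2, ∃ e0 e1 e2 : ZMod 2, ¬ (e0 = 0 ∧ e1 = 0 ∧ e2 = 0) ∧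
      ¬ (e0 = u0 ∧ e1 = u1 ∧ e2 = u2) ∧ e0 * g0 + e1 * g1 + e2 * g2 = 0 := by decide
  obtain ⟨e0, e1, e2, h0, hu, he⟩ := hdec (T.inter x (b 0)) (T.inter x (b 1)) (T.inter x (b 2))
    (μ 0) (μ 1) (μ 2)
  have hsm : ∀ (c : ZMod 2) z, T.inter x (c • z) = c * T.inter x z := by
    intro c z
    have : ∀ a : ZMod 2, a = 0 ∨ a = 1 := by decide
    rcases this c with rfl | rfl <;> simp
  refine ⟨∑ i, ![e0, e1, e2] i • b i, IsEven.sum fun i _ => (hb i).smul _, ?_, fun h => h0 ?_,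
    fun h => hu ?_⟩
  · simpa [Fin.sum_univ_three, hsm] using he
  · have := hind _ h
    exact ⟨congrFun this 0, congrFun this 1, congrFun this 2⟩
  · have h1 := h.add hμ
    rw [add_assoc, ← add_assoc m m, chain_add_self, zero_add, ← Finset.sum_add_distrib] at h1
    simp only [← add_smul] at h1
    have h2 := hind (![e0, e1, e2] + μ) h1
    rw [← ZModModule.sub_eq_add, sub_eq_zero] at h2
    exact ⟨congrFun h2 0, congrFun h2 1, congrFun h2 2⟩

theorem exists_cycle_inter_eq_one (hx : T.IsEven x) (hB : ¬ T.IsBd x) :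
    ∃ (u : ℕ) (c : T.graph.Walk u u), c.IsCycle ∧ T.inter x (c.wlab edgeChain) = 1 := by
  by_contra hno
  push Not at hno
  refine hB (hx.isBd_of_inter fun u c hc => ?_)
  have hz : ∀ a : ZMod 2, a ≠ 1 → a = 0 := by decide
  exact hz _ (hno u c hc)

theorem inter_self_characteristic (hn : T.euler = 2 - ((3 : ℕ) : ℤ)) (hm : T.IsEven m)
    (hmB : ¬ T.IsBd m) (hwu : ∀ x, T.IsEven x → T.inter m x = T.inter x x) : T.inter m m = 1 := by
  by_contra h1
  have hz : ∀ a : ZMod 2, a = 0 ∨ a = 1 := by decide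
  have h0 : T.inter m m = 0 := (hz _).resolve_right h1
  obtain ⟨y, hy, hmy, hyB, hymB⟩ := exists_perp hn m hm
  obtain ⟨u, c, -, hc⟩ := exists_cycle_inter_eq_one hm hmB
  obtain ⟨x, hxc⟩ : ∃ x, x = c.wlab edgeChain := ⟨_, rfl⟩
  have hx : T.IsEven x := hxc ▸ isEven_wlab c
  rw [← hxc] at hc
  obtain ⟨z, hzE, hmz, hzB, hzmB, hzx⟩ : ∃ z, T.IsEven z ∧ T.inter m z = 0 ∧ ¬ T.IsBd z ∧
      ¬ T.IsBd (z + m) ∧ T.inter z x = 0 := by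
    rcases hz (T.inter y x) with h | h
    · exact ⟨y, hy, hmy, hyB, hymB, h⟩
    · refine ⟨y + m, hy.add hm, by rw [map_add, hmy, h0, add_zero], hymB, ?_, ?_⟩
      · rwa [add_assoc, chain_add_self, add_zero]
      · rw [inter_add_left hy hm hx, h, hc]; decide
  refine hzB (isBd_of_perp hn hm hzE hx (fun α β γ h => ?_) hzE ?_ ?_ hzx)
  · rcases hz γ with rfl | rfl
    · rcases hz α with rfl | rfl <;> rcases hz β with rfl | rfl <;>
        simp only [zero_smul, one_smul, zero_add, add_zero] at h
      · simp
      · exact absurd h hzB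
      · exact absurd h hmB
      · exact absurd (by rwa [add_comm]) hzmB
    · have := inter_bd_right hm h
      rw [map_add, one_smul, hc, map_add] at this
      rcases hz α with rfl | rfl <;> rcases hz β with rfl | rfl <;> simp [h0, hmz] at this
  · rw [inter_comm hzE hm, hmz]
  · rw [← hwu z hzE, hmz]

theorem isBd_add_characteristic (hn : T.euler = 2 - ((3 : ℕ) : ℤ)) (hm : T.IsEven m)
    (hmB : ¬ T.IsBd m) (hwu : ∀ x, T.IsEven x → T.inter m x = T.inter x x)
    (hk : T.IsEven k) (hkB : ¬ T.IsBd k) (hmk : T.inter m k = 0) (hx : T.IsEven x)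
    (hkx : T.inter k x = 0) (hmx : T.inter m x = 1) : T.IsBd (x + m) ∨ T.IsBd (x + (m + k)) := by
  have hmm := inter_self_characteristic hn hm hmB hwu
  have hkk : T.inter k k = 0 := by rw [← hwu k hk, hmk]
  have hmkB : ¬ T.IsBd (m + k) := fun h => by
    have := inter_bd_right hm h
    rw [map_add, hmm, hmk] at this
    simp at this
  rcases isBd_cases hn hk hkB hkk hm hmB hmkB (by rw [inter_comm hk hm, hmk]) hx hkx
    with h | h | h | h
  · rw [inter_bd_right hm h] at hmx; simp at hmx
  · rw [inter_congr_right hm h, hmk] at hmx; simp at hmx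
  · exact Or.inl h
  · exact Or.inr h

end Triangulation

namespace Triangulation

variable {T : Triangulation}

/-- The orientation `σ f` of the face `f` traverses the edge from `u` to `v`. -/
noncomputable def dir (σ : Finset ℕ → ℕ × ℕ × ℕ) (f : Finset ℕ) (u v : ℕ) : ZMod 2 :=
  if (u, v) ∈ dedges (σ f) then 1 else 0

/-- `σ` orients each face individually. -/
def Orients (T : Triangulation) (σ : Finset ℕ → ℕ × ℕ × ℕ) : Prop :=
  ∀ f ∈ T.faces, ({(σ f).1, (σ f).2.1, (σ f).2.2} : Finset ℕ) = f

theorem exists_orients (T : Triangulation) : ∃ σ, T.Orients σ := by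
  have h : ∀ f, ∃ t : ℕ × ℕ × ℕ, f ∈ T.faces → ({t.1, t.2.1, t.2.2} : Finset ℕ) = f := by
    intro f
    by_cases hf : f ∈ T.faces
    · obtain ⟨a, b, c, -, -, -, h⟩ := exists_eq hf
      exact ⟨(a, b, c), fun _ => h.symm⟩
    · exact ⟨(0, 0, 0), fun h => absurd h hf⟩
  choose σ hσ using h
  exact ⟨σ, hσ⟩

theorem ne_of_card_eq_three {a b c : ℕ} (h : ({a, b, c} : Finset ℕ).card = 3) :
    a ≠ b ∧ a ≠ c ∧ b ≠ c := by
  have h2 : ∀ x y : ℕ, ({x, y} : Finset ℕ).card ≤ 2 := fun x y => Finset.card_le_two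
  refine ⟨?_, ?_, ?_⟩ <;> rintro rfl
  · have := h2 a c
    simp at h; omega
  · have := h2 b a
    rw [Finset.insert_comm] at h; simp at h; omega
  · have := h2 a b
    simp at h; omega

theorem Orients.dir_rule {σ : Finset ℕ → ℕ × ℕ × ℕ} (hσ : T.Orients σ) {f : Finset ℕ}
    (hf : f ∈ T.faces) {u v w : ℕ} (huv : u ≠ v) (huw : u ≠ w) (hvw : v ≠ w) (h : f = {u, v, w}) :
    dir σ f u v + dir σ f v u = 1 ∧ dir σ f u v = dir σ f v w := by
  have h1 := hσ f hf
  have h3 := T.card_eq_three f hf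
  rw [← h1] at h3
  obtain ⟨hab, hac, hbc⟩ := ne_of_card_eq_three h3
  unfold dir dedges
  generalize σ f = s at *
  obtain ⟨a, b, c⟩ := s
  simp only at *
  have hu : u ∈ ({a, b, c} : Finset ℕ) := by rw [h1, h]; simp
  have hv : v ∈ ({a, b, c} : Finset ℕ) := by rw [h1, h]; simp
  have hw : w ∈ ({a, b, c} : Finset ℕ) := by rw [h1, h]; simp
  simp only [Finset.mem_insert, Finset.mem_singleton] at hu hv hw
  clear h h1 h3 hf
  rcases hu with rfl | rfl | rfl <;> rcases hv with rfl | rfl | rfl <;>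
    rcases hw with rfl | rfl | rfl <;> simp_all [eq_comm]


/-- A chain measuring the edges at which the reference orientation `σ` fails to be coherent. -/
def IsOriCls (T : Triangulation) (σ : Finset ℕ → ℕ × ℕ × ℕ) (m : Finset ℕ → ZMod 2) : Prop :=
  ∀ u v, {u, v} ∈ T.edges → m {u, v} = 1 + ∑ f ∈ T.faces with {u, v} ⊆ f, dir σ f u v

theorem Orients.dir_add_dir {σ : Finset ℕ → ℕ × ℕ × ℕ} (hσ : T.Orients σ) {f : Finset ℕ}
    (hf : f ∈ T.faces) {u v : ℕ} (hu : u ∈ f) (hv : v ∈ f) (huv : u ≠ v) :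
    dir σ f u v + dir σ f v u = 1 := by
  obtain ⟨a, h1, h2, h⟩ := exists_eq_of_pair hf hu hv huv
  exact (hσ.dir_rule hf huv h1 h2 h).1

theorem Orients.sum_dir_comm {σ : Finset ℕ → ℕ × ℕ × ℕ} (hσ : T.Orients σ) {u v : ℕ}
    (h : {u, v} ∈ T.edges) :
    ∑ f ∈ T.faces with {u, v} ⊆ f, dir σ f u v = ∑ f ∈ T.faces with {u, v} ⊆ f, dir σ f v u := by
  have huv : u ≠ v := Finset.card_pair_eq_two_iff.1 (card_of_mem_edges h)
  obtain ⟨f, g, hfg, hf, hg, hef, heg, -⟩ := exists_two_faces h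
  rw [sum_faces_edge h hf hg hfg hef heg, sum_faces_edge h hf hg hfg hef heg]
  have h1 := hσ.dir_add_dir hf (hef (by simp)) (hef (by simp)) huv
  have h2 := hσ.dir_add_dir hg (heg (by simp)) (heg (by simp)) huv
  revert h1 h2
  generalize dir σ f u v = a
  generalize dir σ f v u = b
  generalize dir σ g u v = c
  generalize dir σ g v u = d
  decide +revert

theorem Orients.exists_isOriCls {σ : Finset ℕ → ℕ × ℕ × ℕ} (hσ : T.Orients σ) :
    ∃ m, T.IsOriCls σ m := by
  have h : ∀ e : Finset ℕ, ∃ z : ZMod 2, ∀ u v, e = {u, v} → e ∈ T.edges →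
      z = 1 + ∑ f ∈ T.faces with {u, v} ⊆ f, dir σ f u v := by
    intro e
    by_cases he : ∃ u v, e = {u, v}
    · obtain ⟨u, v, rfl⟩ := he
      refine ⟨1 + ∑ f ∈ T.faces with {u, v} ⊆ f, dir σ f u v, fun a b h hE => ?_⟩
      · have h' : s(u, v) = s(a, b) := by
          have := congrArg (fun s : Finset ℕ => (s : Set ℕ)) h
          simp only [Finset.coe_insert, Finset.coe_singleton] at this
          rcases Set.pair_eq_pair_iff.1 this with ⟨rfl, rfl⟩ | ⟨rfl, rfl⟩
          · rfl
          · exact Sym2.eq_swap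
        rcases Sym2.eq_iff.1 h' with ⟨rfl, rfl⟩ | ⟨rfl, rfl⟩
        · rfl
        · rw [hσ.sum_dir_comm hE, Finset.pair_comm]
    · exact ⟨0, fun u v h => absurd ⟨u, v, h⟩ he⟩
  choose m hm using h
  exact ⟨m, fun u v h => hm _ u v rfl h⟩

theorem IsOriCls.eq {σ : Finset ℕ → ℕ × ℕ × ℕ} {m : Finset ℕ → ZMod 2} (hm : T.IsOriCls σ m)
    {u v : ℕ} {f g : Finset ℕ} (he : {u, v} ∈ T.edges) (hf : f ∈ T.faces) (hg : g ∈ T.faces)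
    (hfg : f ≠ g) (hef : {u, v} ⊆ f) (heg : {u, v} ⊆ g) :
    m {u, v} = 1 + (dir σ f u v + dir σ g u v) := by
  rw [hm u v he, sum_faces_edge he hf hg hfg hef heg]

theorem sum_flags_at {M : Type*} [AddCommMonoid M] (v : ℕ) (w : Finset ℕ → Finset ℕ → M) :
    ∑ e ∈ T.edges with v ∈ e, ∑ f ∈ T.faces with e ⊆ f, w e f =
      ∑ f ∈ T.faces with v ∈ f, ∑ e ∈ T.edges with (v ∈ e ∧ e ⊆ f), w e f := by
  have : ∀ e, (if v ∈ e then ∑ f ∈ T.faces, if e ⊆ f then w e f else 0 else 0) =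
      ∑ f ∈ T.faces, if v ∈ e ∧ e ⊆ f then w e f else 0 := fun e => by
    by_cases h : v ∈ e <;> simp [h]
  simp only [Finset.sum_filter, this]
  rw [Finset.sum_comm]
  refine Finset.sum_congr rfl fun f _ => ?_
  split_ifs with hv
  · rfl
  · refine Finset.sum_eq_zero fun e _ => if_neg fun h => hv (h.2 h.1)

theorem card_edges_at (v : ℕ) :
    {e ∈ T.edges | v ∈ e}.card = {f ∈ T.faces | v ∈ f}.card := by
  have h := sum_flags_at (T := T) v (fun _ _ => 1)
  have h1 : ∀ e ∈ {e ∈ T.edges | v ∈ e}, (∑ f ∈ T.faces with e ⊆ f, 1) = 2 := fun e he => by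
    obtain ⟨f, g, hfg, hf, hg, hef, heg, -⟩ := exists_two_faces (Finset.mem_filter.1 he).1
    rw [sum_faces_edge (Finset.mem_filter.1 he).1 hf hg hfg hef heg]
  have h2 : ∀ f ∈ {f ∈ T.faces | v ∈ f}, (∑ e ∈ T.edges with (v ∈ e ∧ e ⊆ f), 1) = 2 := by
    intro f hf
    obtain ⟨a, b, h1, h2, h3, rfl⟩ := exists_eq_of_mem (Finset.mem_filter.1 hf).1
      (Finset.mem_filter.1 hf).2
    rw [sum_edges_face_at h1 h2 h3 (Finset.mem_filter.1 hf).1]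
  rw [Finset.sum_congr rfl h1, Finset.sum_congr rfl h2] at h
  simpa using h

/-- `dir` as a function of an edge and one of its ends. -/
noncomputable def dirAt (σ : Finset ℕ → ℕ × ℕ × ℕ) (v : ℕ) (f e : Finset ℕ) : ZMod 2 :=
  ∑ u ∈ e.erase v, dir σ f v u

theorem dirAt_pair (σ : Finset ℕ → ℕ × ℕ × ℕ) {u v : ℕ} (h : v ≠ u) (f : Finset ℕ) :
    dirAt σ v f {v, u} = dir σ f v u := by
  rw [dirAt, Finset.erase_insert (by simpa using h), Finset.sum_singleton]

theorem Orients.dirAt_face {σ : Finset ℕ → ℕ × ℕ × ℕ} (hσ : T.Orients σ) {v a b : ℕ}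
    (hva : v ≠ a) (hvb : v ≠ b) (hab : a ≠ b) (hf : {v, a, b} ∈ T.faces) :
    dirAt σ v {v, a, b} {v, b} = 1 + dirAt σ v {v, a, b} {v, a} := by
  rw [dirAt_pair σ hva, dirAt_pair σ hvb]
  have h1 := (hσ.dir_rule hf hva hvb hab rfl).1
  have h2 := (hσ.dir_rule hf hva.symm hab hvb (by rw [Finset.insert_comm])).2
  revert h1 h2
  generalize dir σ {v, a, b} v a = p
  generalize dir σ {v, a, b} v b = q
  generalize dir σ {v, a, b} a v = r
  decide +revert

theorem exists_eq_pair_of_mem {e : Finset ℕ} (he : e ∈ T.edges) {v : ℕ} (hv : v ∈ e) :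
    ∃ u, v ≠ u ∧ e = {v, u} := by
  obtain ⟨a, b, hab, rfl⟩ := Finset.card_eq_two.1 (card_of_mem_edges he)
  simp only [Finset.mem_insert, Finset.mem_singleton] at hv
  rcases hv with rfl | rfl
  · exact ⟨b, hab, rfl⟩
  · exact ⟨a, hab.symm, Finset.pair_comm _ _⟩

theorem IsOriCls.dirAt_eq {σ : Finset ℕ → ℕ × ℕ × ℕ} {m : Finset ℕ → ZMod 2} (hm : T.IsOriCls σ m)
    {v : ℕ} {e f g : Finset ℕ} (he : e ∈ T.edges) (hv : v ∈ e) (hf : f ∈ T.faces)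
    (hg : g ∈ T.faces) (hfg : f ≠ g) (hef : e ⊆ f) (heg : e ⊆ g) :
    m e = 1 + (dirAt σ v f e + dirAt σ v g e) := by
  obtain ⟨u, h, rfl⟩ := exists_eq_pair_of_mem he hv
  rw [dirAt_pair σ h, dirAt_pair σ h, hm.eq he hf hg hfg hef heg]

theorem IsOriCls.isEven {σ : Finset ℕ → ℕ × ℕ × ℕ} {m : Finset ℕ → ZMod 2} (hσ : T.Orients σ)
    (hm : T.IsOriCls σ m) : T.IsEven m := by
  intro v
  have h1 : ∀ e ∈ {e ∈ T.edges | v ∈ e}, m e = 1 + ∑ f ∈ T.faces with e ⊆ f, dirAt σ v f e := by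
    intro e he
    rw [Finset.mem_filter] at he
    obtain ⟨f, g, hfg, hf, hg, hef, heg, -⟩ := exists_two_faces he.1
    rw [sum_faces_edge he.1 hf hg hfg hef heg, hm.dirAt_eq he.1 he.2 hf hg hfg hef heg]
  have h2 : ∀ f ∈ {f ∈ T.faces | v ∈ f},
      ∑ e ∈ T.edges with (v ∈ e ∧ e ⊆ f), dirAt σ v f e = 1 := by
    intro f hf
    obtain ⟨a, b, h1, h2, h3, rfl⟩ := exists_eq_of_mem (Finset.mem_filter.1 hf).1
      (Finset.mem_filter.1 hf).2
    rw [sum_edges_face_at h1 h2 h3 (Finset.mem_filter.1 hf).1,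
      hσ.dirAt_face h1 h2 h3 (Finset.mem_filter.1 hf).1, add_left_comm,
      CharTwo.add_self_eq_zero, add_zero]
  rw [Finset.sum_congr rfl h1, Finset.sum_add_distrib,
    sum_flags_at v (fun e f => dirAt σ v f e), Finset.sum_congr rfl h2]
  simp only [Finset.sum_const, card_edges_at, CharTwo.add_self_eq_zero]


/-- The sign attached to an element of `ZMod 2`. -/
def sign (z : ZMod 2) : ℤ := if z = 0 then 1 else -1

/-- Around a vertex, the signed edges of an even chain cancel. -/
theorem sum_sign_eq_zero {σ : Finset ℕ → ℕ × ℕ × ℕ} {m x : Finset ℕ → ZMod 2}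
    {o t : ℕ → Finset ℕ → ZMod 2} (hσ : T.Orients σ) (hm : T.IsOriCls σ m) (ho : T.IsCol m o)
    (ht : T.IsCol x t) {τ : ℕ → Finset ℕ → ZMod 2}
    (hτ : ∀ e ∈ T.edges, x e = 1 → ∀ v ∈ e, ∀ f ∈ T.faces, e ⊆ f →
      τ v e = t v f + o v f + dirAt σ v f e) (v : ℕ) :
    ∑ e ∈ T.edges with v ∈ e, (if x e = 1 then sign (τ v e) else 0) = 0 := by
  have h := sum_flags_at (T := T) v
    (fun e f => if t v f = 1 then sign (o v f + dirAt σ v f e) else 0)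
  have h2 : ∀ f ∈ {f ∈ T.faces | v ∈ f}, ∑ e ∈ T.edges with (v ∈ e ∧ e ⊆ f),
      (if t v f = 1 then sign (o v f + dirAt σ v f e) else 0) = 0 := by
    intro f hf
    obtain ⟨a, b, h1, h2, h3, rfl⟩ := exists_eq_of_mem (Finset.mem_filter.1 hf).1
      (Finset.mem_filter.1 hf).2
    rw [sum_edges_face_at h1 h2 h3 (Finset.mem_filter.1 hf).1]
    rw [hσ.dirAt_face h1 h2 h3 (Finset.mem_filter.1 hf).1]
    generalize dirAt σ v {v, a, b} {v, a} = p
    generalize o v {v, a, b} = q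
    generalize t v {v, a, b} = r
    unfold sign
    decide +revert
  rw [Finset.sum_eq_zero h2] at h
  rw [← neg_eq_zero, ← Finset.sum_neg_distrib]
  refine Eq.trans ?_ h
  refine Finset.sum_congr rfl fun e he => ?_
  rw [Finset.mem_filter] at he
  obtain ⟨f, g, hfg, hf, hg, hef, heg, -⟩ := exists_two_faces he.1
  rw [sum_faces_edge he.1 hf hg hfg hef heg]
  have e1 := hm.dirAt_eq he.1 he.2 hf hg hfg hef heg
  have e2 := ho.eq he.1 hf hg hfg hef heg he.2
  have e3 := ht.eq he.1 hf hg hfg hef heg he.2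
  have e4 := fun hx => hτ e he.1 hx v he.2 f hf hef
  revert e1 e2 e3 e4
  generalize m e = a1
  generalize x e = a2
  generalize dirAt σ v f e = a3
  generalize dirAt σ v g e = a4
  generalize o v f = a5
  generalize o v g = a6
  generalize t v f = a7
  generalize t v g = a8
  generalize τ v e = a9
  unfold sign
  clear * -
  intro e1 e2 e3 e4
  have c1 : a4 = 1 + a1 + a3 := by rw [e1]; clear * -; decide +revert
  have c2 : a6 = a1 + a5 := by rw [← e2]; clear * -; decide +revert
  have c3 : a8 = a2 + a7 := by rw [← e3]; clear * -; decide +revert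
  subst c1 c2 c3
  clear e1 e2 e3
  by_cases hx : a2 = 1
  · subst hx
    rw [e4 rfl]
    clear * -
    decide +revert
  · obtain rfl : a2 = 0 := by clear e4; decide +revert
    clear * -
    decide +revert

theorem sum_edges_ends_comm {M : Type*} [AddCommMonoid M] (w : ℕ → Finset ℕ → M) :
    ∑ v ∈ T.verts, ∑ e ∈ T.edges with v ∈ e, w v e = ∑ e ∈ T.edges, ∑ v ∈ e, w v e := by
  simp only [Finset.sum_filter]
  rw [Finset.sum_comm]
  refine Finset.sum_congr rfl fun e he => ?_
  rw [← Finset.sum_filter]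
  refine Finset.sum_congr (Finset.ext fun v => ?_) fun _ _ => rfl
  rw [Finset.mem_filter]
  exact ⟨And.right, fun h => ⟨mem_verts_of_mem_edges he h, h⟩⟩

/-- The orientation class is the Wu class. -/
theorem IsOriCls.inter_eq {σ : Finset ℕ → ℕ × ℕ × ℕ} {m x : Finset ℕ → ZMod 2}
    (hσ : T.Orients σ) (hm : T.IsOriCls σ m) (hx : T.IsEven x) : T.inter m x = T.inter x x := by
  have ho := (hm.isEven hσ).isCol
  have ht := hx.isCol
  set o := T.col m
  set t := T.col x
  have hex : ∃ τ : ℕ → Finset ℕ → ZMod 2, ∀ e ∈ T.edges, x e = 1 → ∀ v ∈ e, ∀ f ∈ T.faces, e ⊆ f →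
      τ v e = t v f + o v f + dirAt σ v f e := by
    refine ⟨fun v e => if h : ∃ f ∈ T.faces, e ⊆ f then
      t v h.choose + o v h.choose + dirAt σ v h.choose e else 0, ?_⟩
    intro e he hxe v hv f hf hef
    have hE : ∃ f ∈ T.faces, e ⊆ f := ⟨f, hf, hef⟩
    simp only [dif_pos hE]
    obtain ⟨hg, heg⟩ := hE.choose_spec
    generalize hE.choose = g at *
    by_cases hfg : f = g
    · rw [hfg]
    have e1 := hm.dirAt_eq he hv hf hg hfg hef heg
    have e2 := ho.eq he hf hg hfg hef heg hv
    have e3 := ht.eq he hf hg hfg hef heg hv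
    rw [← e2] at e1
    rw [hxe] at e3
    have c2 : t v g = 1 + t v f := by
      rw [← e3, add_right_comm, CharTwo.add_self_eq_zero, zero_add]
    have c1 : dirAt σ v g e = 1 + (o v f + o v g) + dirAt σ v f e := by
      rw [e1, ← add_assoc, ← add_assoc, CharTwo.add_self_eq_zero, zero_add, add_right_comm,
        CharTwo.add_self_eq_zero, zero_add]
    rw [c1, c2]
    generalize dirAt σ v f e = a3
    generalize o v f = a5
    generalize o v g = a6
    generalize t v f = a7
    clear * -
    decide +revert
  obtain ⟨τ, hτ⟩ := hex
  have hz : ∑ e ∈ T.edges, ∑ v ∈ e, (if x e = 1 then sign (τ v e) else 0) = 0 := by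
    rw [← sum_edges_ends_comm]
    exact Finset.sum_eq_zero fun v _ => sum_sign_eq_zero hσ hm ho ht hτ v
  have hs : ∀ z : ZMod 2, sign z = 1 - 2 * (if z = 0 then 0 else 1) := by
    unfold sign; decide
  have hz2 : ∑ e ∈ T.edges, (if x e = 1 then
      (1 - ∑ v ∈ e, (if τ v e = 0 then (0 : ℤ) else 1)) else 0) = 0 := by
    refine (mul_right_inj' (two_ne_zero (α := ℤ))).1 ?_
    rw [mul_zero, Finset.mul_sum]
    refine Eq.trans ?_ hz
    refine Finset.sum_congr rfl fun e he => ?_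
    split_ifs with h
    · simp only [hs, Finset.sum_sub_distrib, ← Finset.mul_sum, Finset.sum_const,
        card_of_mem_edges he]
      ring
    · simp
  have hz3 := congrArg (Int.cast : ℤ → ZMod 2) hz2
  rw [Int.cast_sum] at hz3
  rw [← CharTwo.add_eq_zero, ho.inter_eq hx, ht.inter_eq hx, ← pairing_add_left, pairing_apply]
  refine (Finset.sum_congr rfl fun e he => ?_).trans (hz3.trans Int.cast_zero)
  have hcast : ∀ z : ZMod 2, (((if z = 0 then (0 : ℤ) else 1) : ℤ) : ZMod 2) = z := by decide
  by_cases h : x e = 1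
  · rw [if_pos h, h, mul_one]
    obtain ⟨f, hf, hef⟩ := (mem_edges.1 he).2
    rw [edgeCol_add, ho.edgeCol_eq he hf hef, ht.edgeCol_eq he hf hef]
    simp only [Int.cast_sub, Int.cast_one, Int.cast_sum, hcast]
    rw [Finset.sum_congr rfl fun v hv => hτ e he h v hv f hf hef]
    obtain ⟨u, v, huv, rfl⟩ := Finset.card_eq_two.1 (card_of_mem_edges he)
    rw [Finset.sum_pair huv, Finset.sum_pair huv, Finset.sum_pair huv, dirAt_pair σ huv,
      Finset.pair_comm, dirAt_pair σ huv.symm]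
    have := hσ.dir_add_dir hf (hef (by simp)) (hef (by simp)) huv
    revert this
    generalize dir σ f u v = a1
    generalize dir σ f v u = a2
    generalize t u f = a3
    generalize t v f = a4
    generalize o u f = a5
    generalize o v f = a6
    clear * -
    intro h
    obtain rfl : a2 = 1 + a1 := by
      rw [← h, add_right_comm, CharTwo.add_self_eq_zero, zero_add]
    clear h
    rw [CharTwo.sub_eq_add]
    decide +revert
  · have h0 : x e = 0 := by
      revert h; generalize x e = z; decide +revert
    simp [h0]

end Triangulation

namespace Triangulation

variable {T : Triangulation} {σ ρ : Finset ℕ → ℕ × ℕ × ℕ} {m : Finset ℕ → ZMod 2}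

theorem dir_eq_one {f : Finset ℕ} {u v : ℕ} : dir σ f u v = 1 ↔ (u, v) ∈ dedges (σ f) := by
  unfold dir; split_ifs with h <;> simp [h]

/-- The difference of two orientations of a face does not depend on the edge. -/
theorem Orients.exists_diff (hσ : T.Orients σ) (hρ : T.Orients ρ) :
    ∃ s : Finset ℕ → ZMod 2, ∀ f ∈ T.faces, ∀ u ∈ f, ∀ v ∈ f, u ≠ v →
      dir ρ f u v = dir σ f u v + s f := by
  have h : ∀ f, ∃ z : ZMod 2, f ∈ T.faces → ∀ u ∈ f, ∀ v ∈ f, u ≠ v →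
      dir ρ f u v = dir σ f u v + z := by
    intro f
    by_cases hf : f ∈ T.faces
    swap
    · exact ⟨0, fun h => absurd h hf⟩
    obtain ⟨a, b, c, hab, hac, hbc, rfl⟩ := exists_eq hf
    refine ⟨dir ρ {a, b, c} a b + dir σ {a, b, c} a b, fun _ u hu v hv huv => ?_⟩
    have e1 : ({a, b, c} : Finset ℕ) = {b, c, a} := by
      ext x; simp only [Finset.mem_insert, Finset.mem_singleton]; tauto
    have key : ∀ π, T.Orients π → (dir π {a, b, c} b a = 1 + dir π {a, b, c} a b ∧
        dir π {a, b, c} b c = dir π {a, b, c} a b ∧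
        dir π {a, b, c} c b = 1 + dir π {a, b, c} a b ∧
        dir π {a, b, c} c a = dir π {a, b, c} a b ∧
        dir π {a, b, c} a c = 1 + dir π {a, b, c} a b) := by
      intro π hπ
      have h1 := hπ.dir_rule hf hab hac hbc rfl
      have h2 := hπ.dir_rule hf hbc hab.symm hac.symm e1
      have h3 := hπ.dir_add_dir hf (u := c) (v := a) (by simp) (by simp) hac.symm
      rw [← h2.2, ← h1.2] at h3
      have h4 := h2.1
      rw [← h1.2] at h4
      have h5 : ∀ p q : ZMod 2, p + q = 1 → q = 1 + p := by decide
      exact ⟨h5 _ _ h1.1, h1.2.symm, h5 _ _ h4, h2.2.symm.trans h1.2.symm, h5 _ _ h3⟩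
    obtain ⟨r1, r2, r3, r4, r5⟩ := key ρ hρ
    obtain ⟨s1, s2, s3, s4, s5⟩ := key σ hσ
    simp only [Finset.mem_insert, Finset.mem_singleton] at hu hv
    rcases hu with rfl | rfl | rfl <;> rcases hv with rfl | rfl | rfl <;>
      first
      | exact absurd rfl huv
      | try simp only [r1, r2, r3, r4, r5, s1, s2, s3, s4, s5]
        clear * -
        generalize dir ρ _ _ _ = p
        generalize dir σ _ _ _ = q
        decide +revert
  choose s hs using h
  exact ⟨s, hs⟩

theorem Orients.exists_flip (hσ : T.Orients σ) (s : Finset ℕ → ZMod 2) :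
    ∃ ρ, T.Orients ρ ∧ ∀ f ∈ T.faces, ∀ u ∈ f, ∀ v ∈ f, u ≠ v →
      dir ρ f u v = dir σ f u v + s f := by
  let ρ : Finset ℕ → ℕ × ℕ × ℕ := fun f =>
    if s f = 0 then σ f else ((σ f).2.1, (σ f).1, (σ f).2.2)
  have hρ : T.Orients ρ := by
    intro f hf
    simp only [ρ]
    split_ifs
    · exact hσ f hf
    · exact (Finset.insert_comm _ _ _).trans (hσ f hf)
  refine ⟨ρ, hρ, ?_⟩
  obtain ⟨r, hr⟩ := hσ.exists_diff hρ
  intro f hf u hu v hv huv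
  rw [hr f hf u hu v hv huv]
  congr 1
  have h3 := T.card_eq_three f hf
  rw [← hσ f hf] at h3
  obtain ⟨h1, h2, h4⟩ := ne_of_card_eq_three h3
  have ha : (σ f).1 ∈ f := (Finset.ext_iff.1 (hσ f hf) _).1 (by simp)
  have hb : (σ f).2.1 ∈ f := (Finset.ext_iff.1 (hσ f hf) _).1 (by simp)
  have h5 := hr f hf _ ha _ hb h1
  have h6 : dir σ f (σ f).1 (σ f).2.1 = 1 := dir_eq_one.2 (by simp [dedges])
  rw [h6] at h5
  have hz : s f = 0 ∨ s f = 1 := by generalize s f = z; decide +revert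
  rcases hz with hz | hz
  · have : dir ρ f (σ f).1 (σ f).2.1 = 1 := dir_eq_one.2 (by simp [ρ, hz, dedges])
    rw [this] at h5
    rw [hz]
    revert h5; generalize r f = z; decide +revert
  · have : dir ρ f (σ f).1 (σ f).2.1 = 0 := by
      unfold dir
      refine if_neg ?_
      simp only [ρ, hz, dedges, one_ne_zero, if_false, Finset.mem_insert, Finset.mem_singleton,
        Prod.mk.injEq]
      rintro (h | h | h)
      · exact h1 h.1
      · exact h4 h.2
      · exact h2 h.1
    rw [this] at h5
    rw [hz]
    revert h5; generalize r f = z; decide +revert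

theorem exists_cutCoherent_iff (hσ : T.Orients σ) (hm : T.IsOriCls σ m) (E : Finset (Finset ℕ)) :
    (∃ ρ, T.Orients ρ ∧ ∀ f ∈ T.faces, ∀ g ∈ T.faces, f ≠ g → f ∩ g ∉ E →
      Disjoint (dedges (ρ f)) (dedges (ρ g))) ↔
    ∃ s : Finset ℕ → ZMod 2, ∀ e ∈ T.edges, e ∉ E → m e = ∑ f ∈ T.faces with e ⊆ f, s f := by
  constructor
  · rintro ⟨ρ, hρ, hdis⟩
    obtain ⟨s, hs⟩ := hσ.exists_diff hρ
    refine ⟨s, fun e he heE => ?_⟩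
    obtain ⟨f, g, hfg, hf, hg, hef, heg, -⟩ := exists_two_faces he
    rw [sum_faces_edge he hf hg hfg hef heg]
    have hd := hdis f hf g hg hfg (by rwa [inter_eq he hf hg hfg hef heg])
    obtain ⟨u, v, huv, rfl⟩ := Finset.card_eq_two.1 (card_of_mem_edges he)
    rw [hm.eq he hf hg hfg hef heg]
    have hu : u ∈ ({u, v} : Finset ℕ) := by simp
    have hv : v ∈ ({u, v} : Finset ℕ) := by simp
    have a1 := hs f hf u (hef hu) v (hef hv) huv
    have a2 := hs g hg u (heg hu) v (heg hv) huv
    have b1 := hρ.dir_add_dir hf (hef hu) (hef hv) huv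
    have b2 := hρ.dir_add_dir hg (heg hu) (heg hv) huv
    have c1 : ¬ (dir ρ f u v = 1 ∧ dir ρ g u v = 1) := fun h =>
      Finset.disjoint_left.1 hd (dir_eq_one.1 h.1) (dir_eq_one.1 h.2)
    have c2 : ¬ (dir ρ f v u = 1 ∧ dir ρ g v u = 1) := fun h =>
      Finset.disjoint_left.1 hd (dir_eq_one.1 h.1) (dir_eq_one.1 h.2)
    have c3 : dir ρ f u v + dir ρ g u v = 1 := by
      revert b1 b2 c1 c2
      generalize dir ρ f u v = a1
      generalize dir ρ f v u = a2
      generalize dir ρ g u v = a3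
      generalize dir ρ g v u = a4
      clear * -
      decide +revert
    rw [a1, a2] at c3
    revert c3
    generalize dir σ f u v = a1
    generalize dir σ g u v = a2
    generalize s f = a3
    generalize s g = a4
    clear * -
    decide +revert
  · rintro ⟨s, hs⟩
    obtain ⟨ρ, hρ, h⟩ := hσ.exists_flip s
    refine ⟨ρ, hρ, fun f hf g hg hfg hE => Finset.disjoint_left.2 ?_⟩
    rintro ⟨u, v⟩ huf hug
    have key : ∀ f ∈ T.faces, (u, v) ∈ dedges (ρ f) → u ∈ f ∧ v ∈ f ∧ u ≠ v := by
      intro f hf hu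
      have h1 := hρ f hf
      have h3 := T.card_eq_three f hf
      rw [← h1] at h3
      obtain ⟨hab, hac, hbc⟩ := ne_of_card_eq_three h3
      rw [← h1]
      simp only [dedges, Finset.mem_insert, Finset.mem_singleton, Prod.mk.injEq] at hu
      rcases hu with ⟨rfl, rfl⟩ | ⟨rfl, rfl⟩ | ⟨rfl, rfl⟩
      · exact ⟨by simp, by simp, hab⟩
      · exact ⟨by simp, by simp, hbc⟩
      · exact ⟨by simp, by simp, hac.symm⟩
    obtain ⟨hu, hv, huv⟩ := key f hf huf
    obtain ⟨hu', hv', -⟩ := key g hg hug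
    have he := pair_mem_edges hf hu hv huv
    have hef : ({u, v} : Finset ℕ) ⊆ f := Finset.insert_subset hu (by simpa using hv)
    have heg : ({u, v} : Finset ℕ) ⊆ g := Finset.insert_subset hu' (by simpa using hv')
    have h1 := hs _ he (by rwa [inter_eq he hf hg hfg hef heg] at hE)
    rw [sum_faces_edge he hf hg hfg hef heg, hm.eq he hf hg hfg hef heg] at h1
    have h2 := h f hf u hu v hv huv
    have h3 := h g hg u hu' v hv' huv
    rw [dir_eq_one.2 huf] at h2
    rw [dir_eq_one.2 hug] at h3
    revert h1 h2 h3
    generalize dir σ f u v = a1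
    generalize dir σ g u v = a2
    generalize s f = a3
    generalize s g = a4
    clear * -
    decide +revert

theorem IsOriCls.not_isBd (hσ : T.Orients σ) (hm : T.IsOriCls σ m) (hT : ¬ T.Orientable) :
    ¬ T.IsBd m := by
  rintro ⟨s, hs⟩
  obtain ⟨ρ, hρ, h⟩ := (exists_cutCoherent_iff hσ hm ∅).2 ⟨s, fun e he _ => hs e he⟩
  exact hT ⟨ρ, hρ, fun f hf g hg hfg => h f hf g hg hfg (by simp)⟩

end Triangulation

namespace SimpleGraph.Walk

theorem wlab_eq_sum_range {V M : Type*} [AddCommGroup M] {G : SimpleGraph V} (L : V → V → M)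
    {u v : V} (p : G.Walk u v) :
    p.wlab L = ∑ i ∈ Finset.range p.length, L (p.getVert i) (p.getVert (i + 1)) := by
  induction p with
  | nil => simp [wlab]
  | cons h p ih =>
    rw [length_cons, Finset.sum_range_succ']
    simp only [getVert_cons_succ, getVert_zero, ← ih]
    simp [wlab, add_comm]

end SimpleGraph.Walk

namespace Triangulation

variable {T : Triangulation}

/-- `g` runs periodically through the vertices of a cycle of length `n`. -/
structure IsLoop (T : Triangulation) (n : ℕ) (g : ℕ → ℕ) : Prop where
  three_le : 3 ≤ n
  inj : ∀ i j, g i = g j ↔ i ≡ j [MOD n]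
  edge_mem : ∀ i, {g i, g (i + 1)} ∈ T.edges

theorem exists_isLoop {u : ℕ} {c : T.graph.Walk u u} (hc : c.IsCycle) :
    ∃ n g, T.IsLoop n g ∧
      c.wlab edgeChain = ∑ i ∈ Finset.range n, edgeChain (g i) (g (i + 1)) := by
  have h3 := hc.three_le_length
  have hmod : ∀ i, i % c.length < c.length := fun i => Nat.mod_lt _ (by omega)
  have hsucc : ∀ i, c.getVert ((i + 1) % c.length) = c.getVert (i % c.length + 1) := by
    intro i
    rw [Nat.add_mod, Nat.mod_eq_of_lt (by omega : 1 < c.length)]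
    rcases Nat.lt_or_ge (i % c.length + 1) c.length with h | h
    · rw [Nat.mod_eq_of_lt h]
    · have : i % c.length + 1 = c.length := by have := hmod i; omega
      rw [this, Nat.mod_self, c.getVert_zero, c.getVert_length]
  refine ⟨c.length, fun i => c.getVert (i % c.length), ⟨h3, fun i j => ⟨fun h => ?_, fun h => ?_⟩,
    fun i => ?_⟩, ?_⟩
  · refine hc.getVert_injOn' ?_ ?_ h
    · have := hmod i; simp only [Set.mem_ofPred_eq]; omega
    · have := hmod j; simp only [Set.mem_ofPred_eq]; omega
  · exact congrArg c.getVert h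
  · rw [hsucc]
    exact c.adj_getVert_succ (hmod i)
  · rw [SimpleGraph.Walk.wlab_eq_sum_range]
    refine Finset.sum_congr rfl fun i hi => ?_
    simp only [hsucc, Nat.mod_eq_of_lt (Finset.mem_range.1 hi)]

namespace IsLoop

variable {n : ℕ} {g : ℕ → ℕ}

theorem not_modEq_add (h : T.IsLoop n g) (i : ℕ) {k : ℕ} (hk : 0 < k) (hkn : k < 3) :
    ¬ i ≡ i + k [MOD n] := fun hi => by
  have h0 : 0 ≡ k [MOD n] := Nat.ModEq.add_left_cancel' i hi
  have h3 := h.three_le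
  rw [Nat.ModEq, Nat.zero_mod, Nat.mod_eq_of_lt (by omega)] at h0
  omega

theorem edge_inj (h : T.IsLoop n g) {i j : ℕ}
    (hij : ({g i, g (i + 1)} : Finset ℕ) = {g j, g (j + 1)}) : i ≡ j [MOD n] := by
  have h1 : g i ∈ ({g j, g (j + 1)} : Finset ℕ) := hij ▸ by simp
  have h2 : g (i + 1) ∈ ({g j, g (j + 1)} : Finset ℕ) := hij ▸ by simp
  simp only [Finset.mem_insert, Finset.mem_singleton, h.inj] at h1 h2
  rcases h1 with h1 | h1
  · exact h1
  rcases h2 with h2 | h2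
  · exact absurd (h2.symm.trans (h1.add_right 1)) (h.not_modEq_add j two_pos (by omega))
  · exact Nat.ModEq.add_right_cancel' 1 h2

theorem edge_congr (h : T.IsLoop n g) {i j : ℕ} (hij : i ≡ j [MOD n]) :
    ({g i, g (i + 1)} : Finset ℕ) = {g j, g (j + 1)} := by
  rw [(h.inj i j).2 hij, (h.inj _ _).2 (hij.add_right 1)]

theorem exists_lt (h : T.IsLoop n g) (i : ℕ) : ∃ j < n, j ≡ i [MOD n] :=
  ⟨i % n, Nat.mod_lt _ (by have := h.three_le; omega), Nat.mod_modEq _ _⟩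

/-- The vertices of a loop, as a list. -/
def list (n : ℕ) (g : ℕ → ℕ) : List ℕ := (List.range n).map g

theorem length_list : (list n g).length = n := by simp [list]

theorem getD_list {i : ℕ} (hi : i < n) : (list n g).getD i 0 = g i := by
  simp [list, List.getD, hi]

theorem getD_list_mod (h : T.IsLoop n g) (i : ℕ) : (list n g).getD (i % n) 0 = g i := by
  rw [getD_list (Nat.mod_lt _ (by have := h.three_le; omega)), h.inj]
  exact Nat.mod_modEq _ _

theorem cycEdges_list (h : T.IsLoop n g) :
    cycEdges (list n g) = (Finset.range n).image fun i => {g i, g (i + 1)} := by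
  unfold cycEdges
  rw [length_list]
  refine Finset.image_congr fun i hi => ?_
  simp only [h.getD_list_mod, getD_list (Finset.mem_range.1 hi)]

theorem mem_cycEdges (h : T.IsLoop n g) {e : Finset ℕ} :
    e ∈ cycEdges (list n g) ↔ ∃ i, e = {g i, g (i + 1)} := by
  rw [h.cycEdges_list, Finset.mem_image]
  constructor
  · rintro ⟨i, -, rfl⟩
    exact ⟨i, rfl⟩
  · rintro ⟨i, rfl⟩
    obtain ⟨j, hj, hji⟩ := h.exists_lt i
    exact ⟨j, Finset.mem_range.2 hj, h.edge_congr hji⟩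

theorem mem_edges_of_mem (h : T.IsLoop n g) {e : Finset ℕ} (he : e ∈ cycEdges (list n g)) :
    e ∈ T.edges := by
  obtain ⟨i, rfl⟩ := h.mem_cycEdges.1 he
  exact h.edge_mem i

theorem isCycle_list (h : T.IsLoop n g) : T.IsCycle (list n g) := by
  refine ⟨by rw [length_list]; exact h.three_le, ?_, fun e he => h.mem_edges_of_mem he⟩
  refine List.Nodup.map_on (fun i hi j hj hij => ?_) List.nodup_range
  rw [h.inj, Nat.ModEq, Nat.mod_eq_of_lt (List.mem_range.1 hi),
    Nat.mod_eq_of_lt (List.mem_range.1 hj)] at hij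
  exact hij

theorem injOn_edge (h : T.IsLoop n g) :
    Set.InjOn (fun i => ({g i, g (i + 1)} : Finset ℕ)) (Finset.range n) := by
  intro i hi j hj hij
  have := h.edge_inj hij
  rwa [Nat.ModEq, Nat.mod_eq_of_lt (by simpa using hi), Nat.mod_eq_of_lt (by simpa using hj)]
    at this

/-- The chain of edges of a loop. -/
noncomputable def chain (n : ℕ) (g : ℕ → ℕ) : Finset ℕ → ZMod 2 :=
  ∑ i ∈ Finset.range n, edgeChain (g i) (g (i + 1))

theorem chain_apply (h : T.IsLoop n g) (e : Finset ℕ) :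
    chain n g e = if e ∈ cycEdges (list n g) then 1 else 0 := by
  rw [h.cycEdges_list]
  have : chain n g = ∑ e ∈ (Finset.range n).image fun i => ({g i, g (i + 1)} : Finset ℕ),
      Pi.single e 1 := by
    rw [Finset.sum_image h.injOn_edge]
    rfl
  rw [this, Finset.sum_apply]
  simp only [Pi.single_apply, Finset.sum_ite_eq]

theorem pairing_chain (h : T.IsLoop n g) (t : ℕ → Finset ℕ → ZMod 2) :
    T.pairing t (chain n g) = ∑ i ∈ Finset.range n, edgeCol T t {g i, g (i + 1)} := by
  unfold chain
  rw [map_sum]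
  exact Finset.sum_congr rfl fun i _ => pairing_edgeChain t (h.edge_mem i)

/-- The two edges of a loop at one of its vertices. -/
theorem eq_or_eq_of_mem (h : T.IsLoop n g) {e : Finset ℕ} (he : e ∈ cycEdges (list n g)) {i : ℕ}
    (hi : g (i + 1) ∈ e) : e = {g i, g (i + 1)} ∨ e = {g (i + 1), g (i + 1 + 1)} := by
  obtain ⟨j, rfl⟩ := h.mem_cycEdges.1 he
  simp only [Finset.mem_insert, Finset.mem_singleton, h.inj] at hi
  rcases hi with hi | hi
  · exact Or.inr (h.edge_congr hi.symm)
  · exact Or.inl (h.edge_congr (Nat.ModEq.add_right_cancel' 1 hi).symm)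

theorem edge_ne (h : T.IsLoop n g) (i : ℕ) :
    ({g i, g (i + 1)} : Finset ℕ) ≠ {g (i + 1), g (i + 1 + 1)} := fun he =>
  h.not_modEq_add i one_pos (by omega) (h.edge_inj he)

theorem value_succ (h : T.IsLoop n g) {w : Finset ℕ → ZMod 2} {i : ℕ}
    (hw : ∑ e ∈ T.edges with g (i + 1) ∈ e, w e = 0)
    (hs : ∀ e ∈ T.edges, g (i + 1) ∈ e → e ∉ cycEdges (list n g) → w e = 0) :
    w {g i, g (i + 1)} = w {g (i + 1), g (i + 1 + 1)} := by
  rw [← CharTwo.add_eq_zero, ← Finset.sum_pair (h.edge_ne i)]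
  refine Eq.trans (Finset.sum_subset ?_ ?_) hw
  · intro e he
    rw [Finset.mem_insert, Finset.mem_singleton] at he
    rw [Finset.mem_filter]
    rcases he with rfl | rfl
    · exact ⟨h.edge_mem i, by simp⟩
    · exact ⟨h.edge_mem (i + 1), by simp⟩
  · intro e he hne
    rw [Finset.mem_filter] at he
    refine hs e he.1 he.2 fun hE => hne ?_
    rw [Finset.mem_insert, Finset.mem_singleton]
    exact h.eq_or_eq_of_mem hE he.2

/-- An even chain carried by a loop is zero or the chain of the loop. -/
theorem eq_zero_or_eq_chain (h : T.IsLoop n g) {y : Finset ℕ → ZMod 2} (hy : T.IsEven y)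
    (hs : ∀ e ∈ T.edges, e ∉ cycEdges (list n g) → y e = 0) :
    (∀ e ∈ T.edges, y e = 0) ∨ ∀ e ∈ T.edges, y e = chain n g e := by
  have hc : ∀ i, y {g i, g (i + 1)} = y {g 0, g (0 + 1)} := by
    intro i
    induction i with
    | zero => rfl
    | succ i ih => exact (h.value_succ (hy _) fun e he _ => hs e he).symm.trans ih
  have hz : y {g 0, g (0 + 1)} = 0 ∨ y {g 0, g (0 + 1)} = 1 := by
    generalize y {g 0, g (0 + 1)} = z; decide +revert
  refine hz.imp (fun hz e he => ?_) fun hz e he => ?_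
  · by_cases hE : e ∈ cycEdges (list n g)
    · obtain ⟨i, rfl⟩ := h.mem_cycEdges.1 hE
      rw [hc, hz]
    · exact hs e he hE
  · rw [h.chain_apply]
    split_ifs with hE
    · obtain ⟨i, rfl⟩ := h.mem_cycEdges.1 hE
      rw [hc, hz]
    · exact hs e he hE

theorem not_separating (h : T.IsLoop n g) (hB : ¬ T.IsBd (chain n g)) :
    ¬ T.Separating (list n g) := by
  rintro ⟨f, hf, f', hf', hn⟩
  let q : Finset ℕ → ZMod 2 := fun a => if T.SameSide (list n g) f a then 1 else 0
  let y : Finset ℕ → ZMod 2 := fun e => ∑ a ∈ T.faces with e ⊆ a, q a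
  have hyB : T.IsBd y := ⟨q, fun e _ => rfl⟩
  have hs : ∀ e ∈ T.edges, e ∉ cycEdges (list n g) → y e = 0 := by
    intro e he hE
    obtain ⟨a, b, hab, ha, hb, hea, heb, -⟩ := exists_two_faces he
    have hi := inter_eq he ha hb hab hea heb
    have key : T.SameSide (list n g) f a ↔ T.SameSide (list n g) f b := by
      constructor <;> intro hS <;> refine Relation.ReflTransGen.tail hS ?_
      · exact ⟨ha, hb, by rw [hi, card_of_mem_edges he], by rwa [hi]⟩
      · exact ⟨hb, ha, by rw [Finset.inter_comm, hi, card_of_mem_edges he],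
          by rwa [Finset.inter_comm, hi]⟩
    show ∑ a ∈ T.faces with e ⊆ a, q a = 0
    rw [sum_faces_edge he ha hb hab hea heb]
    simp only [q, key, CharTwo.add_self_eq_zero]
  rcases h.eq_zero_or_eq_chain hyB.isEven hs with h0 | h1
  · refine hn ?_
    have h2 : q f' = 1 := by
      refine face_induction (P := fun a => q a = 1) ?_ hf hf' (if_pos Relation.ReflTransGen.refl)
      intro a ha b hb hab e he hea heb hqa
      have := h0 e he
      simp only [y] at this
      rw [sum_faces_edge he ha hb hab hea heb, CharTwo.add_eq_zero] at this
      rw [← this, hqa]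
    by_contra hS
    simp [q, hS] at h2
  · exact hB ⟨q, fun e he => (h1 e he).symm⟩

theorem orientableLeaving_iff (h : T.IsLoop n g) {σ : Finset ℕ → ℕ × ℕ × ℕ}
    {m : Finset ℕ → ZMod 2} (hσ : T.Orients σ) (hm : T.IsOriCls σ m) (hT : ¬ T.Orientable) :
    T.OrientableLeaving (list n g) ↔ T.IsBd (chain n g + m) := by
  refine (exists_cutCoherent_iff hσ hm (cycEdges (list n g))).trans ⟨?_, ?_⟩
  · rintro ⟨s, hs⟩
    let y : Finset ℕ → ZMod 2 := fun e => ∑ a ∈ T.faces with e ⊆ a, s a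
    have hyB : T.IsBd y := ⟨s, fun e _ => rfl⟩
    have hmy : ∀ e ∈ T.edges, e ∉ cycEdges (list n g) → (m + y) e = 0 := fun e he hE => by
      rw [Pi.add_apply, hs e he hE, CharTwo.add_self_eq_zero]
    rcases h.eq_zero_or_eq_chain ((hm.isEven hσ).add hyB.isEven) hmy with h0 | h1
    · refine absurd ⟨s, fun e he => ?_⟩ (hm.not_isBd hσ hT)
      exact CharTwo.add_eq_zero.1 (h0 e he)
    · refine ⟨s, fun e he => ?_⟩
      rw [Pi.add_apply, ← h1 e he, Pi.add_apply, add_right_comm, CharTwo.add_self_eq_zero,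
        zero_add]
  · rintro ⟨s, hs⟩
    refine ⟨s, fun e he hE => ?_⟩
    rw [← hs e he, Pi.add_apply, h.chain_apply, if_neg hE, zero_add]

/-- Faces at a vertex of a loop with the same colour are joined around the vertex without
crossing the loop. -/
theorem eq_of_col_eq (h : T.IsLoop n g) {t : ℕ → Finset ℕ → ZMod 2}
    (ht : T.IsCol (chain n g) t) {i : ℕ} {q : Finset ℕ → ZMod 2}
    (hq : ∀ e ∈ T.edges, g i ∈ e → e ∉ cycEdges (list n g) → ∀ f ∈ T.faces, ∀ f' ∈ T.faces,
      f ≠ f' → e ⊆ f → e ⊆ f' → q f = q f')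
    {f f' : Finset ℕ} (hf : f ∈ T.faces) (hf' : f' ∈ T.faces) (hif : g i ∈ f) (hif' : g i ∈ f')
    (hff : t (g i) f = t (g i) f') : q f = q f' := by
  obtain ⟨j, hj⟩ : ∃ j, g (j + 1) = g i := by
    refine ⟨i + (n - 1), (h.inj _ _).2 ?_⟩
    have := h.three_le
    rw [show i + (n - 1) + 1 = i + n by omega]
    exact Nat.add_modEq_right
  rw [← hj] at hq hif hif' hff
  let w : Finset ℕ → ZMod 2 := fun e => ∑ a ∈ T.faces with e ⊆ a, q a
  have hs : ∀ e ∈ T.edges, g (j + 1) ∈ e → e ∉ cycEdges (list n g) → w e = 0 := by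
    intro e he hv hE
    obtain ⟨a, b, hab, ha, hb, hea, heb, -⟩ := exists_two_faces he
    show ∑ a ∈ T.faces with e ⊆ a, q a = 0
    rw [sum_faces_edge he ha hb hab hea heb, hq e he hv hE a ha b hb hab hea heb,
      CharTwo.add_self_eq_zero]
  have hw := h.value_succ (sum_edges_at_face_comm (g (j + 1)) q) hs
  have hconst : ∀ r : Finset ℕ → ZMod 2, (∀ e ∈ T.edges, g (j + 1) ∈ e →
      ∑ a ∈ T.faces with e ⊆ a, r a = 0) → r f = r f' := by
    intro r hr
    refine link_induction (P := fun a => r f = r a) ?_ hf hf' hif hif' rfl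
    intro a ha b hb hab e he hv hea heb hra
    have := hr e he hv
    rw [sum_faces_edge he ha hb hab hea heb, CharTwo.add_eq_zero] at this
    exact hra.trans this
  have hz : w {g j, g (j + 1)} = 0 ∨ w {g j, g (j + 1)} = 1 := by
    generalize w {g j, g (j + 1)} = z; decide +revert
  rcases hz with hz | hz
  · refine hconst q fun e he hv => ?_
    by_cases hE : e ∈ cycEdges (list n g)
    · rcases h.eq_or_eq_of_mem hE hv with rfl | rfl
      · exact hz
      · exact hw.symm.trans hz
    · exact hs e he hv hE
  · have := hconst (fun a => q a + t (g (j + 1)) a) fun e he hv => by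
      rw [Finset.sum_add_distrib, ht e he _ hv, h.chain_apply]
      split_ifs with hE
      · rcases h.eq_or_eq_of_mem hE hv with rfl | rfl
        · exact (congrArg (· + 1) hz).trans (by decide)
        · exact (congrArg (· + 1) (hw.symm.trans hz)).trans (by decide)
      · exact (congrArg (· + 0) (hs e he hv hE)).trans (by decide)
    simp only [hff] at this
    exact add_right_cancel this

theorem not_oneSided (h : T.IsLoop n g) (h0 : T.inter (chain n g) (chain n g) = 0)
    (he : T.IsEven (chain n g)) : ¬ T.OneSided (list n g) := by
  intro hO
  have ht := he.isCol
  rw [ht.inter_eq he, h.pairing_chain] at h0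
  set t := T.col (chain n g)
  let κ : ℕ → ZMod 2 := fun i => edgeCol T t {g i, g (i + 1)}
  let I : ℕ × Finset ℕ → ZMod 2 := fun x => t (g x.1) x.2 + ∑ j ∈ Finset.range x.1, κ j
  have hI : ∀ x y, Relation.EqvGen (T.CornerRel (list n g)) x y → I x = I y := by
    intro x y hxy
    induction hxy with
    | refl => rfl
    | symm _ _ _ ih => exact ih.symm
    | trans _ _ _ _ _ ih ih' => exact ih.trans ih'
    | rel x y hxy =>
      obtain ⟨⟨hx, hxf, hxm⟩, ⟨hy, hyf, hym⟩, hxy⟩ := hxy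
      obtain ⟨i, f⟩ := x
      obtain ⟨i', f'⟩ := y
      simp only [length_list] at hx hy hxy hxf hxm hyf hym
      rw [getD_list hx] at hxm hxy
      rw [getD_list hy] at hym hxy
      rcases hxy with ⟨rfl, hc, hm, hE⟩ | ⟨hi, rfl, hs⟩
      · have := ht.eq (inter_mem_edges hxf hc) hxf hyf (ne_of_inter_card hxf hc)
          Finset.inter_subset_left Finset.inter_subset_right hm
        rw [h.chain_apply, if_neg hE, CharTwo.add_eq_zero] at this
        simp only [I, this]
      · have hg : g i' = g (i + 1) := by rw [hi, h.inj]; exact Nat.mod_modEq _ _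
        rw [hg] at hs
        have h1 := ht.edgeCol_eq (h.edge_mem i) hxf hs
        rw [Finset.sum_pair (fun hii => h.not_modEq_add i one_pos (by omega) ((h.inj _ _).1 hii))]
          at h1
        have h2 : ∑ j ∈ Finset.range i', κ j = ∑ j ∈ Finset.range (i + 1), κ j := by
          rcases Nat.lt_or_ge (i + 1) n with hlt | hge
          · rw [hi, Nat.mod_eq_of_lt hlt]
          · have hn : i + 1 = n := by omega
            rw [hi, hn, Nat.mod_self, Finset.range_zero, Finset.sum_empty]
            exact h0.symm
        simp only [I]
        rw [h2, Finset.sum_range_succ, hg]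
        have h3 : κ i = t (g i) f + t (g (i + 1)) f := h1
        rw [h3]
        generalize t (g i) f = a
        generalize t (g (i + 1)) f = b
        generalize ∑ j ∈ Finset.range i, κ j = c
        clear * -
        decide +revert
  obtain ⟨a, b, hab, ha, hb, hea, heb, -⟩ := exists_two_faces (h.edge_mem 0)
  have hn : 0 < n := by have := h.three_le; omega
  have hcor : ∀ a ∈ T.faces, {g 0, g (0 + 1)} ⊆ a → T.IsCorner (list n g) (0, a) := by
    intro a ha hea
    refine ⟨by rw [length_list]; exact hn, ha, ?_⟩
    simp only [getD_list hn]
    exact hea (by simp)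
  have hab' := hI _ _ (hO _ _ (hcor a ha hea) (hcor b hb heb))
  have := ht.eq (h.edge_mem 0) ha hb hab hea heb (v := g 0) (by simp)
  rw [h.chain_apply, if_pos (h.mem_cycEdges.2 ⟨0, rfl⟩)] at this
  simp only [I, add_left_inj] at hab'
  rw [hab', CharTwo.add_self_eq_zero] at this
  exact zero_ne_one this

theorem oneSided (h : T.IsLoop n g) (h1 : T.inter (chain n g) (chain n g) = 1)
    (he : T.IsEven (chain n g)) : T.OneSided (list n g) := by
  have ht := he.isCol
  rw [ht.inter_eq he, h.pairing_chain] at h1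
  set t := T.col (chain n g)
  have hn : 0 < n := by have := h.three_le; omega
  let κ : ℕ → ZMod 2 := fun i => edgeCol T t {g i, g (i + 1)}
  obtain ⟨b, hb, heb⟩ := (mem_edges.1 (h.edge_mem 0)).2
  have hcorner : ∀ i < n, ∀ f, T.IsCorner (list n g) (i, f) ↔ f ∈ T.faces ∧ g i ∈ f := by
    intro i hi f
    simp only [IsCorner, length_list, getD_list hi, hi, true_and]
  let E := Relation.EqvGen (T.CornerRel (list n g))
  have hA : ∀ i < n, ∀ f ∈ T.faces, ∀ f' ∈ T.faces, g i ∈ f → g i ∈ f' → t (g i) f = t (g i) f' →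
      E (i, f) (i, f') := by
    intro i hi f hf f' hf' hif hif' htt
    let q : Finset ℕ → ZMod 2 := fun a => if E (i, f) (i, a) then 1 else 0
    have hq := h.eq_of_col_eq ht (i := i) (q := q) ?_ hf hf' hif hif' htt
    · by_contra hE
      have hEf : E (i, f) (i, f) := Relation.EqvGen.refl _
      simp [q, hE, hEf] at hq
    intro e he hv hE a ha c hc hac hea hec
    have hi' := inter_eq he ha hc hac hea hec
    have hrel : E (i, a) (i, c) := by
      refine Relation.EqvGen.rel _ _ ⟨(hcorner i hi a).2 ⟨ha, hea hv⟩,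
        (hcorner i hi c).2 ⟨hc, hec hv⟩, Or.inl ⟨rfl, ?_, ?_, ?_⟩⟩
      · simp only [hi', card_of_mem_edges he]
      · simp only [hi', getD_list hi, hv]
      · simpa only [hi'] using hE
    have : E (i, f) (i, a) ↔ E (i, f) (i, c) :=
      ⟨fun h => h.trans _ _ _ hrel, fun h => h.trans _ _ _ (hrel.symm _ _)⟩
    simp only [q, this]
  let P : ℕ → ZMod 2 → Prop := fun i a =>
    ∀ f ∈ T.faces, g i ∈ f → t (g i) f = a → E (0, b) (i % n, f)
  have hstep : ∀ i a, P i a → P (i + 1) (a + κ i) := by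
    intro i a hP f hf hif hta
    obtain ⟨c, d, hcd, hc, hd, hec, hed, -⟩ := exists_two_faces (h.edge_mem i)
    have hgi : g i ∈ ({g i, g (i + 1)} : Finset ℕ) := by simp
    have hgi1 : g (i + 1) ∈ ({g i, g (i + 1)} : Finset ℕ) := by simp
    have hsum := ht.eq (h.edge_mem i) hc hd hcd hec hed hgi
    rw [h.chain_apply, if_pos (h.mem_cycEdges.2 ⟨i, rfl⟩)] at hsum
    obtain ⟨r, hr, her, hra⟩ : ∃ r ∈ T.faces, {g i, g (i + 1)} ⊆ r ∧ t (g i) r = a := by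
      have hz : t (g i) c = a ∨ t (g i) d = a := by
        revert hsum
        generalize t (g i) c = p
        generalize t (g i) d = q
        clear * -
        decide +revert
      rcases hz with hz | hz
      · exact ⟨c, hc, hec, hz⟩
      · exact ⟨d, hd, hed, hz⟩
    have e1 := hP r hr (her hgi) hra
    have hlt : ∀ j, j % n < n := fun j => Nat.mod_lt _ hn
    have hgm : ∀ j, g (j % n) = g j := fun j => (h.inj _ _).2 (Nat.mod_modEq _ _)
    have e2 : E (i % n, r) ((i + 1) % n, r) := by
      refine Relation.EqvGen.rel _ _ ⟨(hcorner _ (hlt _) r).2 ⟨hr, ?_⟩,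
        (hcorner _ (hlt _) r).2 ⟨hr, ?_⟩, Or.inr ⟨?_, rfl, ?_⟩⟩
      · rw [hgm]; exact her hgi
      · rw [hgm]; exact her hgi1
      · simp only [length_list, Nat.mod_add_mod]
      · simp only [h.getD_list_mod]; exact her
    have h3 := ht.edgeCol_eq (h.edge_mem i) hr her
    rw [Finset.sum_pair (fun hii => h.not_modEq_add i one_pos (by omega) ((h.inj _ _).1 hii)),
      hra] at h3
    have h4 : κ i = a + t (g (i + 1)) r := h3
    have e3 : E ((i + 1) % n, r) ((i + 1) % n, f) := by
      refine hA _ (hlt _) r hr f hf ?_ ?_ ?_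
      · rw [hgm]; exact her hgi1
      · rw [hgm]; exact hif
      · rw [hgm, hta, h4, ← add_assoc, CharTwo.add_self_eq_zero, zero_add]
    exact (e1.trans _ _ _ e2).trans _ _ _ e3
  have hrun : ∀ a, P 0 a → ∀ i, P i (a + ∑ j ∈ Finset.range i, κ j) := by
    intro a ha i
    induction i with
    | zero => simpa using ha
    | succ i ih =>
      rw [Finset.sum_range_succ, ← add_assoc]
      exact hstep _ _ ih
  have hg0 : g 0 ∈ ({g 0, g (0 + 1)} : Finset ℕ) := by simp
  have hP0 : P 0 (t (g 0) b) := by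
    intro f hf h0f htf
    rw [Nat.zero_mod]
    exact hA 0 hn b hb f hf (heb hg0) h0f htf.symm
  have hP1 : P 0 (t (g 0) b + 1) := by
    have := hrun _ hP0 n
    rw [show ∑ j ∈ Finset.range n, κ j = 1 from h1] at this
    intro f hf h0f htf
    have hgn : g n = g 0 := (h.inj _ _).2 (by simp [Nat.ModEq])
    have h2 := this f hf (by rwa [hgn]) (by rwa [hgn])
    rwa [Nat.mod_self] at h2
  have hall : ∀ x, T.IsCorner (list n g) x → E (0, b) x := by
    rintro ⟨i, f⟩ hx
    have hi : i < n := by have := hx.1; rwa [length_list] at this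
    obtain ⟨hf, hif⟩ := (hcorner i hi f).1 hx
    have hz : t (g i) f = t (g 0) b + ∑ j ∈ Finset.range i, κ j ∨
        t (g i) f = t (g 0) b + 1 + ∑ j ∈ Finset.range i, κ j := by
      generalize t (g i) f = p
      generalize t (g 0) b = q
      generalize ∑ j ∈ Finset.range i, κ j = r
      clear * -
      decide +revert
    have key : E (0, b) (i % n, f) := by
      rcases hz with hz | hz
      · exact hrun _ hP0 i f hf hif hz
      · exact hrun _ hP1 i f hf hif hz
    rwa [Nat.mod_eq_of_lt hi] at key
  exact fun x y hx hy => ((hall x hx).symm _ _).trans _ _ _ (hall y hy)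

end IsLoop

end Triangulation

namespace SimpleGraph.Walk

variable {V : Type*} {G : SimpleGraph V}

theorem IsCycle.exists_adj {u x : V} {c : G.Walk u u} (hc : c.IsCycle) (hx : x ∈ c.support) :
    ∃ y, G.Adj x y :=
  ⟨_, (c.rotate x hx).adj_snd (hc.rotate hx).not_nil⟩

theorem IsCycle.three_le_card_support [DecidableEq V] {u : V} {c : G.Walk u u} (hc : c.IsCycle) :
    3 ≤ c.support.toFinset.card := by
  have h1 : c.support.tail.toFinset.card = c.length := by
    rw [List.toFinset_card_of_nodup hc.support_nodup, List.length_tail, length_support]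
    rfl
  have h2 : c.support.tail.toFinset ⊆ c.support.toFinset := fun x hx => by
    rw [List.mem_toFinset] at hx ⊢
    exact List.mem_of_mem_tail hx
  have := Finset.card_le_card h2
  have := hc.three_le_length
  omega

end SimpleGraph.Walk

namespace Triangulation

variable {T : Triangulation}

theorem mem_verts_of_mem_support {u x : ℕ} {c : T.graph.Walk u u} (hc : c.IsCycle)
    (hx : x ∈ c.support) : x ∈ T.verts := by
  obtain ⟨y, hy⟩ := hc.exists_adj hx
  exact mem_verts_of_mem_edges hy (by simp)

theorem exists_list {σ : Finset ℕ → ℕ × ℕ × ℕ} {m : Finset ℕ → ZMod 2} (hσ : T.Orients σ)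
    (hm : T.IsOriCls σ m) (hT : ¬ T.Orientable) {u : ℕ} {c : T.graph.Walk u u} (hc : c.IsCycle)
    (hB : ¬ T.IsBd (c.wlab edgeChain)) :
    ∃ l, T.IsCycle l ∧ ¬ T.Separating l ∧ (T.inter m (c.wlab edgeChain) = 1 → T.OneSided l) ∧
      (T.inter m (c.wlab edgeChain) = 0 → ¬ T.OneSided l) ∧
      (T.OrientableLeaving l ↔ T.IsBd (c.wlab edgeChain + m)) := by
  obtain ⟨n, g, h, hcg⟩ := exists_isLoop hc
  have he := isEven_wlab c
  rw [hm.inter_eq hσ he]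
  rw [hcg] at he hB ⊢
  exact ⟨IsLoop.list n g, h.isCycle_list, h.not_separating hB, fun h1 => h.oneSided h1 he,
    fun h0 => h.not_oneSided h0 he, h.orientableLeaving_iff hσ hm hT⟩

theorem zmod_two_cases (z : ZMod 2) : z = 0 ∨ z = 1 := by decide +revert

variable {m : Finset ℕ → ZMod 2} (hn : T.euler = 2 - ((3 : ℕ) : ℤ)) (hm : T.IsEven m)
  (hmB : ¬ T.IsBd m) (hwu : ∀ x, T.IsEven x → T.inter m x = T.inter x x)

theorem odd_split {x : Finset ℕ → ZMod 2} {f k : ℕ} {F : T.graph.Walk f f} (hF : F.IsCycle)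
    (hF1 : T.inter x (F.wlab edgeChain) = 1) {K : T.graph.Walk k k} (hK : K.IsCycle)
    (hK0 : T.inter x (K.wlab edgeChain) = 0) :
    ∃ (u v : ℕ) (D₁ : T.graph.Walk u u) (D₂ : T.graph.Walk v v), D₁.IsCycle ∧ D₂.IsCycle ∧
      T.inter x (D₁.wlab edgeChain) = 1 ∧ T.inter x (D₂.wlab edgeChain) = 1 ∧
      D₁.wlab edgeChain + D₂.wlab edgeChain = K.wlab edgeChain :=
  SimpleGraph.exists_odd_split (T.verts : Set ℕ)
    (fun A B hA hB hA2 hB2 => linkage (by omega) A B (Finset.coe_subset.1 hA)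
      (Finset.coe_subset.1 hB) hA2 hB2) edgeChain_comm (T.inter x) hF hF1 hK hK0
    (fun _ hx => mem_verts_of_mem_support hF hx) (fun _ hx => mem_verts_of_mem_support hK hx)

include hn hm hmB in
theorem exists_twoSided : ∃ (u : ℕ) (c : T.graph.Walk u u), c.IsCycle ∧
    ¬ T.IsBd (c.wlab edgeChain) ∧ T.inter m (c.wlab edgeChain) = 0 := by
  obtain ⟨u, C, hC, hC1⟩ := exists_cycle_inter_eq_one hm hmB
  obtain ⟨x, hx, hCx, hxB, -⟩ := exists_perp hn (C.wlab edgeChain) hm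
  obtain ⟨f, F, hF, hF1⟩ := exists_cycle_inter_eq_one hx hxB
  rw [inter_comm (isEven_wlab C) hx] at hCx
  obtain ⟨p, q, D₁, D₂, h1, h2, e1, e2, hs⟩ := odd_split hF hF1 hC hCx
  rw [← hs, map_add] at hC1
  have hB : ∀ y, T.inter x y = 1 → ¬ T.IsBd y := fun y h1 hy => by
    rw [inter_bd_right hx hy] at h1
    exact zero_ne_one h1
  rcases zmod_two_cases (T.inter m (D₁.wlab edgeChain)) with h | h
  · exact ⟨p, D₁, h1, hB _ e1, h⟩
  · refine ⟨q, D₂, h2, hB _ e2, ?_⟩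
    rw [h] at hC1
    exact add_eq_left.1 hC1

include hn hm hmB in
theorem exists_oneSided_nonorientable : ∃ (u : ℕ) (c : T.graph.Walk u u), c.IsCycle ∧
    ¬ T.IsBd (c.wlab edgeChain + m) ∧ T.inter m (c.wlab edgeChain) = 1 := by
  obtain ⟨k, K, hK, hKB, hK0⟩ := exists_twoSided hn hm hmB
  obtain ⟨c, C, hC, hC1⟩ := exists_cycle_inter_eq_one hm hmB
  obtain ⟨p, q, D₁, D₂, h1, h2, e1, e2, hs⟩ := odd_split hC hC1 hK hK0
  by_cases h : T.IsBd (D₁.wlab edgeChain + m)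
  · refine ⟨q, D₂, h2, fun h' => hKB ?_, e2⟩
    have := h.add h'
    rwa [add_add_add_comm, chain_add_self, add_zero, hs] at this
  · exact ⟨p, D₁, h1, h, e1⟩

/-- If the intersection number with `l` has a potential on the edges inside `X`, then every class
meeting `l` oddly meets a cycle avoiding `X` oddly. -/
theorem exists_cycle_avoiding (hm : T.IsEven m) {l : Finset ℕ → ZMod 2} (hl : T.IsEven l)
    (hlm : T.inter l m = 1) (X : Set ℕ) (p : ℕ → ZMod 2)
    (hp : ∀ u ∈ X, ∀ v ∈ X, T.graph.Adj u v → T.inter l (edgeChain u v) = p u + p v) :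
    ∃ (u : ℕ) (c : T.graph.Walk u u), c.IsCycle ∧ (∀ x ∈ c.support, x ∉ X) ∧
      T.inter m (c.wlab edgeChain) = 1 := by
  by_contra hno
  let H : SimpleGraph ℕ :=
    { Adj := fun u v => T.graph.Adj u v ∧ u ∉ X ∧ v ∉ X
      symm := ⟨fun u v h => ⟨h.1.symm, h.2.2, h.2.1⟩⟩
      loopless := ⟨fun u h => T.graph.loopless.irrefl u h.1⟩ }
  have hH : H ≤ T.graph := fun u v h => h.1
  obtain ⟨β, hβ⟩ := SimpleGraph.exists_potential (G := H)
    (l := fun u v => T.inter m (edgeChain u v)) (fun a b => by rw [edgeChain_comm])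
    (fun u c hc => by
      rw [← SimpleGraph.Walk.wlab_map, ← SimpleGraph.Walk.wlab_mapLe _ hH]
      refine (zmod_two_cases _).resolve_right fun h1 =>
        hno ⟨u, c.mapLe hH, hc.mapLe hH, fun x hx => ?_, h1⟩
      rw [SimpleGraph.Walk.support_mapLe_eq_support] at hx
      obtain ⟨y, hy⟩ := hc.exists_adj hx
      exact hy.2.1)
  have key : ∀ f ∈ T.faces, ∀ u ∈ f, u ∉ X → ∀ v ∈ f, v ∉ X →
      T.col m u f + β u = T.col m v f + β v := by
    intro f hf u hu huX v hv hvX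
    by_cases huv : u = v
    · rw [huv]
    have he := pair_mem_edges hf hu hv huv
    have hsub : ({u, v} : Finset ℕ) ⊆ f := by
      intro x hx
      rcases Finset.mem_insert.1 hx with rfl | hx
      · exact hu
      · exact Finset.mem_singleton.1 hx ▸ hv
    have h1 : T.inter m (edgeChain u v) = β u + β v := hβ u v ⟨he, huX, hvX⟩
    have h2 : T.inter m (edgeChain u v) = T.col m u f + T.col m v f := by
      rw [inter, pairing_edgeChain _ he, hm.isCol.edgeCol_eq he hf hsub, Finset.sum_pair huv]
    rw [h2] at h1
    clear * - h1
    generalize T.col m u f = a, T.col m v f = b, β u = c, β v = d at *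
    decide +revert
  let s : Finset ℕ → ZMod 2 := fun f =>
    if h : ∃ u ∈ f, u ∉ X then T.col m h.choose f + β h.choose else 0
  have hs : ∀ f ∈ T.faces, ∀ u ∈ f, u ∉ X → s f = T.col m u f + β u := by
    intro f hf u hu huX
    have h : ∃ u ∈ f, u ∉ X := ⟨u, hu, huX⟩
    simp only [s, dif_pos h]
    exact key f hf _ h.choose_spec.1 h.choose_spec.2 u hu huX
  let b : Finset ℕ → ZMod 2 := fun e => ∑ f ∈ T.faces with e ⊆ f, s f
  have hb : T.IsBd b := ⟨s, fun _ _ => rfl⟩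
  have h0 : T.inter l (m + b) = 0 := by
    refine pairing_eq_zero_of_potential (hm.add hb.isEven) p fun e he hne => ?_
    have hX : ∀ u ∈ e, u ∈ X := by
      intro u hu
      by_contra huX
      refine hne ?_
      obtain ⟨f, g, hfg, hf, hg, hef, heg, -⟩ := exists_two_faces he
      have hc := hm.isCol.eq he hf hg hfg hef heg hu
      have hbe : b e = s f + s g := sum_faces_edge he hf hg hfg hef heg s
      rw [Pi.add_apply, hbe, hs f hf u (hef hu) huX, hs g hg u (heg hu) huX, ← hc]
      clear * -
      generalize T.col m u f = a, T.col m u g = b, β u = c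
      decide +revert
    obtain ⟨u, v, huv, rfl⟩ := Finset.card_eq_two.1 (card_of_mem_edges he)
    rw [Finset.sum_pair huv, ← pairing_edgeChain _ he]
    exact hp u (hX u (by simp)) v (hX v (by simp)) he
  rw [map_add, hlm, inter_bd_right hl hb, add_zero] at h0
  exact one_ne_zero h0

theorem exists_shortest {P : ∀ u : ℕ, T.graph.Walk u u → Prop} (h : ∃ u c, P u c) :
    ∃ u c, P u c ∧ ∀ v (d : T.graph.Walk v v), P v d → c.length ≤ d.length := by
  have h' : ∃ n u, ∃ c : T.graph.Walk u u, P u c ∧ c.length = n := by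
    obtain ⟨u, c, hc⟩ := h
    exact ⟨_, u, c, hc, rfl⟩
  obtain ⟨u, c, hc, hn⟩ := Nat.find_spec h'
  exact ⟨u, c, hc, fun v d hd => hn ▸ Nat.find_min' h' ⟨v, d, hd, rfl⟩⟩

include hn hm hmB hwu in
theorem exists_isBd_add_of_disjoint {k c : ℕ} {K : T.graph.Walk k k} {C : T.graph.Walk c c}
    (hK : K.IsCycle) (hC : C.IsCycle) (hKB : ¬ T.IsBd (K.wlab edgeChain))
    (hK0 : T.inter m (K.wlab edgeChain) = 0) (hdis : ∀ x ∈ C.support, x ∉ K.support)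
    (hCm : T.IsBd (C.wlab edgeChain + (m + K.wlab edgeChain))) :
    ∃ (u : ℕ) (D : T.graph.Walk u u), D.IsCycle ∧ T.IsBd (D.wlab edgeChain + m) := by
  obtain ⟨α, hα⟩ := hC.exists_isArcPotential (L := edgeChain) edgeChain_comm
  obtain ⟨β, hβ⟩ := hK.exists_isArcPotential (L := edgeChain) edgeChain_comm
  obtain ⟨s, t, P, hP, hPP⟩ := linkage (T := T) le_rfl C.support.toFinset K.support.toFinset
    (fun x hx => mem_verts_of_mem_support hC (List.mem_toFinset.1 hx))
    (fun x hx => mem_verts_of_mem_support hK (List.mem_toFinset.1 hx))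
    hC.three_le_card_support hK.three_le_card_support
  simp only [List.mem_toFinset] at hP
  set y : Fin 3 → Finset ℕ → ZMod 2 := fun i => α (s i) + (P i).wlab edgeChain + β (t i) with hy
  obtain ⟨i, j, hij, hyij⟩ := Fintype.exists_ne_map_eq_of_card_lt
    (fun i => T.inter (K.wlab edgeChain) (y i)) (by simp [ZMod.card])
  have hD : ∀ ε ε' : ZMod 2, ∃ (u : ℕ) (D : T.graph.Walk u u), D.IsCycle ∧ D.wlab edgeChain =
      (y i + y j) + (ε • C.wlab edgeChain + ε' • K.wlab edgeChain) := fun ε ε' =>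
    SimpleGraph.exists_isCycle_of_two_paths edgeChain_comm hα hβ hdis (hP i).1 (hP j).1
      (hPP i j hij) (hP i).2.1 (hP j).2.1 (hP i).2.2.1 (hP j).2.2.1 (hP i).2.2.2.1
      (hP i).2.2.2.2 (hP j).2.2.2.1 (hP j).2.2.2.2 ε ε'
  have hw : T.IsEven (y i + y j) := by
    obtain ⟨u, D, -, h⟩ := hD 0 0
    have := isEven_wlab D
    rwa [h, zero_smul, zero_smul, add_zero, add_zero] at this
  have hkw : T.inter (K.wlab edgeChain) (y i + y j) = 0 := by
    rw [map_add]
    exact hyij ▸ CharTwo.add_self_eq_zero _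
  have hk := isEven_wlab K
  have hmm := inter_self_characteristic hn hm hmB hwu
  have hmkB : ¬ T.IsBd (m + K.wlab edgeChain) := fun h => by
    have := inter_bd_right hm h
    rw [map_add, hmm, hK0, add_zero] at this
    exact one_ne_zero this
  have hkm : T.inter (K.wlab edgeChain) m = 0 := by rw [inter_comm hk hm, hK0]
  have hkk : T.inter (K.wlab edgeChain) (K.wlab edgeChain) = 0 := by rw [← hwu _ hk, hK0]
  generalize y i + y j = w at *
  generalize K.wlab edgeChain = k at *
  generalize C.wlab edgeChain = c at *
  have fin : ∀ (ε ε' : ZMod 2) (z : Finset ℕ → ZMod 2), T.IsBd z →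
      w + (ε • c + ε' • k) + m = z →
      ∃ (u : ℕ) (D : T.graph.Walk u u), D.IsCycle ∧ T.IsBd (D.wlab edgeChain + m) := by
    intro ε ε' z hz h
    obtain ⟨u, D, hDc, hDe⟩ := hD ε ε'
    exact ⟨u, D, hDc, by rwa [hDe, h]⟩
  rcases isBd_cases hn hk hKB hkk hm hmB hmkB hkm hw hkw with h | h | h | h
  · refine fin 1 1 _ (h.add hCm) ?_
    rw [one_smul, one_smul]
    abel
  · refine fin 1 0 _ (h.add hCm) ?_
    have := chain_add_self k
    rw [one_smul, zero_smul, add_zero, show w + k + (c + (m + k)) = w + c + m + (k + k) by abel,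
      this, add_zero]
  · refine fin 0 0 _ h ?_
    rw [zero_smul, zero_smul, add_zero, add_zero]
  · refine fin 0 1 _ h ?_
    rw [one_smul, zero_smul, zero_add]
    abel

include hn hm hmB hwu in
/-- Some cycle represents the characteristic class. -/
theorem exists_cycle_characteristic : ∃ (u : ℕ) (D : T.graph.Walk u u), D.IsCycle ∧
    T.IsBd (D.wlab edgeChain + m) := by
  by_contra hno
  obtain ⟨k, K, ⟨hK, hKB, hK0⟩, hmin⟩ := exists_shortest (exists_twoSided hn hm hmB)
  obtain ⟨α, hα⟩ := hK.exists_isArcPotential (L := edgeChain) edgeChain_comm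
  have hk := isEven_wlab K
  have hmm := inter_self_characteristic hn hm hmB hwu
  have hkm : T.inter (K.wlab edgeChain) m = 0 := by rw [inter_comm hk hm, hK0]
  have hkk : T.inter (K.wlab edgeChain) (K.wlab edgeChain) = 0 := by rw [← hwu _ hk, hK0]
  have hl := hm.add hk
  have hlm : T.inter (m + K.wlab edgeChain) m = 1 := by
    rw [inter_add_left hm hk hm, hmm, hkm, add_zero]
  have hlk : T.inter (m + K.wlab edgeChain) (K.wlab edgeChain) = 0 := by
    rw [inter_add_left hm hk hk, hkk, hK0, add_zero]
  obtain ⟨c, C, hC, hCK, hC1⟩ := exists_cycle_avoiding hm hl hlm {x | x ∈ K.support}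
    (fun v => T.inter (m + K.wlab edgeChain) (α v)) fun u hu v hv huv => by
      rcases hα.chord edgeChain_comm hu hv huv with (h | h) | ⟨D₁, D₂, h1, h2, l1, -, e1, e2⟩
      · rw [h, map_add]
      · rw [h, map_add, hlk, zero_add, map_add]
      · have hd := isEven_wlab D₁
        have h0 : T.inter (m + K.wlab edgeChain) (D₁.wlab edgeChain) = 0 := by
          by_cases hB : T.IsBd (D₁.wlab edgeChain)
          · exact inter_bd_right hl hB
          rw [inter_add_left hm hk hd]
          rcases zmod_two_cases (T.inter m (D₁.wlab edgeChain)) with hm0 | hm1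
          · exact absurd (hmin _ D₁ ⟨h1, hB, hm0⟩) (not_le.2 l1)
          rcases zmod_two_cases (T.inter (K.wlab edgeChain) (D₁.wlab edgeChain)) with hd0 | hd1
          · rcases isBd_add_characteristic hn hm hmB hwu hk hKB hK0 hd hd0 hm1 with h | h
            · exact absurd ⟨_, D₁, h1, h⟩ hno
            · refine absurd ⟨_, D₂, h2, ?_⟩ hno
              rw [e2, ← e1, add_comm (K.wlab edgeChain), add_assoc, add_comm (K.wlab edgeChain)]
              exact h
          · rw [hm1, hd1]
            exact CharTwo.add_self_eq_zero _
        rw [e1, map_add, map_add] at h0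
        exact CharTwo.add_eq_zero.1 h0
  have hkC : T.inter (K.wlab edgeChain) (C.wlab edgeChain) = 0 :=
    hk.isCol.pairing_eq_zero_of_disjoint (isEven_wlab C) {x | x ∈ K.support}
      (fun e _ he => support_of_wlab K he) fun e _ he v hv => hCK v (support_of_wlab C he v hv)
  rcases isBd_add_characteristic hn hm hmB hwu hk hKB hK0 (isEven_wlab C) hkC hC1 with h | h
  · exact hno ⟨c, C, hC, h⟩
  · exact hno (exists_isBd_add_of_disjoint hn hm hmB hwu hK hC hKB hK0 hCK h)

end Triangulation

/-- Every triangulation of `N_3` has a nonseparating cycle which is one-sided and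
orientable-leaving; one which is one-sided and nonorientable-leaving; and one which is
two-sided and nonorientable-leaving. -/
theorem every_triangulation_n3_nonseparating :
    ∀ T : Triangulation, T.IsN 3 →
      (∃ c : List ℕ, T.IsCycle c ∧ ¬ T.Separating c ∧
        T.OneSided c ∧ T.OrientableLeaving c) ∧
      (∃ c : List ℕ, T.IsCycle c ∧ ¬ T.Separating c ∧
        T.OneSided c ∧ ¬ T.OrientableLeaving c) ∧
      (∃ c : List ℕ, T.IsCycle c ∧ ¬ T.Separating c ∧
        ¬ T.OneSided c ∧ ¬ T.OrientableLeaving c) := by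

  intro T ⟨hn, hT⟩
  obtain ⟨σ, hσ⟩ := T.exists_orients
  obtain ⟨m, hmσ⟩ := hσ.exists_isOriCls
  have hm := hmσ.isEven hσ
  have hmB := hmσ.not_isBd hσ hT
  have hwu := fun x (hx : T.IsEven x) => hmσ.inter_eq hσ hx
  have hmm := Triangulation.inter_self_characteristic hn hm hmB hwu
  have hodd : ∀ y, T.inter m y = 1 → ¬ T.IsBd y := fun y h1 hy => by
    rw [Triangulation.inter_bd_right hm hy] at h1
    exact zero_ne_one h1
  refine ⟨?_, ?_, ?_⟩
  · obtain ⟨u, D, hD, hDm⟩ := Triangulation.exists_cycle_characteristic hn hm hmB hwu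
    have h1 := (Triangulation.inter_congr_right hm hDm).trans hmm
    obtain ⟨l, hl, hs, h, -, ho⟩ := Triangulation.exists_list hσ hmσ hT hD (hodd _ h1)
    exact ⟨l, hl, hs, h h1, ho.2 hDm⟩
  · obtain ⟨u, D, hD, hDm, h1⟩ := Triangulation.exists_oneSided_nonorientable hn hm hmB
    obtain ⟨l, hl, hs, h, -, ho⟩ := Triangulation.exists_list hσ hmσ hT hD (hodd _ h1)
    exact ⟨l, hl, hs, h h1, fun h => hDm (ho.1 h)⟩
  · obtain ⟨u, D, hD, hDB, h0⟩ := Triangulation.exists_twoSided hn hm hmB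
    obtain ⟨l, hl, hs, -, h, ho⟩ := Triangulation.exists_list hσ hmσ hT hD hDB
    refine ⟨l, hl, hs, h h0, fun h => zero_ne_one (α := ZMod 2) ?_⟩
    rw [← h0, Triangulation.inter_congr_right hm (ho.1 h), hmm]
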